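/- There is a θ-invariant full-measure set Ω̃ such that for each ω ∈ Ω̃ the limit Φ(ω) := lim_{n→∞}(φ(n,ω)ᵀφ(n,ω))^{1/(2n)} exists with distinct eigenvalues e^{λ_p(ω)} < ⋯ < e^{λ_1(ω)} of multiplicities d_i(ω), and there exists a splitting ℝ^d = E_1(ω) ⊕ ⋯ ⊕ E_{p(ω)}(ω) into linear subspaces with dim E_i(ω) = d_i(ω) such that: (a) A(ω)E_i(ω) = E_i(θω) for each i; and (b) for x ∈ ℝ^d∖{0}, lim_{n→+∞}(1/n)log|φ(n,ω)x| = λ_i(ω) and lim_{n→−∞}(1/n)log|φ(n,ω)x| = λ_i(ω) hold simultaneously if and only if x ∈ E_i(ω)∖{0}. -/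

import Mathlib

open Matrix Filter Topology MeasureTheory

noncomputable section

/-- The Euclidean norm of a vector in `ℝ^d`. -/
def eNorm {ι : Type*} [Fintype ι] (x : ι → ℝ) : ℝ := Real.sqrt (∑ i, x i ^ 2)

/-- The operator norm of a matrix, with respect to the Euclidean norm. -/
def opNorm {ι : Type*} [Fintype ι] (M : Matrix ι ι ℝ) : ℝ :=
  ⨆ x : {x : ι → ℝ // eNorm x ≤ 1}, eNorm (M *ᵥ (x : ι → ℝ))

/-- Exponential growth rate at most `a`. -/
def Gr (f : ℕ → ℝ) (a : ℝ) : Prop :=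
  ∀ ε : ℝ, 0 < ε → ∀ᶠ n : ℕ in atTop, f n ≤ Real.exp (n * (a + ε))

theorem Gr.rate {f : ℕ → ℝ} {a b : ℝ} (h : Gr f a) (hab : a ≤ b) : Gr f b := by
  intro ε hε
  filter_upwards [h ε hε] with n hn
  refine hn.trans (Real.exp_le_exp.2 ?_)
  gcongr

theorem Gr.of_le_ev {f g : ℕ → ℝ} {a : ℝ} (h : Gr g a) (hfg : ∀ᶠ n in atTop, f n ≤ g n) :
    Gr f a := by
  intro ε hε
  filter_upwards [h ε hε, hfg] with n hn h2
  exact h2.trans hn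

theorem Gr.of_le {f g : ℕ → ℝ} {a : ℝ} (h : Gr g a) (hfg : ∀ n, f n ≤ g n) :
    Gr f a := h.of_le_ev (Eventually.of_forall hfg)

theorem exp_const_ev (C : ℝ) {ε : ℝ} (hε : 0 < ε) :
    ∀ᶠ n : ℕ in atTop, C ≤ Real.exp (n * ε) := by
  have h : Tendsto (fun n : ℕ => Real.exp (n * ε)) atTop atTop :=
    Real.tendsto_exp_atTop.comp (tendsto_natCast_atTop_atTop.atTop_mul_const hε)
  exact h.eventually_ge_atTop C

theorem Gr.const (C : ℝ) : Gr (fun _ => C) 0 := by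
  intro ε hε
  filter_upwards [exp_const_ev C hε] with n hn
  simpa using hn

theorem Gr.mul {f g : ℕ → ℝ} {a b : ℝ} (hf : Gr f a) (hg : Gr g b)
    (f0 : ∀ n, 0 ≤ f n) (g0 : ∀ n, 0 ≤ g n) : Gr (fun n => f n * g n) (a + b) := by
  intro ε hε
  filter_upwards [hf (ε/2) (by positivity), hg (ε/2) (by positivity)] with n h1 h2
  calc f n * g n ≤ Real.exp (n * (a + ε/2)) * Real.exp (n * (b + ε/2)) :=
        mul_le_mul h1 h2 (g0 n) (Real.exp_pos _).le
    _ = _ := by rw [← Real.exp_add]; ring_nf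

theorem Gr.const_mul {f : ℕ → ℝ} {a : ℝ} (hf : Gr f a) (C : ℝ) (hC : 0 ≤ C)
    (f0 : ∀ n, 0 ≤ f n) : Gr (fun n => C * f n) a := by
  have := (Gr.const C).mul hf (fun _ => hC) f0
  simpa using this

theorem Gr.zero (a : ℝ) : Gr (fun _ => 0) a := by
  intro ε hε
  exact Eventually.of_forall fun n => (Real.exp_pos _).le

theorem Gr.add {f g : ℕ → ℝ} {a : ℝ} (hf : Gr f a) (hg : Gr g a) :
    Gr (fun n => f n + g n) a := by
  intro ε hε
  filter_upwards [hf (ε/2) (by positivity), hg (ε/2) (by positivity),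
    exp_const_ev 2 (half_pos hε)] with n h1 h2 h3
  calc f n + g n ≤ 2 * Real.exp (n * (a + ε/2)) := by linarith
    _ ≤ Real.exp (n * (ε/2)) * Real.exp (n * (a + ε/2)) := by gcongr
    _ = _ := by rw [← Real.exp_add]; ring_nf

theorem Gr.sum {ι : Type*} (s : Finset ι) {f : ι → ℕ → ℝ} {a : ℝ} (h : ∀ i ∈ s, Gr (f i) a) :
    Gr (fun n => ∑ i ∈ s, f i n) a := by
  classical
  induction s using Finset.induction_on with
  | empty => simpa using Gr.zero a
  | insert i s hi ih =>
    simp only [Finset.sum_insert hi]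
    exact (h i (by simp)).add (ih fun j hj => h j (by simp [hj]))

theorem Gr.shift {f : ℕ → ℝ} {a : ℝ} (h : Gr f a) : Gr (fun n => f (n + 1)) a := by
  intro ε hε
  have h1 := (tendsto_add_atTop_nat 1).eventually (h (ε/2) (by positivity))
  filter_upwards [h1, exp_const_ev (Real.exp (a + ε/2)) (half_pos hε)] with n h1 h3
  calc f (n+1) ≤ Real.exp ((n+1 : ℕ) * (a + ε/2)) := h1
    _ = Real.exp (a + ε/2) * Real.exp (n * (a + ε/2)) := by
        rw [← Real.exp_add]; push_cast; ring_nf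
    _ ≤ Real.exp (n * (ε/2)) * Real.exp (n * (a + ε/2)) := by gcongr
    _ = _ := by rw [← Real.exp_add]; ring_nf

theorem Gr.unshift {f : ℕ → ℝ} {a : ℝ} (h : Gr (fun n => f (n + 1)) a) : Gr f a := by
  intro ε hε
  have h3 := exp_const_ev (Real.exp (-(a + ε/2))) (half_pos hε)
  have h1 := (h (ε/2) (by positivity))
  obtain ⟨N1, h1⟩ := eventually_atTop.1 h1
  obtain ⟨N3, h3⟩ := eventually_atTop.1 h3
  filter_upwards [eventually_ge_atTop (N1 + N3 + 1)] with n hn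
  obtain ⟨m, rfl⟩ : ∃ m, n = m + 1 := ⟨n - 1, by omega⟩
  calc f (m+1) ≤ Real.exp (m * (a + ε/2)) := h1 m (by omega)
    _ = Real.exp (-(a + ε/2)) * Real.exp ((m + 1 : ℕ) * (a + ε/2)) := by
        rw [← Real.exp_add]; push_cast; ring_nf
    _ ≤ Real.exp ((m + 1 : ℕ) * (ε/2)) * Real.exp ((m + 1 : ℕ) * (a + ε/2)) := by
        exact mul_le_mul_of_nonneg_right (h3 (m+1) (by omega)) (Real.exp_pos _).le
    _ = _ := by rw [← Real.exp_add]; ring_nf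

theorem Gr.tendsto_zero {f : ℕ → ℝ} {a : ℝ} (h : Gr f a) (ha : a < 0) (f0 : ∀ n, 0 ≤ f n) :
    Tendsto f atTop (𝓝 0) := by
  have h1 := h (-a/2) (by linarith)
  have h2 : Tendsto (fun n : ℕ => Real.exp (n * (a + -a/2))) atTop (𝓝 0) :=
    Real.tendsto_exp_atBot.comp
      (tendsto_natCast_atTop_atTop.atTop_mul_const_of_neg (by linarith))
  exact tendsto_of_tendsto_of_tendsto_of_le_of_le' tendsto_const_nhds h2
    (Eventually.of_forall f0) h1

theorem exp_nat_mul_pow (n : ℕ) (c : ℝ) : Real.exp (n * c) = Real.exp c ^ n := by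
  rw [← Real.exp_nat_mul]

theorem Gr.summable {f : ℕ → ℝ} {a : ℝ} (h : Gr f a) (ha : a < 0) (f0 : ∀ n, 0 ≤ f n) :
    Summable f := by
  have h1 := h (-a/2) (by linarith)
  obtain ⟨N, hN⟩ := eventually_atTop.1 h1
  rw [← summable_nat_add_iff N]
  have hs : Summable fun n : ℕ => Real.exp (a + -a/2) ^ n :=
    summable_geometric_of_lt_one (Real.exp_pos _).le (by rw [Real.exp_lt_one_iff]; linarith)
  refine Summable.of_nonneg_of_le (fun n => f0 _) (fun n => ?_) ((summable_nat_add_iff N).2 hs)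
  rw [← exp_nat_mul_pow]
  exact hN _ (by omega)

theorem Gr.telescope {f g : ℕ → ℝ} {a : ℝ} (hg : Gr g a) (ha : a < 0)
    (hf : Tendsto f atTop (𝓝 0)) (hfg : ∀ n, f n ≤ f (n + 1) + g n) : Gr f a := by
  intro ε hε
  set δ := min (ε/2) (-a/2) with hδ
  have hδ0 : 0 < δ := lt_min (by linarith) (by linarith)
  have hδ1 : a + δ < 0 := by have := min_le_right (ε/2) (-a/2); linarith
  have hδ2 : δ ≤ ε/2 := min_le_left _ _
  set r := Real.exp (a + δ) with hr
  have hr1 : r < 1 := by rw [hr, Real.exp_lt_one_iff]; exact hδ1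
  have hr0 : 0 < r := Real.exp_pos _
  obtain ⟨N, hN⟩ := eventually_atTop.1 (hg δ hδ0)
  have key : ∀ m n, N ≤ n → f n ≤ f (n + m) + r ^ n * (1 - r ^ m) / (1 - r) := by
    intro m
    induction m with
    | zero => intro n hn; simp
    | succ m ih =>
      intro n hn
      have h1 := ih (n+1) (by omega)
      have h2 := hN n hn
      rw [exp_nat_mul_pow] at h2
      have h3 := hfg n
      have h4 : r ^ n * (1 - r ^ (m + 1)) / (1 - r)
          = r ^ (n+1) * (1 - r ^ m) / (1 - r) + r ^ n := by
        have : 1 - r ≠ 0 := by linarith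
        field_simp; ring
      rw [h4, show n + (m + 1) = n + 1 + m by ring]
      linarith
  have key2 : ∀ n, N ≤ n → f n ≤ r ^ n * (1 / (1 - r)) := by
    intro n hn
    have ht : Tendsto (fun m => f (n + m) + r ^ n * (1 / (1 - r))) atTop
        (𝓝 (0 + r ^ n * (1 / (1 - r)))) := by
      refine Tendsto.add_const _ ?_
      have := (tendsto_add_atTop_iff_nat n).2 hf
      simpa [add_comm] using this
    rw [zero_add] at ht
    refine ge_of_tendsto' ht fun m => (key m n hn).trans ?_
    have h1 : 0 < 1 - r := by linarith
    rw [mul_div_assoc]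
    gcongr
    have : 0 < r ^ m := by positivity
    linarith
  filter_upwards [eventually_ge_atTop N, exp_const_ev (1 / (1 - r)) (half_pos hε)] with n h1 h2
  calc f n ≤ r ^ n * (1 / (1 - r)) := key2 n h1
    _ ≤ r ^ n * Real.exp (n * (ε/2)) := by gcongr
    _ = Real.exp (n * (a + δ + ε/2)) := by
      rw [hr, ← exp_nat_mul_pow, ← Real.exp_add]; ring_nf
    _ ≤ _ := by
      exact Real.exp_le_exp.2 (mul_le_mul_of_nonneg_left (by linarith) (Nat.cast_nonneg n))

theorem Gr.of_tendsto {f : ℕ → ℝ} {a : ℝ} (f0 : ∀ n, 0 < f n)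
    (h : Tendsto (fun n : ℕ => (1 / (n:ℝ)) * Real.log (f n)) atTop (𝓝 a)) : Gr f a := by
  intro ε hε
  filter_upwards [h.eventually_lt_const (show a < a + ε by linarith), eventually_gt_atTop 0]
    with n h1 h2
  have hn : (0:ℝ) < n := by exact_mod_cast h2
  rw [← Real.log_le_iff_le_exp (f0 n)]
  rw [one_div, inv_mul_lt_iff₀ hn] at h1
  exact h1.le

theorem Gr.of_tendsto_inv {f : ℕ → ℝ} {a : ℝ} (f0 : ∀ n, 0 < f n)
    (h : Tendsto (fun n : ℕ => (1 / (n:ℝ)) * Real.log (f n)) atTop (𝓝 a)) :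
    Gr (fun n => (f n)⁻¹) (-a) := by
  refine Gr.of_tendsto (fun n => inv_pos.2 (f0 n)) ?_
  simpa [Real.log_inv] using h.neg

theorem Gr.tendsto_log {f : ℕ → ℝ} {a : ℝ} (f0 : ∀ n, 0 < f n) (h : Gr f a)
    (h' : Gr (fun n => (f n)⁻¹) (-a)) :
    Tendsto (fun n : ℕ => (1 / (n:ℝ)) * Real.log (f n)) atTop (𝓝 a) := by
  rw [tendsto_order]
  constructor
  · intro b hb
    filter_upwards [h' ((a - b)/2) (by linarith), eventually_gt_atTop 0] with n h1 h2
    have hn : (0:ℝ) < n := by exact_mod_cast h2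
    rw [← Real.log_le_iff_le_exp (inv_pos.2 (f0 n)), Real.log_inv] at h1
    rw [one_div, lt_inv_mul_iff₀ hn]
    nlinarith
  · intro b hb
    filter_upwards [h ((b - a)/2) (by linarith), eventually_gt_atTop 0] with n h1 h2
    have hn : (0:ℝ) < n := by exact_mod_cast h2
    rw [← Real.log_le_iff_le_exp (f0 n)] at h1
    rw [one_div, inv_mul_lt_iff₀ hn]
    nlinarith

/-- Sum of the absolute values of all `k`-minors. -/
def mS {d : ℕ} (k : ℕ) (M : Matrix (Fin d) (Fin d) ℝ) : ℝ :=
  ∑ I : Fin k → Fin d, ∑ J : Fin k → Fin d, |(M.submatrix I J).det|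

theorem mS_nonneg {d : ℕ} (k : ℕ) (M : Matrix (Fin d) (Fin d) ℝ) : 0 ≤ mS k M :=
  Finset.sum_nonneg fun _ _ => Finset.sum_nonneg fun _ _ => abs_nonneg _

theorem le_mS {d k : ℕ} (M : Matrix (Fin d) (Fin d) ℝ) (I J : Fin k → Fin d) :
    |(M.submatrix I J).det| ≤ mS k M := by
  refine le_trans ?_ (Finset.single_le_sum (f := fun I => ∑ J : Fin k → Fin d,
    |(M.submatrix I J).det|) (fun _ _ => Finset.sum_nonneg fun _ _ => abs_nonneg _)
    (Finset.mem_univ I))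
  exact Finset.single_le_sum (f := fun J => |(M.submatrix I J).det|) (fun _ _ => abs_nonneg _)
    (Finset.mem_univ J)

theorem cauchyBinet_aux {d k : ℕ} (M N : Matrix (Fin d) (Fin d) ℝ) (I J : Fin k → Fin d) :
    ((M * N).submatrix I J).det =
      ∑ K : Fin k → Fin d, (∏ i, N (K i) (J i)) * (M.submatrix I K).det := by
  simp only [det_apply', submatrix_apply, mul_apply, Finset.prod_univ_sum, Finset.mul_sum,
    Fintype.piFinset_univ]
  rw [Finset.sum_comm]
  refine Finset.sum_congr rfl fun K _ => Finset.sum_congr rfl fun σ _ => ?_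
  rw [Finset.prod_mul_distrib]; ring

theorem cauchyBinet {d k : ℕ} (M N : Matrix (Fin d) (Fin d) ℝ) (I J : Fin k → Fin d) :
    (k.factorial : ℝ) * ((M * N).submatrix I J).det =
      ∑ K : Fin k → Fin d, (M.submatrix I K).det * (N.submatrix K J).det := by
  have h : ∀ τ : Equiv.Perm (Fin k), ((M * N).submatrix I J).det =
      ∑ K : Fin k → Fin d, (M.submatrix I K).det *
        ((Equiv.Perm.sign τ : ℤ) * ∏ i, N (K (τ i)) (J i)) := by
    intro τ
    rw [cauchyBinet_aux]
    let e : (Fin k → Fin d) ≃ (Fin k → Fin d) := Equiv.arrowCongr τ.symm (Equiv.refl _)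
    rw [← e.sum_comp]
    refine Finset.sum_congr rfl fun K _ => ?_
    have h1 : e K = K ∘ τ := by ext; simp [e, Equiv.arrowCongr]
    have h2 : (M.submatrix I (K ∘ τ)) = (M.submatrix I K).submatrix id τ := by
      ext; simp
    rw [h1, h2, det_permute']
    simp only [Function.comp]
    ring
  have h3 : (∑ τ : Equiv.Perm (Fin k), ((M * N).submatrix I J).det)
      = (k.factorial : ℝ) * ((M * N).submatrix I J).det := by
    rw [Finset.sum_const, Finset.card_univ, Fintype.card_perm, Fintype.card_fin, nsmul_eq_mul]
  rw [← h3, Finset.sum_congr rfl fun τ _ => h τ, Finset.sum_comm]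
  refine Finset.sum_congr rfl fun K _ => ?_
  rw [← Finset.mul_sum, det_apply' (N.submatrix K J)]
  rfl

theorem abs_minor_mul_le {d k : ℕ} (M N : Matrix (Fin d) (Fin d) ℝ) (I J : Fin k → Fin d) :
    |((M * N).submatrix I J).det| ≤
      ∑ K : Fin k → Fin d, |(M.submatrix I K).det| * |(N.submatrix K J).det| := by
  have h1 : (1:ℝ) ≤ k.factorial := by exact_mod_cast Nat.one_le_iff_ne_zero.2 k.factorial_ne_zero
  calc |((M * N).submatrix I J).det| ≤ (k.factorial : ℝ) * |((M * N).submatrix I J).det| :=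
        le_mul_of_one_le_left (abs_nonneg _) h1
    _ = |(k.factorial : ℝ) * ((M * N).submatrix I J).det| := by
        rw [abs_mul, abs_of_nonneg (by linarith : (0:ℝ) ≤ k.factorial)]
    _ ≤ _ := by
        rw [cauchyBinet]
        refine (Finset.abs_sum_le_sum_abs _ _).trans_eq ?_
        simp only [abs_mul]

theorem mS_mul_le {d : ℕ} (k : ℕ) (M N : Matrix (Fin d) (Fin d) ℝ) :
    mS k (M * N) ≤ mS k M * mS k N := by
  calc mS k (M * N) ≤ ∑ I : Fin k → Fin d, ∑ J : Fin k → Fin d, ∑ K : Fin k → Fin d,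
        |(M.submatrix I K).det| * |(N.submatrix K J).det| :=
        Finset.sum_le_sum fun I _ => Finset.sum_le_sum fun J _ => abs_minor_mul_le M N I J
    _ = ∑ I : Fin k → Fin d, ∑ K : Fin k → Fin d, |(M.submatrix I K).det| *
        ∑ J : Fin k → Fin d, |(N.submatrix K J).det| := by
        refine Finset.sum_congr rfl fun I _ => ?_
        rw [Finset.sum_comm]
        simp only [Finset.mul_sum]
    _ ≤ ∑ I : Fin k → Fin d, ∑ K : Fin k → Fin d, |(M.submatrix I K).det| * mS k N := by
        gcongr with I _ K _
        exact Finset.single_le_sum (f := fun K => ∑ J : Fin k → Fin d, |(N.submatrix K J).det|)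
          (fun _ _ => Finset.sum_nonneg fun _ _ => abs_nonneg _) (Finset.mem_univ K)
    _ = _ := by simp only [mS, Finset.sum_mul]

theorem one_le_mS_one {d k : ℕ} (hk : k ≤ d) : 1 ≤ mS k (1 : Matrix (Fin d) (Fin d) ℝ) := by
  have h := le_mS (1 : Matrix (Fin d) (Fin d) ℝ) (Fin.castLE hk) (Fin.castLE hk)
  rwa [submatrix_one _ (Fin.castLE_injective hk), det_one, abs_one] at h

theorem mS_pos {d k : ℕ} (hk : k ≤ d) (M N : Matrix (Fin d) (Fin d) ℝ) (h : M * N = 1) :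
    0 < mS k M := by
  have h1 := mS_mul_le k M N
  rw [h] at h1
  have h2 := one_le_mS_one (d := d) hk
  by_contra h3
  have h4 : mS k M = 0 := le_antisymm (not_lt.1 h3) (mS_nonneg _ _)
  rw [h4] at h1
  linarith

/-- a constant -/
def mC (d k : ℕ) : ℝ :=
  (Fintype.card (Fin k → Fin d) : ℝ) * ((Fintype.card (Fin k → Fin d) : ℝ) * k.factorial)

theorem mC_nonneg (d k : ℕ) : 0 ≤ mC d k := by unfold mC; positivity

theorem abs_det_le {k : ℕ} (M : Matrix (Fin k) (Fin k) ℝ) {a : ℝ} (h : ∀ i j, |M i j| ≤ a) :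
    |M.det| ≤ k.factorial * a ^ k := by
  have := Matrix.det_le (A := M) (abv := AbsoluteValue.abs) (x := a) h
  simpa using this

theorem mS_le_of_entries {d : ℕ} (k : ℕ) (M : Matrix (Fin d) (Fin d) ℝ) {a : ℝ}
    (h : ∀ i j, |M i j| ≤ a) : mS k M ≤ mC d k * a ^ k := by
  calc mS k M ≤ ∑ I : Fin k → Fin d, ∑ J : Fin k → Fin d, (k.factorial * a ^ k : ℝ) :=
        Finset.sum_le_sum fun I _ => Finset.sum_le_sum fun J _ =>
          abs_det_le _ fun i j => h _ _
    _ = _ := by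
        simp only [Finset.sum_const, Finset.card_univ, nsmul_eq_mul, mC]; ring

theorem laplace_col {d k : ℕ} (X : Matrix (Fin d) (Fin d) ℝ) (I J : Fin (k+1) → Fin d)
    (j : Fin (k+1)) :
    |(X.submatrix I J).det| ≤ (∑ i, |X i (J j)|) * ((k+1 : ℕ) * mS k X) := by
  rw [det_succ_column _ j]
  refine (Finset.abs_sum_le_sum_abs _ _).trans ?_
  calc _ ≤ ∑ i : Fin (k+1), (∑ i, |X i (J j)|) * mS k X := by
        refine Finset.sum_le_sum fun i _ => ?_
        rw [abs_mul, abs_mul, abs_pow, abs_neg, abs_one, one_pow, one_mul, submatrix_submatrix]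
        refine mul_le_mul ?_ (le_mS _ _ _) (abs_nonneg _)
          (Finset.sum_nonneg fun _ _ => abs_nonneg _)
        exact Finset.single_le_sum (f := fun i => |X i (J j)|) (fun _ _ => abs_nonneg _)
          (Finset.mem_univ (I i))
    _ = _ := by simp; ring

theorem mS_transpose {d : ℕ} (k : ℕ) (M : Matrix (Fin d) (Fin d) ℝ) : mS k Mᵀ = mS k M := by
  unfold mS
  rw [Finset.sum_comm]
  refine Finset.sum_congr rfl fun I _ => Finset.sum_congr rfl fun J _ => ?_
  rw [← transpose_submatrix, det_transpose]

theorem laplace_row {d k : ℕ} (X : Matrix (Fin d) (Fin d) ℝ) (I J : Fin (k+1) → Fin d)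
    (j : Fin (k+1)) :
    |(X.submatrix I J).det| ≤ (∑ i, |X (I j) i|) * ((k+1 : ℕ) * mS k X) := by
  have := laplace_col Xᵀ J I j
  rwa [← transpose_submatrix, det_transpose, mS_transpose] at this

theorem prod_antitone_le {d k : ℕ} (hk : k ≤ d) (s : Fin d → ℝ) (hs : Antitone s)
    (s0 : ∀ i, 0 ≤ s i) (J : Fin k → Fin d) (hJ : Function.Injective J) :
    ∏ i, s (J i) ≤ ∏ i : Fin k, s (Fin.castLE hk i) := by
  have hm : StrictMono (J ∘ Tuple.sort J) :=
    (Tuple.monotone_sort J).strictMono_of_injective (hJ.comp (Tuple.sort J).injective)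
  have hle : ∀ n (hn : n < k), n ≤ ((J ∘ Tuple.sort J) ⟨n, hn⟩).val := by
    intro n
    induction n with
    | zero => intro _; exact Nat.zero_le _
    | succ n ih =>
      intro hn
      have h1 := ih (by omega)
      have h2 : (J ∘ Tuple.sort J) ⟨n, by omega⟩ < (J ∘ Tuple.sort J) ⟨n+1, hn⟩ :=
        hm (by simp)
      have h3 : ((J ∘ Tuple.sort J) ⟨n, by omega⟩).val < ((J ∘ Tuple.sort J) ⟨n+1, hn⟩).val := h2
      omega
  rw [← Equiv.prod_comp (Tuple.sort J)]
  refine Finset.prod_le_prod (fun i _ => s0 _) fun i _ => hs ?_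
  exact hle i.1 i.2

theorem det_diag_sub {d k : ℕ} (s : Fin d → ℝ) (I J : Fin k → Fin d) :
    ((diagonal s).submatrix I J).det =
      (∏ i, s (J i)) * ((1 : Matrix (Fin d) (Fin d) ℝ).submatrix I J).det := by
  rw [← det_mul_row]
  congr 1
  ext i j
  simp only [submatrix_apply, of_apply, diagonal_apply, one_apply]
  split_ifs with h
  · rw [h, mul_one]
  · rw [mul_zero]

theorem mS_diag_le {d k : ℕ} (hk : k ≤ d) (s : Fin d → ℝ) (hs : Antitone s)
    (s0 : ∀ i, 0 ≤ s i) :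
    mS k (diagonal s) ≤ mC d k * ∏ i : Fin k, s (Fin.castLE hk i) := by
  have hP : 0 ≤ ∏ i : Fin k, s (Fin.castLE hk i) := Finset.prod_nonneg fun _ _ => s0 _
  calc mS k (diagonal s) ≤ ∑ I : Fin k → Fin d, ∑ J : Fin k → Fin d,
        (k.factorial * ∏ i : Fin k, s (Fin.castLE hk i) : ℝ) := by
        refine Finset.sum_le_sum fun I _ => Finset.sum_le_sum fun J _ => ?_
        rw [det_diag_sub, abs_mul, abs_of_nonneg (Finset.prod_nonneg fun _ _ => s0 _), mul_comm]
        by_cases hJ : Function.Injective J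
        · refine mul_le_mul ?_ (prod_antitone_le hk s hs s0 J hJ)
            (Finset.prod_nonneg fun _ _ => s0 _) (by positivity)
          have := abs_det_le ((1 : Matrix (Fin d) (Fin d) ℝ).submatrix I J) (a := 1) (by
            intro i j; simp only [submatrix_apply, one_apply]; split_ifs <;> simp)
          simpa using this
        · have : ((1 : Matrix (Fin d) (Fin d) ℝ).submatrix I J).det = 0 := by
            obtain ⟨a, b, hab, hne⟩ := Function.not_injective_iff.1 hJ
            refine det_zero_of_column_eq hne fun i => ?_
            rw [submatrix_apply, submatrix_apply, hab]
          rw [this]; simp; positivity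
    _ = _ := by simp only [Finset.sum_const, Finset.card_univ, nsmul_eq_mul, mC]; ring

theorem le_mS_diag {d k : ℕ} (hk : k ≤ d) (s : Fin d → ℝ) (s0 : ∀ i, 0 ≤ s i) :
    ∏ i : Fin k, s (Fin.castLE hk i) ≤ mS k (diagonal s) := by
  have h := le_mS (diagonal s) (Fin.castLE hk) (Fin.castLE hk)
  rwa [det_diag_sub, submatrix_one _ (Fin.castLE_injective hk), det_one, mul_one,
    abs_of_nonneg (Finset.prod_nonneg fun _ _ => s0 _)] at h

theorem orth_entry {d : ℕ} (U : Matrix (Fin d) (Fin d) ℝ) (h : Uᵀ * U = 1) (i j : Fin d) :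
    |U i j| ≤ 1 := by
  have h1 : (Uᵀ * U) j j = 1 := by rw [h]; simp
  rw [mul_apply] at h1
  simp only [transpose_apply] at h1
  have h2 : U i j * U i j ≤ ∑ x, U x j * U x j :=
    Finset.single_le_sum (f := fun x => U x j * U x j) (fun _ _ => mul_self_nonneg _)
      (Finset.mem_univ i)
  rw [h1] at h2
  exact abs_le_one_iff_mul_self_le_one.2 h2

/-- singular value decomposition -/
structure SVD {d : ℕ} (M U V : Matrix (Fin d) (Fin d) ℝ) (s : Fin d → ℝ) : Prop where
  hU : Uᵀ * U = 1
  hV : Vᵀ * V = 1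
  pos : ∀ j, 0 < s j
  eq : M = U * diagonal s * Vᵀ

theorem svd_exists {d : ℕ} (M : Matrix (Fin d) (Fin d) ℝ) (hM : IsUnit M) :
    ∃ U V s, SVD M U V s ∧ Antitone s := by
  have hpd : (Mᵀ * M).PosDef := by
    rw [← conjTranspose_eq_transpose_of_trivial]
    refine Matrix.PosDef.conjTranspose_mul_self _ ?_
    exact Matrix.mulVec_injective_iff_isUnit.2 hM
  have hH := hpd.isHermitian
  set W : Matrix (Fin d) (Fin d) ℝ := (hH.eigenvectorUnitary : Matrix (Fin d) (Fin d) ℝ) with hW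
  have hWW : Wᵀ * W = 1 := by
    have := Unitary.coe_star_mul_self hH.eigenvectorUnitary
    rwa [star_eq_conjTranspose, conjTranspose_eq_transpose_of_trivial] at this
  have hspec : Mᵀ * M = W * diagonal hH.eigenvalues * Wᵀ := by
    have := hH.spectral_theorem
    rwa [Unitary.conjStarAlgAut_apply, star_eq_conjTranspose,
      conjTranspose_eq_transpose_of_trivial] at this
  set e : Fin d → ℝ := fun j => -hH.eigenvalues j
  set τ := Tuple.sort e
  set s : Fin d → ℝ := fun j => Real.sqrt (hH.eigenvalues (τ j))
  have hspos : ∀ j, 0 < s j := fun j => Real.sqrt_pos.2 (hpd.eigenvalues_pos _)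
  have hanti : Antitone s := by
    intro i j hij
    have := Tuple.monotone_sort e hij
    simp only [Function.comp, e] at this
    exact Real.sqrt_le_sqrt (neg_le_neg_iff.1 this)
  set V := W.submatrix id τ
  have hV : Vᵀ * V = 1 := by
    have : Vᵀ * V = (Wᵀ * W).submatrix τ τ := by
      simp only [V, transpose_submatrix]
      rw [← Matrix.submatrix_mul _ _ _ _ _ Function.bijective_id]
    rw [this, hWW, submatrix_one _ τ.injective]
  have hMM : Vᵀ * (Mᵀ * M) * V = diagonal (fun j => s j ^ 2) := by
    have h1 : Wᵀ * (Mᵀ * M) * W = diagonal hH.eigenvalues := by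
      calc Wᵀ * (Mᵀ * M) * W = Wᵀ * (W * diagonal hH.eigenvalues * Wᵀ) * W :=
            congrArg (fun X => Wᵀ * X * W) hspec
        _ = (Wᵀ * W) * diagonal hH.eigenvalues * (Wᵀ * W) := by simp only [Matrix.mul_assoc]
        _ = _ := by rw [hWW]; simp
    have h2 : Vᵀ * (Mᵀ * M) * V = (Wᵀ * (Mᵀ * M) * W).submatrix τ τ := by
      ext i j; simp [V, mul_apply]
    rw [h2, h1, submatrix_diagonal _ _ τ.injective]
    congr 1
    ext j
    simp only [Function.comp, s]
    rw [Real.sq_sqrt (hpd.eigenvalues_pos _).le]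
  have hVV : V * Vᵀ = 1 := mul_eq_one_comm.1 hV
  refine ⟨M * V * diagonal (fun j => (s j)⁻¹), V, s, ⟨?_, hV, hspos, ?_⟩, hanti⟩
  · rw [transpose_mul, transpose_mul, diagonal_transpose]
    calc _ = diagonal (fun j => (s j)⁻¹) * (Vᵀ * (Mᵀ * M) * V) * diagonal (fun j => (s j)⁻¹) := by
          simp only [Matrix.mul_assoc]
      _ = 1 := by
          rw [hMM, diagonal_mul_diagonal, diagonal_mul_diagonal, ← diagonal_one]
          congr 1; ext j
          have := (hspos j).ne'
          field_simp
  · rw [Matrix.mul_assoc (M * V), diagonal_mul_diagonal]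
    have : (diagonal fun i => (s i)⁻¹ * s i) = (1 : Matrix (Fin d) (Fin d) ℝ) := by
      rw [← diagonal_one]; congr 1; ext j
      exact inv_mul_cancel₀ (hspos j).ne'
    rw [this, Matrix.mul_one, Matrix.mul_assoc, hVV, Matrix.mul_one]

theorem SVD.mS_le {d k : ℕ} (hk : k ≤ d) {M U V : Matrix (Fin d) (Fin d) ℝ} {s : Fin d → ℝ}
    (h : SVD M U V s) (hs : Antitone s) :
    mS k M ≤ mC d k ^ 3 * ∏ i : Fin k, s (Fin.castLE hk i) := by
  have hVt : ∀ i j, |Vᵀ i j| ≤ 1 := fun i j => orth_entry V h.hV j i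
  have h1 := mS_le_of_entries k U (orth_entry U h.hU)
  have h2 := mS_le_of_entries k Vᵀ hVt
  rw [one_pow, mul_one] at h1 h2
  have h3 := mS_diag_le hk s hs (fun i => (h.pos i).le)
  rw [h.eq]
  calc _ ≤ mS k (U * diagonal s) * mS k Vᵀ := mS_mul_le _ _ _
    _ ≤ (mS k U * mS k (diagonal s)) * mS k Vᵀ :=
        mul_le_mul_of_nonneg_right (mS_mul_le _ _ _) (mS_nonneg _ _)
    _ ≤ (mC d k * (mC d k * ∏ i : Fin k, s (Fin.castLE hk i))) * mC d k := by
        have := mC_nonneg d k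
        have := mS_nonneg k (diagonal s)
        have := mS_nonneg k Vᵀ
        have := mS_nonneg k U
        gcongr
        exact mul_nonneg (by assumption) ((mS_nonneg _ _).trans h3)
    _ = _ := by ring

theorem SVD.le_mS {d k : ℕ} (hk : k ≤ d) {M U V : Matrix (Fin d) (Fin d) ℝ} {s : Fin d → ℝ}
    (h : SVD M U V s) :
    ∏ i : Fin k, s (Fin.castLE hk i) ≤ mC d k ^ 2 * mS k M := by
  have hUt : ∀ i j, |Uᵀ i j| ≤ 1 := fun i j => orth_entry U h.hU j i
  have h1 := mS_le_of_entries k Uᵀ hUt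
  have h2 := mS_le_of_entries k V (orth_entry V h.hV)
  rw [one_pow, mul_one] at h1 h2
  have he : Uᵀ * M * V = diagonal s := by
    rw [h.eq]
    calc _ = (Uᵀ * U) * diagonal s * (Vᵀ * V) := by simp only [Matrix.mul_assoc]
      _ = _ := by rw [h.hU, h.hV]; simp
  refine (le_mS_diag hk s (fun i => (h.pos i).le)).trans ?_
  rw [← he]
  calc _ ≤ mS k (Uᵀ * M) * mS k V := mS_mul_le _ _ _
    _ ≤ (mS k Uᵀ * mS k M) * mS k V :=
        mul_le_mul_of_nonneg_right (mS_mul_le _ _ _) (mS_nonneg _ _)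
    _ ≤ (mC d k * mS k M) * mC d k := by
        have := mC_nonneg d k
        have := mS_nonneg k M
        have := mS_nonneg k V
        gcongr
    _ = _ := by ring

section

theorem eNorm_eq {d : ℕ} (x : Fin d → ℝ) : eNorm x = ‖WithLp.toLp 2 x‖ := by
  rw [EuclideanSpace.norm_eq, eNorm]; simp

theorem eNorm_nonneg {d : ℕ} (x : Fin d → ℝ) : 0 ≤ eNorm x := Real.sqrt_nonneg _

theorem eNorm_sq {d : ℕ} (x : Fin d → ℝ) : eNorm x ^ 2 = ∑ i, x i ^ 2 :=
  Real.sq_sqrt (Finset.sum_nonneg fun _ _ => sq_nonneg _)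

theorem eNorm_add_le {d : ℕ} (x y : Fin d → ℝ) : eNorm (x + y) ≤ eNorm x + eNorm y := by
  simp only [eNorm_eq, WithLp.toLp_add]; exact norm_add_le _ _

theorem eNorm_smul {d : ℕ} (c : ℝ) (x : Fin d → ℝ) : eNorm (c • x) = |c| * eNorm x := by
  simp only [eNorm_eq, WithLp.toLp_smul, norm_smul, Real.norm_eq_abs]

theorem eNorm_zero {d : ℕ} : eNorm (0 : Fin d → ℝ) = 0 := by simp [eNorm]

theorem abs_le_eNorm {d : ℕ} (x : Fin d → ℝ) (i : Fin d) : |x i| ≤ eNorm x := by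
  rw [← Real.sqrt_sq_eq_abs]
  exact Real.sqrt_le_sqrt (Finset.single_le_sum (f := fun i => x i ^ 2)
    (fun _ _ => sq_nonneg _) (Finset.mem_univ i))

theorem eNorm_le_sum {d : ℕ} (x : Fin d → ℝ) : eNorm x ≤ ∑ i, |x i| := by
  refine Real.sqrt_le_iff.2 ⟨Finset.sum_nonneg fun _ _ => abs_nonneg _, ?_⟩
  have := Finset.sum_sq_le_sq_sum_of_nonneg (s := Finset.univ) (f := fun i => |x i|)
    (fun _ _ => abs_nonneg _)
  simpa using this

theorem eNorm_pos {d : ℕ} {x : Fin d → ℝ} (hx : x ≠ 0) : 0 < eNorm x := by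
  rw [eNorm_eq, norm_pos_iff]
  intro h
  apply hx
  have := congrArg WithLp.ofLp h
  simpa using this

theorem eNorm_orth {d : ℕ} (U : Matrix (Fin d) (Fin d) ℝ) (h : Uᵀ * U = 1) (x : Fin d → ℝ) :
    eNorm (U *ᵥ x) = eNorm x := by
  have h1 : ∀ y : Fin d → ℝ, ∑ i, y i ^ 2 = y ⬝ᵥ y := fun y => by
    simp [dotProduct, sq]
  unfold eNorm
  rw [h1, h1, dotProduct_mulVec, vecMul_mulVec, h, Matrix.vecMul_one]

theorem orth_conj_le {d : ℕ} (P C Q : Matrix (Fin d) (Fin d) ℝ) (hP : Pᵀ * P = 1)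
    (hQ : Qᵀ * Q = 1) (i j : Fin d) :
    |(Pᵀ * C * Q) i j| ≤ ∑ a, ∑ b, |C a b| := by
  rw [mul_apply]
  refine (Finset.abs_sum_le_sum_abs _ _).trans ?_
  rw [Finset.sum_comm]
  refine Finset.sum_le_sum fun b _ => ?_
  rw [abs_mul, mul_apply]
  calc _ ≤ |∑ a, Pᵀ i a * C a b| * 1 :=
        mul_le_mul_of_nonneg_left (orth_entry Q hQ b j) (abs_nonneg _)
    _ ≤ ∑ a, |Pᵀ i a * C a b| := by rw [mul_one]; exact Finset.abs_sum_le_sum_abs _ _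
    _ ≤ _ := by
        refine Finset.sum_le_sum fun a _ => ?_
        rw [abs_mul]
        have := orth_entry P hP a i
        calc _ ≤ 1 * |C a b| := mul_le_mul_of_nonneg_right this (abs_nonneg _)
          _ = _ := one_mul _

/-- one sided regular cocycle data -/
structure Coc {d : ℕ} (M A B U V : ℕ → Matrix (Fin d) (Fin d) ℝ) (s : ℕ → Fin d → ℝ)
    (l : Fin d → ℝ) : Prop where
  svd : ∀ n, SVD (M n) (U n) (V n) (s n)
  step : ∀ n, M (n+1) = A n * M n
  inv : ∀ n, B n * A n = 1
  gA : ∀ i j, Gr (fun n => |A n i j|) 0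
  gB : ∀ i j, Gr (fun n => |B n i j|) 0
  gs : ∀ j, Gr (fun n => s n j) (l j)
  gs' : ∀ j, Gr (fun n => (s n j)⁻¹) (-l j)

variable {d : ℕ} {M A B U V : ℕ → Matrix (Fin d) (Fin d) ℝ} {s : ℕ → Fin d → ℝ} {l : Fin d → ℝ}

theorem SVD.inter {M U V M' U' V' C : Matrix (Fin d) (Fin d) ℝ} {s s' : Fin d → ℝ}
    (h : SVD M U V s) (h' : SVD M' U' V' s') (e : M = C * M') (i j : Fin d) :
    s i * (Vᵀ * V') i j = (Uᵀ * C * U') i j * s' j := by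
  have h1 : diagonal s * (Vᵀ * V') = (Uᵀ * C * U') * diagonal s' := by
    calc diagonal s * (Vᵀ * V') = (Uᵀ * U) * diagonal s * (Vᵀ * V') := by rw [h.hU, Matrix.one_mul]
      _ = Uᵀ * (U * diagonal s * Vᵀ) * V' := by simp only [Matrix.mul_assoc]
      _ = Uᵀ * (C * (U' * diagonal s' * V'ᵀ)) * V' := by rw [← h.eq, e, ← h'.eq]
      _ = Uᵀ * C * U' * diagonal s' * (V'ᵀ * V') := by simp only [Matrix.mul_assoc]
      _ = _ := by rw [h'.hV, Matrix.mul_one]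
  have := congrFun (congrFun h1 i) j
  rwa [diagonal_mul, mul_diagonal] at this

theorem SVD.inter_le {M U V M' U' V' C : Matrix (Fin d) (Fin d) ℝ} {s s' : Fin d → ℝ}
    (h : SVD M U V s) (h' : SVD M' U' V' s') (e : M = C * M') (i j : Fin d) :
    |(Vᵀ * V') i j| ≤ (s i)⁻¹ * ((∑ a, ∑ b, |C a b|) * s' j) := by
  have h1 := h.inter h' e i j
  have h2 := orth_conj_le U C U' h.hU h'.hU i j
  have h3 : (Vᵀ * V') i j = (s i)⁻¹ * ((Uᵀ * C * U') i j * s' j) := by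
    rw [← h1]; have := (h.pos i).ne'; field_simp
  rw [h3, abs_mul, abs_mul, abs_of_pos (inv_pos.2 (h.pos i)), abs_of_pos (h'.pos j)]
  have := inv_pos.2 (h.pos i)
  have := h'.pos j
  gcongr

theorem Coc.grO (h : Coc M A B U V s l) (i j : Fin d) :
    Gr (fun n => |((V n)ᵀ * V (n+1)) i j|) (-|l i - l j|) := by
  have e1 : ∀ n, M n = B n * M (n+1) := fun n => by
    rw [h.step, ← Matrix.mul_assoc, h.inv, Matrix.one_mul]
  have hB : Gr (fun n => ∑ a, ∑ b, |B n a b|) 0 :=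
    Gr.sum _ fun a _ => Gr.sum _ fun b _ => h.gB a b
  have hA : Gr (fun n => ∑ a, ∑ b, |A n a b|) 0 :=
    Gr.sum _ fun a _ => Gr.sum _ fun b _ => h.gA a b
  have p1 : Gr (fun n => |((V n)ᵀ * V (n+1)) i j|) (-l i + (0 + l j)) := by
    refine Gr.of_le ((h.gs' i).mul (hB.mul (h.gs j).shift ?_ ?_) ?_ ?_)
      (fun n => (h.svd n).inter_le (h.svd (n+1)) (e1 n) i j)
    · intro n; positivity
    · intro n; exact ((h.svd _).pos j).le
    · intro n; exact (inv_pos.2 ((h.svd _).pos i)).le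
    · intro n; exact mul_nonneg (by positivity) ((h.svd _).pos j).le
  have p2 : Gr (fun n => |((V n)ᵀ * V (n+1)) i j|) (-l j + (0 + l i)) := by
    refine Gr.of_le ((h.gs' j).shift.mul (hA.mul (h.gs i) ?_ ?_) ?_ ?_)
      (fun n => ?_)
    · intro n; positivity
    · intro n; exact ((h.svd _).pos i).le
    · intro n; exact (inv_pos.2 ((h.svd _).pos j)).le
    · intro n; exact mul_nonneg (by positivity) ((h.svd _).pos i).le
    · have := (h.svd (n+1)).inter_le (h.svd n) (h.step n) j i
      have e : ((V n)ᵀ * V (n+1)) i j = ((V (n+1))ᵀ * V n) j i := by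
        rw [← transpose_apply ((V (n+1))ᵀ * V n), transpose_mul, transpose_transpose]
      rwa [e]
  rcases le_total (l i) (l j) with hl | hl
  · refine p2.rate (le_of_eq ?_)
    rw [abs_of_nonpos (by linarith)]; ring
  · refine p1.rate (le_of_eq ?_)
    rw [abs_of_nonneg (by linarith)]; ring

theorem Coc.step_le (h : Coc M A B U V s l) (f : ℝ → ℝ) (n : ℕ) (a b : Fin d) :
    |(V (n+1) * diagonal (fun j => f (l j)) * (V (n+1))ᵀ) a b
      - (V n * diagonal (fun j => f (l j)) * (V n)ᵀ) a b|
      ≤ ∑ i, ∑ j, |f (l j) - f (l i)| * |((V n)ᵀ * V (n+1)) i j| := by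
  set D := diagonal (fun j => f (l j))
  set O := (V n)ᵀ * V (n+1)
  have hV1 : V n * (V n)ᵀ = 1 := mul_eq_one_comm.1 (h.svd n).hV
  have hV2 : V (n+1) * (V (n+1))ᵀ = 1 := mul_eq_one_comm.1 (h.svd (n+1)).hV
  have e : V (n+1) * D * (V (n+1))ᵀ - V n * D * (V n)ᵀ
      = V n * (O * D - D * O) * (V (n+1))ᵀ := by
    rw [Matrix.mul_sub, Matrix.sub_mul]
    congr 1
    · calc _ = 1 * (V (n+1) * D * (V (n+1))ᵀ) := by rw [Matrix.one_mul]
        _ = _ := by rw [← hV1]; simp only [O, Matrix.mul_assoc]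
    · calc _ = V n * D * (V n)ᵀ * 1 := by rw [Matrix.mul_one]
        _ = _ := by rw [← hV2]; simp only [O, Matrix.mul_assoc]
  rw [← Matrix.sub_apply, e]
  have := orth_conj_le (V n)ᵀ (O * D - D * O) (V (n+1))ᵀ (by rw [transpose_transpose, hV1])
    (by rw [transpose_transpose, hV2]) a b
  rw [transpose_transpose] at this
  refine this.trans (le_of_eq ?_)
  refine Finset.sum_congr rfl fun i _ => Finset.sum_congr rfl fun j _ => ?_
  rw [Matrix.sub_apply, mul_diagonal, diagonal_mul, ← abs_mul]
  congr 1; ring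

theorem Coc.conv (h : Coc M A B U V s l) (f : ℝ → ℝ) :
    ∃ Ψ : Matrix (Fin d) (Fin d) ℝ,
      Tendsto (fun n => V n * diagonal (fun j => f (l j)) * (V n)ᵀ) atTop (𝓝 Ψ) := by
  have key : ∀ a b, ∃ y : ℝ,
      Tendsto (fun n => (V n * diagonal (fun j => f (l j)) * (V n)ᵀ) a b) atTop (𝓝 y) := by
    intro a b
    refine cauchySeq_tendsto_of_complete (cauchySeq_of_summable_dist ?_)
    have hs : Summable fun n => ∑ i, ∑ j, |f (l j) - f (l i)| * |((V n)ᵀ * V (n+1)) i j| := by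
      refine summable_sum fun i _ => summable_sum fun j _ => ?_
      by_cases hij : l i = l j
      · simp [hij, summable_zero]
      · exact ((h.grO i j).summable
          (by have := abs_pos.2 (sub_ne_zero.2 hij); linarith) (fun _ => abs_nonneg _)).mul_left _
    refine Summable.of_nonneg_of_le (fun _ => dist_nonneg) (fun n => ?_) hs
    rw [dist_comm, Real.dist_eq]
    exact h.step_le f n a b
  choose Ψ hΨ using key
  refine ⟨Ψ, ?_⟩
  exact tendsto_pi_nhds.2 fun a => tendsto_pi_nhds.2 fun b => hΨ a b

theorem Coc.limit (h : Coc M A B U V s l) :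
    ∃ W : Matrix (Fin d) (Fin d) ℝ, Wᵀ * W = 1 ∧ ∀ f : ℝ → ℝ,
      Tendsto (fun n => V n * diagonal (fun j => f (l j)) * (V n)ᵀ) atTop
        (𝓝 (W * diagonal (fun j => f (l j)) * Wᵀ)) := by
  have hc : IsCompact (Set.Icc (fun _ _ => -1 : Fin d → Fin d → ℝ) (fun _ _ => 1)) := isCompact_Icc
  have hm : ∀ n, (V n : Fin d → Fin d → ℝ) ∈
      Set.Icc (fun _ _ => -1 : Fin d → Fin d → ℝ) (fun _ _ => 1) := fun n =>
    ⟨fun i j => (abs_le.1 (orth_entry _ (h.svd n).hV i j)).1,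
      fun i j => (abs_le.1 (orth_entry _ (h.svd n).hV i j)).2⟩
  obtain ⟨W, ψ, hψ, hW'⟩ : ∃ (W : Matrix (Fin d) (Fin d) ℝ) (ψ : ℕ → ℕ), StrictMono ψ ∧
      Tendsto (fun n => V (ψ n)) atTop (𝓝 W) := by
    obtain ⟨W, -, ψ, hψ, hW⟩ := hc.tendsto_subseq hm
    exact ⟨W, ψ, hψ, hW⟩
  refine ⟨W, ?_, fun f => ?_⟩
  · have h1 : Tendsto (fun n => (V (ψ n))ᵀ * V (ψ n)) atTop (𝓝 (Wᵀ * W)) := by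
      have : Continuous fun X : Matrix (Fin d) (Fin d) ℝ => Xᵀ * X := by fun_prop
      exact (this.tendsto _).comp hW'
    refine tendsto_nhds_unique h1 ?_
    simp only [(h.svd _).hV]
    exact tendsto_const_nhds
  · obtain ⟨Ψ, hΨ⟩ := h.conv f
    have h1 : Tendsto (fun n => V (ψ n) * diagonal (fun j => f (l j)) * (V (ψ n))ᵀ) atTop
        (𝓝 (W * diagonal (fun j => f (l j)) * Wᵀ)) := by
      have : Continuous fun X : Matrix (Fin d) (Fin d) ℝ =>
        X * diagonal (fun j => f (l j)) * Xᵀ := by fun_prop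
      exact (this.tendsto _).comp hW'
    have h2 := hΨ.comp hψ.tendsto_atTop
    rw [← tendsto_nhds_unique h2 h1]
    exact hΨ

end

section

/-- coordinate subspace in an orthonormal basis -/
def cSub {d : ℕ} (W : Matrix (Fin d) (Fin d) ℝ) (S : Finset (Fin d)) :
    Submodule ℝ (Fin d → ℝ) where
  carrier := {x | ∀ j, j ∉ S → (Wᵀ *ᵥ x) j = 0}
  add_mem' := by
    intro a b ha hb j hj
    rw [mulVec_add, Pi.add_apply, ha j hj, hb j hj, add_zero]
  zero_mem' := by intro j hj; simp
  smul_mem' := by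
    intro c x hx j hj
    rw [mulVec_smul, Pi.smul_apply, hx j hj, smul_zero]

theorem mem_cSub {d : ℕ} {W : Matrix (Fin d) (Fin d) ℝ} {S : Finset (Fin d)} {x : Fin d → ℝ} :
    x ∈ cSub W S ↔ ∀ j, j ∉ S → (Wᵀ *ᵥ x) j = 0 := Iff.rfl

theorem finrank_cSub {d : ℕ} (W : Matrix (Fin d) (Fin d) ℝ) (hW : Wᵀ * W = 1)
    (S : Finset (Fin d)) : Module.finrank ℝ (cSub W S) = S.card := by
  have hWW : W * Wᵀ = 1 := mul_eq_one_comm.1 hW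
  have e : cSub W S ≃ₗ[ℝ] (S → ℝ) :=
    { toFun := fun x j => (Wᵀ *ᵥ (x : Fin d → ℝ)) j
      map_add' := by intro x y; ext j; simp [mulVec_add]
      map_smul' := by intro c x; ext j; simp [mulVec_smul]
      invFun := fun y => ⟨W *ᵥ (fun j => if h : j ∈ S then y ⟨j, h⟩ else 0), by
        intro j hj
        rw [mulVec_mulVec, hW, one_mulVec]
        simp [hj]⟩
      left_inv := by
        intro x
        ext1
        have : (fun j => if h : j ∈ S then (Wᵀ *ᵥ (x : Fin d → ℝ)) j else 0)
            = Wᵀ *ᵥ (x : Fin d → ℝ) := by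
          ext j
          by_cases hj : j ∈ S
          · simp [hj]
          · simp [hj, x.2 j hj]
        simp only [this]
        rw [mulVec_mulVec, hWW, one_mulVec]
      right_inv := by
        intro y
        ext j
        simp only
        rw [mulVec_mulVec, hW, one_mulVec]
        simp }
  rw [e.finrank_eq, Module.finrank_fintype_fun_eq_card, Fintype.card_coe]

/-- slow growth space -/
def slow {d : ℕ} (M : ℕ → Matrix (Fin d) (Fin d) ℝ) (μ : ℝ) : Submodule ℝ (Fin d → ℝ) where
  carrier := {x | Gr (fun n => eNorm (M n *ᵥ x)) μ}
  add_mem' := by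
    intro a b ha hb
    refine Gr.of_le (Gr.add ha hb) fun n => ?_
    rw [mulVec_add]; exact eNorm_add_le _ _
  zero_mem' := by
    refine Gr.of_le (Gr.zero μ) fun n => ?_
    rw [mulVec_zero, eNorm_zero]
  smul_mem' := by
    intro c x hx
    refine Gr.of_le (Gr.const_mul hx |c| (abs_nonneg _) fun n => eNorm_nonneg _) fun n => ?_
    rw [mulVec_smul, eNorm_smul]

theorem mem_slow {d : ℕ} {M : ℕ → Matrix (Fin d) (Fin d) ℝ} {μ : ℝ} {x : Fin d → ℝ} :
    x ∈ slow M μ ↔ Gr (fun n => eNorm (M n *ᵥ x)) μ := Iff.rfl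

/-- limiting right singular basis -/
structure LimW {d : ℕ} (V : ℕ → Matrix (Fin d) (Fin d) ℝ) (l : Fin d → ℝ)
    (W : Matrix (Fin d) (Fin d) ℝ) : Prop where
  orth : Wᵀ * W = 1
  lim : ∀ f : ℝ → ℝ,
      Tendsto (fun n => V n * diagonal (fun j => f (l j)) * (V n)ᵀ) atTop
        (𝓝 (W * diagonal (fun j => f (l j)) * Wᵀ))

variable {d : ℕ} {M A B U V : ℕ → Matrix (Fin d) (Fin d) ℝ} {s : ℕ → Fin d → ℝ} {l : Fin d → ℝ}
  {W : Matrix (Fin d) (Fin d) ℝ}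

theorem quad_diag (V : Matrix (Fin d) (Fin d) ℝ) (g : Fin d → ℝ) (x : Fin d → ℝ) :
    x ⬝ᵥ ((V * diagonal g * Vᵀ) *ᵥ x) = ∑ j, g j * (Vᵀ *ᵥ x) j ^ 2 := by
  rw [← mulVec_mulVec, ← mulVec_mulVec, dotProduct_mulVec, ← mulVec_transpose]
  simp only [dotProduct, mulVec_diagonal]
  refine Finset.sum_congr rfl fun j _ => by ring

theorem LimW.quad (hW : LimW V l W) (f : ℝ → ℝ) (x : Fin d → ℝ) :
    Tendsto (fun n => ∑ j, f (l j) * ((V n)ᵀ *ᵥ x) j ^ 2) atTop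
      (𝓝 (∑ j, f (l j) * (Wᵀ *ᵥ x) j ^ 2)) := by
  simp only [← quad_diag (g := fun j => f (l j))]
  have : Continuous fun X : Matrix (Fin d) (Fin d) ℝ => x ⬝ᵥ (X *ᵥ x) := by fun_prop
  exact (this.tendsto _).comp (hW.lim f)

theorem SVD.mulVec_norm {M U V : Matrix (Fin d) (Fin d) ℝ} {s : Fin d → ℝ} (h : SVD M U V s)
    (x : Fin d → ℝ) : eNorm (M *ᵥ x) = eNorm (fun j => s j * (Vᵀ *ᵥ x) j) := by
  rw [h.eq, ← mulVec_mulVec, ← mulVec_mulVec, eNorm_orth _ h.hU]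
  congr 1
  ext j
  rw [mulVec_diagonal]

theorem SVD.coord_le {M U V : Matrix (Fin d) (Fin d) ℝ} {s : Fin d → ℝ} (h : SVD M U V s)
    (x : Fin d → ℝ) (j : Fin d) : |(Vᵀ *ᵥ x) j| ≤ (s j)⁻¹ * eNorm (M *ᵥ x) := by
  have := abs_le_eNorm (fun j => s j * (Vᵀ *ᵥ x) j) j
  rw [← h.mulVec_norm, abs_mul, abs_of_pos (h.pos j)] at this
  rw [inv_mul_eq_div, le_div_iff₀ (h.pos j), mul_comm]
  exact this

theorem SVD.norm_le {M U V : Matrix (Fin d) (Fin d) ℝ} {s : Fin d → ℝ} (h : SVD M U V s)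
    (x : Fin d → ℝ) : eNorm (M *ᵥ x) ≤ ∑ j, s j * |(Vᵀ *ᵥ x) j| := by
  rw [h.mulVec_norm]
  refine (eNorm_le_sum _).trans (le_of_eq (Finset.sum_congr rfl fun j _ => ?_))
  rw [abs_mul, abs_of_pos (h.pos j)]

/-- cutoff -/
def ind (t : ℝ) : ℝ → ℝ := fun y => if t ≤ y then 1 else 0

def cut (t : ℝ) (l : Fin d → ℝ) (c : Fin d → ℝ) : Fin d → ℝ := fun j => ind t (l j) * c j

theorem cut_norm_sq (t : ℝ) (c : Fin d → ℝ) :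
    eNorm (cut t l c) ^ 2 = ∑ j, ind t (l j) * c j ^ 2 := by
  rw [eNorm_sq]
  refine Finset.sum_congr rfl fun j _ => ?_
  simp only [cut, ind]; split_ifs <;> simp

theorem LimW.cut_tendsto (hW : LimW V l W) (t : ℝ) (x : Fin d → ℝ) :
    Tendsto (fun n => eNorm (cut t l ((V n)ᵀ *ᵥ x))) atTop (𝓝 (eNorm (cut t l (Wᵀ *ᵥ x)))) := by
  have h1 := hW.quad (ind t) x
  simp only [← cut_norm_sq] at h1
  have h2 := h1.sqrt
  simpa only [Real.sqrt_sq (eNorm_nonneg _)] using h2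

theorem cut_norm_le (t : ℝ) (c : Fin d → ℝ) : eNorm (cut t l c) ≤ eNorm c := by
  refine Real.sqrt_le_sqrt (Finset.sum_le_sum fun j _ => ?_)
  simp only [cut, ind]; split_ifs <;> simp [sq_nonneg]

theorem cut_le (t : ℝ) (c : Fin d → ℝ) {j : Fin d} (hj : t ≤ l j) :
    |c j| ≤ eNorm (cut t l c) := by
  have := abs_le_eNorm (cut t l c) j
  simpa [cut, ind, hj] using this

theorem Coc.cut_step (h : Coc M A B U V s l) (t : ℝ) (x : Fin d → ℝ) (n : ℕ) :
    eNorm (cut t l ((V n)ᵀ *ᵥ x)) ≤ eNorm (cut t l ((V (n+1))ᵀ *ᵥ x)) +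
      ∑ i, ∑ k, if t ≤ l i ∧ l k < t then
        |((V n)ᵀ * V (n+1)) i k| * |((V (n+1))ᵀ *ᵥ x) k| else 0 := by
  set O := (V n)ᵀ * V (n+1) with hO
  set c := (V (n+1))ᵀ *ᵥ x with hc
  have hV1 : V n * (V n)ᵀ = 1 := mul_eq_one_comm.1 (h.svd n).hV
  have hV2 : V (n+1) * (V (n+1))ᵀ = 1 := mul_eq_one_comm.1 (h.svd (n+1)).hV
  have hcO : (V n)ᵀ *ᵥ x = O *ᵥ c := by
    rw [hO, hc, mulVec_mulVec, Matrix.mul_assoc, hV2, Matrix.mul_one]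
  have hOO : Oᵀ * O = 1 := by
    rw [hO, transpose_mul, transpose_transpose]
    calc _ = (V (n+1))ᵀ * (V n * (V n)ᵀ) * V (n+1) := by simp only [Matrix.mul_assoc]
      _ = 1 := by rw [hV1, Matrix.mul_one, (h.svd _).hV]
  have hsplit : cut t l (O *ᵥ c) = cut t l (O *ᵥ cut t l c) + cut t l (O *ᵥ (c - cut t l c)) := by
    ext j; simp only [cut, mulVec_sub, Pi.add_apply, Pi.sub_apply]; ring
  rw [hcO, hsplit]
  refine (eNorm_add_le _ _).trans (add_le_add ?_ ?_)
  · exact (cut_norm_le _ _).trans (eNorm_orth O hOO _).le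
  · refine (eNorm_le_sum _).trans (Finset.sum_le_sum fun i _ => ?_)
    by_cases hi : t ≤ l i
    · simp only [cut, ind, hi, if_true, one_mul, true_and]
      rw [mulVec, dotProduct]
      refine (Finset.abs_sum_le_sum_abs _ _).trans (Finset.sum_le_sum fun k _ => ?_)
      by_cases hk : t ≤ l k
      · simp [cut, ind, hk, not_lt.2 hk]
      · simp [cut, ind, hk, not_le.1 hk, abs_mul]
    · simp [cut, ind, hi]

theorem Coc.coord_gr (h : Coc M A B U V s l) (hW : LimW V l W) {μ : ℝ} {x : Fin d → ℝ}
    (hx : ∀ j, μ < l j → (Wᵀ *ᵥ x) j = 0) :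
    ∀ j, Gr (fun n => |((V n)ᵀ *ᵥ x) j|) (μ - l j) := by
  have hV1 : ∀ n, V n * (V n)ᵀ = 1 := fun n => mul_eq_one_comm.1 (h.svd n).hV
  have hlow : ∀ j, l j ≤ μ → Gr (fun n => |((V n)ᵀ *ᵥ x) j|) (μ - l j) := by
    intro j hj
    refine Gr.of_le ((Gr.const (eNorm x)).rate (by linarith)) fun n => ?_
    refine (abs_le_eNorm _ _).trans (eNorm_orth _ ?_ _).le
    rw [transpose_transpose, hV1]
  have key : ∀ (m : ℕ) (j : Fin d), (Finset.univ.filter fun i => l i < l j).card = m →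
      Gr (fun n => |((V n)ᵀ *ᵥ x) j|) (μ - l j) := by
    intro m
    induction m using Nat.strong_induction_on with
    | _ m ih =>
      intro j hj
      rcases le_or_gt (l j) μ with hl | hl
      · exact hlow j hl
      have ih' : ∀ k, l k < l j → Gr (fun n => |((V n)ᵀ *ᵥ x) k|) (μ - l k) := by
        intro k hk
        refine ih _ ?_ k rfl
        rw [← hj]
        refine Finset.card_lt_card ?_
        refine (Finset.ssubset_iff_of_subset ?_).2 ⟨k, by simp [hk], by simp⟩
        intro i hi
        simp only [Finset.mem_filter, Finset.mem_univ, true_and] at hi ⊢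
        exact hi.trans hk
      have hz : Tendsto (fun n => eNorm (cut (l j) l ((V n)ᵀ *ᵥ x))) atTop (𝓝 0) := by
        have := hW.cut_tendsto (l j) x
        have e : cut (l j) l (Wᵀ *ᵥ x) = 0 := by
          ext k
          simp only [cut, ind]
          split_ifs with hk
          · rw [hx k (hl.trans_le hk)]; simp
          · simp
        rwa [e, eNorm_zero] at this
      have hg : Gr (fun n => ∑ i, ∑ k, if l j ≤ l i ∧ l k < l j then
          |((V n)ᵀ * V (n+1)) i k| * |((V (n+1))ᵀ *ᵥ x) k| else 0) (μ - l j) := by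
        refine Gr.sum _ fun i _ => Gr.sum _ fun k _ => ?_
        by_cases hik : l j ≤ l i ∧ l k < l j
        · simp only [hik, and_self, if_true]
          refine ((h.grO i k).mul (ih' k hik.2).shift (fun _ => abs_nonneg _)
            (fun _ => abs_nonneg _)).rate ?_
          rw [abs_of_nonneg (by linarith [hik.1, hik.2])]
          linarith [hik.1]
        · simp only [hik, if_false]; exact Gr.zero _
      have := Gr.telescope hg (by linarith) hz (h.cut_step (l j) x)
      exact this.of_le fun n => cut_le _ _ le_rfl
  exact fun j => key _ j rfl

theorem Coc.slow_eq (h : Coc M A B U V s l) (hW : LimW V l W) (μ : ℝ) :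
    slow M μ = cSub W (Finset.univ.filter fun j => l j ≤ μ) := by
  ext x
  rw [mem_slow, mem_cSub]
  simp only [Finset.mem_filter, Finset.mem_univ, true_and, not_le]
  constructor
  · intro hx j hj
    have hf := hW.quad (fun y => if μ < y then 1 else 0) x
    have h0 : Tendsto (fun n => ∑ j, (if μ < l j then 1 else 0) * ((V n)ᵀ *ᵥ x) j ^ 2) atTop
        (𝓝 (∑ j : Fin d, (0:ℝ))) := by
      refine tendsto_finsetSum _ fun j _ => ?_
      by_cases hj : μ < l j
      · simp only [hj, if_true, one_mul]
        have : Gr (fun n => |((V n)ᵀ *ᵥ x) j|) (-l j + μ) :=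
          ((h.gs' j).mul hx (fun n => (inv_pos.2 ((h.svd n).pos j)).le)
            (fun n => eNorm_nonneg _)).of_le fun n => (h.svd n).coord_le x j
        have := (this.tendsto_zero (by linarith) (fun _ => abs_nonneg _)).pow 2
        simpa using this
      · simp [hj]
    have he := tendsto_nhds_unique hf h0
    rw [Finset.sum_const_zero, Finset.sum_eq_zero_iff_of_nonneg] at he
    · have := he j (Finset.mem_univ j)
      simpa [hj] using this
    · intro j _; split_ifs <;> simp [sq_nonneg]
  · intro hx
    have hc := h.coord_gr hW hx
    refine Gr.of_le (Gr.sum Finset.univ (f := fun j n => s n j * |((V n)ᵀ *ᵥ x) j|)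
      (a := μ) fun j _ => ?_) fun n => (h.svd n).norm_le x
    refine ((h.gs j).mul (hc j) (fun n => ((h.svd n).pos j).le)
      (fun n => abs_nonneg _)).rate (by linarith)

theorem Coc.lower (h : Coc M A B U V s l) (hW : LimW V l W) {t : ℝ} {x : Fin d → ℝ} {j : Fin d}
    (hj : t ≤ l j) (hx : (Wᵀ *ᵥ x) j ≠ 0) : Gr (fun n => (eNorm (M n *ᵥ x))⁻¹) (-t) := by
  have hq : 0 < eNorm (cut t l (Wᵀ *ᵥ x)) := (abs_pos.2 hx).trans_le (cut_le t _ hj)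
  set q := eNorm (cut t l (Wᵀ *ᵥ x))
  have hev := (hW.cut_tendsto t x).eventually_const_lt (show q/2 < q by linarith)
  have hg : Gr (fun n => (2/q) * ∑ j, if t ≤ l j then (s n j)⁻¹ else 0) (-t) := by
    refine Gr.const_mul (Gr.sum _ fun j _ => ?_) _ (by positivity) ?_
    · by_cases hj : t ≤ l j
      · simp only [hj, if_true]; exact (h.gs' j).rate (by linarith)
      · simp only [hj, if_false]; exact Gr.zero _
    · intro n
      refine Finset.sum_nonneg fun j _ => ?_
      split_ifs
      · exact (inv_pos.2 ((h.svd n).pos j)).le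
      · exact le_rfl
  refine hg.of_le_ev ?_
  filter_upwards [hev] with n hn
  have h1 : eNorm (cut t l ((V n)ᵀ *ᵥ x)) ≤
      (∑ j, if t ≤ l j then (s n j)⁻¹ else 0) * eNorm (M n *ᵥ x) := by
    rw [Finset.sum_mul]
    refine (eNorm_le_sum _).trans (Finset.sum_le_sum fun j _ => ?_)
    by_cases hj : t ≤ l j
    · simpa [cut, ind, hj] using (h.svd n).coord_le x j
    · simp [cut, ind, hj]
  have h2 : 0 < eNorm (M n *ᵥ x) := by
    rcases (eNorm_nonneg (M n *ᵥ x)).eq_or_lt with h0 | h0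
    · rw [← h0, mul_zero] at h1; linarith
    · exact h0
  rw [inv_le_iff_one_le_mul₀ h2]
  have h3 := hn.le.trans h1
  calc (1:ℝ) = (2/q) * (q/2) := by field_simp
    _ ≤ (2/q) * ((∑ j, if t ≤ l j then (s n j)⁻¹ else 0) * eNorm (M n *ᵥ x)) := by gcongr
    _ = _ := by ring

end

section
variable {d : ℕ} {M A B U V : ℕ → Matrix (Fin d) (Fin d) ℝ} {s : ℕ → Fin d → ℝ} {l : Fin d → ℝ}
  {W : Matrix (Fin d) (Fin d) ℝ}

theorem conj_posDef (V : Matrix (Fin d) (Fin d) ℝ) (hV : Vᵀ * V = 1) (g : Fin d → ℝ)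
    (hg : ∀ j, 0 < g j) : (V * diagonal g * Vᵀ).PosDef := by
  have hu : IsUnit V := IsUnit.of_mul_eq_one _ (mul_eq_one_comm.1 hV)
  have := (Matrix.IsUnit.posDef_star_right_conjugate_iff (x := diagonal g) hu).2 (PosDef.diagonal hg)
  rwa [star_eq_conjTranspose, conjTranspose_eq_transpose_of_trivial] at this

theorem conj_symm (V : Matrix (Fin d) (Fin d) ℝ) (g : Fin d → ℝ) :
    (V * diagonal g * Vᵀ).IsSymm := by
  simp [IsSymm, transpose_mul, Matrix.mul_assoc]

theorem mconj_pow (V : Matrix (Fin d) (Fin d) ℝ) (hV : Vᵀ * V = 1) (g : Fin d → ℝ) (n : ℕ) :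
    (V * diagonal g * Vᵀ) ^ n = V * diagonal (fun j => g j ^ n) * Vᵀ := by
  induction n with
  | zero => simp [mul_eq_one_comm.1 hV]
  | succ n ih =>
    rw [pow_succ, ih]
    calc _ = V * diagonal (fun j => g j ^ n) * (Vᵀ * V) * diagonal g * Vᵀ := by
          simp only [Matrix.mul_assoc]
      _ = V * (diagonal (fun j => g j ^ n) * diagonal g) * Vᵀ := by
          rw [hV, Matrix.mul_one]; simp only [Matrix.mul_assoc]
      _ = _ := by rw [diagonal_mul_diagonal]; simp only [pow_succ]

theorem eigen_conj (W : Matrix (Fin d) (Fin d) ℝ) (hW : Wᵀ * W = 1) (g : Fin d → ℝ) (μ : ℝ) :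
    Module.End.eigenspace (Matrix.toLin' (W * diagonal g * Wᵀ)) μ
      = cSub W (Finset.univ.filter fun j => g j = μ) := by
  have hWW : W * Wᵀ = 1 := mul_eq_one_comm.1 hW
  ext x
  rw [Module.End.mem_eigenspace_iff, toLin'_apply, mem_cSub]
  simp only [Finset.mem_filter, Finset.mem_univ, true_and]
  have h1 : (W * diagonal g * Wᵀ) *ᵥ x = μ • x ↔
      diagonal g *ᵥ (Wᵀ *ᵥ x) = μ • (Wᵀ *ᵥ x) := by
    rw [← mulVec_mulVec, ← mulVec_mulVec]
    constructor
    · intro h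
      have := congrArg (fun y => Wᵀ *ᵥ y) h
      simpa only [mulVec_mulVec, mulVec_smul, ← Matrix.mul_assoc, hW, Matrix.one_mul] using this
    · intro h
      rw [h, mulVec_smul, mulVec_mulVec, hWW, one_mulVec]
  rw [h1, funext_iff]
  refine forall_congr' fun j => ?_
  rw [mulVec_diagonal, Pi.smul_apply, smul_eq_mul]
  constructor
  · intro h hj
    have : (g j - μ) * (Wᵀ *ᵥ x) j = 0 := by linarith
    exact (mul_eq_zero.1 this).resolve_left (sub_ne_zero.2 hj)
  · intro h
    by_cases hj : g j = μ
    · rw [hj]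
    · rw [h hj, mul_zero, mul_zero]

theorem Coc.roots (h : Coc M A B U V s l) (hW : LimW V l W) :
    ∃ R : ℕ → Matrix (Fin d) (Fin d) ℝ,
      (∀ n : ℕ, 1 ≤ n → (R n).IsSymm ∧ (R n).PosDef ∧ R n ^ (2 * n) = (M n)ᵀ * M n) ∧
      Tendsto R atTop (𝓝 (W * diagonal (fun j => Real.exp (l j)) * Wᵀ)) := by
  have sp := fun n j => (h.svd n).pos j
  refine ⟨fun n => V n * diagonal (fun j => s n j ^ (1 / (n:ℝ))) * (V n)ᵀ, ?_, ?_⟩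
  · intro n hn
    refine ⟨conj_symm _ _, conj_posDef _ (h.svd n).hV _ fun j => Real.rpow_pos_of_pos (sp n j) _, ?_⟩
    rw [mconj_pow _ (h.svd n).hV]
    have e1 : ∀ j, (s n j ^ (1 / (n:ℝ))) ^ (2 * n) = s n j * s n j := by
      intro j
      have hn' : (n:ℝ) ≠ 0 := by positivity
      rw [← Real.rpow_natCast, ← Real.rpow_mul (sp n j).le]
      have : 1 / (n:ℝ) * ((2 * n : ℕ) : ℝ) = (2:ℕ) := by push_cast; field_simp
      rw [this, Real.rpow_natCast, sq]
    simp only [e1]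
    rw [← diagonal_mul_diagonal]
    have e2 : M n = U n * diagonal (s n) * (V n)ᵀ := (h.svd n).eq
    have e3 : (M n)ᵀ * M n = (V n * diagonal (s n) * (U n)ᵀ) * (U n * diagonal (s n) * (V n)ᵀ) := by
      rw [e2]; simp [transpose_mul, Matrix.mul_assoc]
    rw [e3]
    calc _ = V n * diagonal (s n) * 1 * diagonal (s n) * (V n)ᵀ := by
          simp only [Matrix.mul_assoc, Matrix.one_mul]
      _ = _ := by rw [← (h.svd n).hU]; simp only [Matrix.mul_assoc]
  · have hj : ∀ j, Tendsto (fun n : ℕ => s n j ^ (1 / (n:ℝ))) atTop (𝓝 (Real.exp (l j))) := by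
      intro j
      have := Gr.tendsto_log (fun n => sp n j) (h.gs j) (h.gs' j)
      have := (Real.continuous_exp.tendsto _).comp this
      refine this.congr fun n => ?_
      simp only [Function.comp]
      rw [Real.rpow_def_of_pos (sp n j), mul_comm]
    have h0 : Tendsto (fun n : ℕ => ∑ j, |s n j ^ (1 / (n:ℝ)) - Real.exp (l j)|) atTop (𝓝 0) := by
      have : Tendsto (fun n : ℕ => ∑ j, |s n j ^ (1 / (n:ℝ)) - Real.exp (l j)|) atTop
          (𝓝 (∑ j : Fin d, |Real.exp (l j) - Real.exp (l j)|)) :=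
        tendsto_finsetSum _ fun j _ => ((hj j).sub_const _).abs
      simpa using this
    have h1 : Tendsto (fun n : ℕ => V n * diagonal (fun j => s n j ^ (1 / (n:ℝ)) - Real.exp (l j)) *
        (V n)ᵀ) atTop (𝓝 0) := by
      refine tendsto_pi_nhds.2 fun a => tendsto_pi_nhds.2 fun b => ?_
      refine squeeze_zero_norm (fun n => ?_) h0
      have hV1 : V n * (V n)ᵀ = 1 := mul_eq_one_comm.1 (h.svd n).hV
      have := orth_conj_le (V n)ᵀ (diagonal (fun j => s n j ^ (1 / (n:ℝ)) - Real.exp (l j))) (V n)ᵀ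
        (by rw [transpose_transpose, hV1]) (by rw [transpose_transpose, hV1]) a b
      rw [transpose_transpose] at this
      refine this.trans (le_of_eq ?_)
      refine Finset.sum_congr rfl fun i _ => ?_
      rw [Finset.sum_eq_single i]
      · rw [diagonal_apply_eq]
      · intro b _ hb; rw [diagonal_apply_ne _ hb.symm, abs_zero]
      · simp
    have h2 := h1.add (hW.lim Real.exp)
    rw [zero_add] at h2
    refine h2.congr fun n => ?_
    rw [← Matrix.add_mul, ← Matrix.mul_add, diagonal_add]
    simp
end

theorem core_growth {d k : ℕ} (X Y : ℕ → Matrix (Fin d) (Fin d) ℝ) (a0 : Fin d)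
    (ha0 : (a0 : ℕ) < k + 1) {g1 g0 r : ℝ}
    (hX1 : Gr (fun n => mS (k+1) (X n)) g1) (hX0 : Gr (fun n => mS k (X n)) g0)
    (hY1 : Gr (fun n => mS (k+1) (Y n)) g1) (hY0 : Gr (fun n => mS k (Y n)) g0)
    (hcol : ∀ i, Gr (fun n => |X n i a0|) r)
    (hrow : ∀ a : Fin d, k + 1 ≤ (a : ℕ) → ∀ i, Gr (fun n => |Y n a i|) r) :
    Gr (fun n => mS (k+1) (X n * Y n)) (g1 + (r + (0 + g0))) := by
  have key : Gr (fun n => ∑ I : Fin (k+1) → Fin d, ∑ J : Fin (k+1) → Fin d,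
      ∑ K : Fin (k+1) → Fin d, |((X n).submatrix I K).det| * |((Y n).submatrix K J).det|)
      (g1 + (r + (0 + g0))) := by
    refine Gr.sum _ fun I _ => Gr.sum _ fun J _ => Gr.sum _ fun K _ => ?_
    have c0 : Gr (fun _ => ((k+1 : ℕ) : ℝ)) 0 := Gr.const _
    by_cases hK : Function.Injective K
    · by_cases hlarge : ∃ j, k + 1 ≤ (K j : ℕ)
      · obtain ⟨j, hj⟩ := hlarge
        have h2 : Gr (fun n => |((Y n).submatrix K J).det|) (r + (0 + g0)) := by
          refine Gr.of_le ((Gr.sum Finset.univ (fun i _ => hrow (K j) hj i)).mul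
            (c0.mul hY0 ?_ ?_) ?_ ?_) fun n => laplace_row (Y n) K J j
          · intro n; positivity
          · intro n; exact mS_nonneg _ _
          · intro n; positivity
          · intro n; exact mul_nonneg (by positivity) (mS_nonneg _ _)
        exact (hX1.of_le fun n => le_mS (X n) I K).mul h2 (fun _ => abs_nonneg _)
          (fun _ => abs_nonneg _)
      · push Not at hlarge
        obtain ⟨j, hj⟩ : ∃ j, K j = a0 := by
          let K' : Fin (k+1) → Fin (k+1) := fun j => ⟨K j, hlarge j⟩
          have hi : Function.Injective K' := by
            intro a b hab
            apply hK
            have := congrArg Fin.val hab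
            exact Fin.ext this
          obtain ⟨j, hj⟩ := (Finite.injective_iff_surjective.1 hi) ⟨a0, ha0⟩
          have := congrArg Fin.val hj
          exact ⟨j, Fin.ext this⟩
        have h2 : Gr (fun n => |((X n).submatrix I K).det|) (r + (0 + g0)) := by
          refine Gr.of_le ((Gr.sum Finset.univ (fun i _ => hcol i)).mul
            (c0.mul hX0 ?_ ?_) ?_ ?_) fun n => ?_
          · intro n; positivity
          · intro n; exact mS_nonneg _ _
          · intro n; positivity
          · intro n; exact mul_nonneg (by positivity) (mS_nonneg _ _)
          · have := laplace_col (X n) I K j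
            rwa [hj] at this
        refine (h2.mul (hY1.of_le fun n => le_mS (Y n) K J) (fun _ => abs_nonneg _)
          (fun _ => abs_nonneg _)).rate (by linarith)
    · have : ∀ n, |((X n).submatrix I K).det| * |((Y n).submatrix K J).det| = 0 := by
        intro n
        simp only [Function.Injective, not_forall] at hK
        obtain ⟨a, b, hab, hne⟩ := hK
        have : ((X n).submatrix I K).det = 0 :=
          det_zero_of_column_eq hne fun i => by simp [hab]
        rw [this]; simp
      simp only [this]
      exact Gr.zero _
  refine key.of_le fun n => ?_
  unfold mS
  exact Finset.sum_le_sum fun I _ => Finset.sum_le_sum fun J _ => abs_minor_mul_le _ _ I J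

theorem transversal {d k : ℕ} (M N' : ℕ → Matrix (Fin d) (Fin d) ℝ)
    (F : Matrix (Fin d) (Fin d) ℝ) (hF : Fᵀ * F = 1) {g1 g0 r : ℝ}
    (hM1 : Gr (fun n => mS (k+1) (M n)) g1) (hM0 : Gr (fun n => mS k (M n)) g0)
    (hN1 : Gr (fun n => mS (k+1) (N' n)) g1) (hN0 : Gr (fun n => mS k (N' n)) g0)
    {x : Fin d → ℝ} (hx0 : x ≠ 0) (hx : Gr (fun n => eNorm (M n *ᵥ x)) r)
    (hξ : ∀ a : Fin d, k + 1 ≤ (a : ℕ) → (Fᵀ *ᵥ x) a = 0)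
    (hrow : ∀ a : Fin d, k + 1 ≤ (a : ℕ) →
      Gr (fun n => eNorm ((N' n)ᵀ *ᵥ (F *ᵥ Pi.single a 1))) r) :
    Gr (fun n => mS (k+1) (M n * N' n)) (g1 + (r + g0)) := by
  have hFF : F * Fᵀ = 1 := mul_eq_one_comm.1 hF
  set ξ := Fᵀ *ᵥ x with hξd
  have hxξ : x = F *ᵥ ξ := by rw [hξd, mulVec_mulVec, hFF, one_mulVec]
  obtain ⟨a0, ha0⟩ : ∃ a, ξ a ≠ 0 := by
    by_contra hcon
    push Not at hcon
    apply hx0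
    have : ξ = 0 := funext hcon
    rw [hxξ, this, mulVec_zero]
  have ha0k : (a0 : ℕ) < k + 1 := by
    by_contra hcon
    exact ha0 (hξ a0 (by omega))
  set T : Matrix (Fin d) (Fin d) ℝ := (1 : Matrix (Fin d) (Fin d) ℝ).updateCol a0 ξ with hT
  have hdet : T.det = ξ a0 := by
    rw [hT, ← cramer_apply, cramer_one]; rfl
  have hTu : IsUnit T.det := by rw [hdet]; exact isUnit_iff_ne_zero.2 ha0
  have hTT : T * T⁻¹ = 1 := Matrix.mul_nonsing_inv _ hTu
  have hrowT : ∀ a : Fin d, k + 1 ≤ (a : ℕ) → ∀ b, T⁻¹ a b = (1 : Matrix (Fin d) (Fin d) ℝ) a b := by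
    intro a ha b
    have hne : a ≠ a0 := by rintro rfl; omega
    have h1 : ∀ c, T a c = (1 : Matrix (Fin d) (Fin d) ℝ) a c := by
      intro c
      rw [hT, updateCol_apply]
      split_ifs with hc
      · rw [hξ a ha, hc, one_apply_ne hne]
      · rfl
    have h2 := congrFun (congrFun hTT a) b
    rw [mul_apply] at h2
    simp only [h1] at h2
    rw [← h2, ← mul_apply, Matrix.one_mul]
  have e : ∀ n, M n * N' n = (M n * (F * T)) * (T⁻¹ * Fᵀ * N' n) := by
    intro n
    calc _ = M n * (F * 1 * Fᵀ) * N' n := by rw [Matrix.mul_one, hFF, Matrix.mul_one]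
      _ = _ := by rw [← hTT]; simp only [Matrix.mul_assoc]
  have gm : ∀ (j : ℕ) (g : ℝ) (Z : ℕ → Matrix (Fin d) (Fin d) ℝ) (C : Matrix (Fin d) (Fin d) ℝ),
      Gr (fun n => mS j (Z n)) g → Gr (fun n => mS j (Z n * C)) g := by
    intro j g Z C h
    refine (h.const_mul (mS j C) (mS_nonneg _ _) fun _ => mS_nonneg _ _).of_le fun n => ?_
    rw [mul_comm]; exact mS_mul_le _ _ _
  have gm' : ∀ (j : ℕ) (g : ℝ) (Z : ℕ → Matrix (Fin d) (Fin d) ℝ) (C : Matrix (Fin d) (Fin d) ℝ),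
      Gr (fun n => mS j (Z n)) g → Gr (fun n => mS j (C * Z n)) g := by
    intro j g Z C h
    refine (h.const_mul (mS j C) (mS_nonneg _ _) fun _ => mS_nonneg _ _).of_le fun n => ?_
    exact mS_mul_le _ _ _
  simp only [e]
  have := core_growth (fun n => M n * (F * T)) (fun n => T⁻¹ * Fᵀ * N' n) a0 ha0k
    (gm _ _ _ _ hM1) (gm _ _ _ _ hM0) (gm' _ _ _ _ hN1) (gm' _ _ _ _ hN0) (r := r) ?_ ?_
  · simpa using this
  · intro i
    refine hx.of_le fun n => ?_
    have : (M n * (F * T)) i a0 = (M n *ᵥ x) i := by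
      rw [hxξ, mulVec_mulVec, ← Matrix.mul_assoc, mul_apply]
      refine Finset.sum_congr rfl fun b _ => ?_
      rw [hT, updateCol_self]
    rw [this]
    exact abs_le_eNorm _ _
  · intro a ha i
    refine (hrow a ha).of_le fun n => ?_
    have : (T⁻¹ * Fᵀ * N' n) a i = ((N' n)ᵀ *ᵥ (F *ᵥ Pi.single a 1)) i := by
      have h1 : (T⁻¹ * Fᵀ * N' n) a i = (Fᵀ * N' n) a i := by
        rw [Matrix.mul_assoc, mul_apply]
        simp only [hrowT a ha]
        rw [← mul_apply, Matrix.one_mul]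
      rw [h1, mulVec_single_one, mul_apply, mulVec, dotProduct]
      refine Finset.sum_congr rfl fun b _ => ?_
      simp [mul_comm]
    rw [this]
    exact abs_le_eNorm _ _

theorem SVD.inv {d : ℕ} {M N U V : Matrix (Fin d) (Fin d) ℝ} {s : Fin d → ℝ} (h : SVD M U V s)
    (hN : N * M = 1) : SVD N V U (fun j => (s j)⁻¹) := by
  refine ⟨h.hV, h.hU, fun j => inv_pos.2 (h.pos j), ?_⟩
  have h1 : M * (V * diagonal (fun j => (s j)⁻¹) * Uᵀ) = 1 := by
    rw [h.eq]
    calc _ = U * diagonal s * (Vᵀ * V) * diagonal (fun j => (s j)⁻¹) * Uᵀ := by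
          simp only [Matrix.mul_assoc]
      _ = U * (diagonal s * diagonal (fun j => (s j)⁻¹)) * Uᵀ := by
          rw [h.hV]; simp only [Matrix.mul_assoc, Matrix.one_mul]
      _ = _ := by
          have : (diagonal s * diagonal (fun j => (s j)⁻¹)) = (1 : Matrix (Fin d) (Fin d) ℝ) := by
            rw [diagonal_mul_diagonal, ← diagonal_one]
            congr 1; ext j; exact mul_inv_cancel₀ (h.pos j).ne'
          rw [this, Matrix.mul_one, mul_eq_one_comm.1 h.hU]
  calc N = N * (M * (V * diagonal (fun j => (s j)⁻¹) * Uᵀ)) := by rw [h1, Matrix.mul_one]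
    _ = _ := by rw [← Matrix.mul_assoc, hN, Matrix.one_mul]

theorem SVD.tr {d : ℕ} {M U V : Matrix (Fin d) (Fin d) ℝ} {s : Fin d → ℝ} (h : SVD M U V s) :
    SVD Mᵀ V U s := by
  refine ⟨h.hV, h.hU, h.pos, ?_⟩
  rw [h.eq]; simp [transpose_mul, Matrix.mul_assoc]

theorem cover_bound (N : ℕ) (a : ℕ → ℕ → ℝ) (G f : ℕ → ℝ) (B : ℕ → Prop) [DecidablePred B]
    (ha0 : ∀ m, a m 0 = 0) (hsub : ∀ m p q, a m (p + q) ≤ a m p + a (m + p) q)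
    (hG : Monotone G) (hf : ∀ m, 0 ≤ f m) (ha1 : ∀ m, a m 1 ≤ f m)
    (hBG : ∀ m, B m → G m ≤ f m)
    (hB : ∀ m, ¬ B m → ∃ l, 1 ≤ l ∧ l ≤ N ∧ a m l ≤ l * G m) :
    ∀ n m, a m n ≤ ∑ k ∈ Finset.range n, (if B (m+k) then f (m+k) else G (m+k)) +
      ∑ k ∈ Finset.range n, (if n ≤ k + N then f (m+k) + |G (m+k)| else 0) := by
  set u : ℕ → ℝ := fun m => if B m then f m else G m with hu
  have huG : ∀ m, G m ≤ u m := by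
    intro m; simp only [hu]; split_ifs with h
    · exact hBG m h
    · exact le_rfl
  have hw0 : ∀ m, 0 ≤ f m + |G m| := fun m => add_nonneg (hf m) (abs_nonneg _)
  have hfu : ∀ m, f m ≤ u m + (f m + |G m|) := by
    intro m; have := huG m; have := neg_abs_le (G m); linarith
  have hsum : ∀ n m, a m n ≤ ∑ k ∈ Finset.range n, f (m+k) := by
    intro n
    induction n with
    | zero => intro m; simp [ha0]
    | succ n ih =>
      intro m
      rw [Finset.sum_range_succ]
      have := hsub m n 1
      have := ih m
      have := ha1 (m+n)
      linarith
  intro n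
  induction n using Nat.strong_induction_on with
  | _ n ih =>
    intro m
    rcases Nat.eq_zero_or_pos n with rfl | hn
    · simp [ha0]
    have step : ∀ l, 1 ≤ l → l ≤ n → a m l ≤ ∑ k ∈ Finset.range l, u (m+k) →
        a m n ≤ ∑ k ∈ Finset.range n, u (m+k) +
          ∑ k ∈ Finset.range n, (if n ≤ k + N then f (m+k) + |G (m+k)| else 0) := by
      intro l h1 hln hl
      obtain ⟨r, rfl⟩ := Nat.exists_eq_add_of_le hln
      have h2 := ih r (by omega) (m+l)
      have h3 := hsub m l r
      rw [Finset.sum_range_add, Finset.sum_range_add]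
      have h4 : 0 ≤ ∑ x ∈ Finset.range l, (if l + r ≤ x + N then f (m+x) + |G (m+x)| else 0) :=
        Finset.sum_nonneg fun k _ => by
          split_ifs
          · exact hw0 _
          · exact le_rfl
      have h5 : ∑ k ∈ Finset.range r, (if r ≤ k + N then f (m+l+k) + |G (m+l+k)| else 0)
          = ∑ k ∈ Finset.range r,
            (if l + r ≤ l + k + N then f (m+(l+k)) + |G (m+(l+k))| else 0) := by
        refine Finset.sum_congr rfl fun k _ => ?_
        have : (r ≤ k + N) ↔ (l + r ≤ l + k + N) := by omega
        simp only [this, add_assoc]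
      have h6 : ∑ k ∈ Finset.range r, u (m + l + k) = ∑ k ∈ Finset.range r, u (m + (l + k)) := by
        simp only [add_assoc]
      rw [h5] at h2
      change a (m+l) r ≤ ∑ k ∈ Finset.range r, u (m + l + k) + _ at h2
      rw [h6] at h2
      linarith
    by_cases hb : B m
    · refine step 1 le_rfl hn ?_
      simp only [Finset.sum_range_one, add_zero, hu, hb, if_true]
      exact ha1 m
    · obtain ⟨l, h1, hlN, hl⟩ := hB m hb
      rcases le_or_gt l n with hln | hln
      · refine step l h1 hln (hl.trans ?_)
        calc (l:ℝ) * G m = ∑ k ∈ Finset.range l, G m := by simp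
          _ ≤ _ := Finset.sum_le_sum fun k _ => (hG (by omega)).trans (huG _)
      · refine (hsum n m).trans ?_
        change _ ≤ ∑ k ∈ Finset.range n, u (m + k) + _
        rw [← Finset.sum_add_distrib]
        refine Finset.sum_le_sum fun k _ => ?_
        rw [if_pos (by omega)]
        exact hfu _

section erg
variable {Ω : Type*} [MeasurableSpace Ω] {μ : Measure Ω} [IsProbabilityMeasure μ] {T : Ω → Ω}

theorem integral_comp_iter (hT : MeasurePreserving T μ μ) {f : Ω → ℝ} (hf : Measurable f) (k : ℕ) :
    ∫ ω, f (T^[k] ω) ∂μ = ∫ ω, f ω ∂μ := by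
  have h := hT.iterate k
  rw [← integral_map h.measurable.aemeasurable (by rw [h.map_eq]; exact hf.aestronglyMeasurable),
    h.map_eq]

theorem E1 (hT : MeasurePreserving T μ μ) (g : ℕ → Ω → ℝ) (hgm : ∀ n, Measurable (g n))
    (hgi : ∀ n, Integrable (g n) μ) (hg0 : ∀ ω, g 0 ω = 0)
    (hsub : ∀ m n ω, g (m + n) ω ≤ g m ω + g n (T^[m] ω))
    (f : Ω → ℝ) (hfm : Measurable f) (hfi : Integrable f μ) (hf0 : ∀ ω, 0 ≤ f ω)
    (hg1 : ∀ ω, g 1 ω ≤ f ω)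
    (G : Ω → ℝ) (hGm : Measurable G) (hGi : Integrable G μ) (hGT : ∀ᵐ ω ∂μ, G ω ≤ G (T ω))
    (hGg : ∀ᵐ ω ∂μ, ∃ l : ℕ, 1 ≤ l ∧ g l ω ≤ l * G ω)
    (c : ℝ) (hc : ∀ n : ℕ, 1 ≤ n → n * c ≤ ∫ ω, g n ω ∂μ) : c ≤ ∫ ω, G ω ∂μ := by
  classical
  set B : ℕ → Set Ω := fun N => {ω | ∀ l ∈ Finset.Icc 1 N, (l:ℝ) * G ω < g l ω} with hBdef
  have hBm : ∀ N, MeasurableSet (B N) := by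
    intro N
    have : B N = ⋂ l ∈ Finset.Icc 1 N, {ω | (l:ℝ) * G ω < g l ω} := by
      ext ω; simp [hBdef]
    rw [this]
    exact Finset.measurableSet_biInter _ fun l _ =>
      measurableSet_lt (hGm.const_mul _) (hgm l)
  set u : ℕ → Ω → ℝ := fun N ω => if ω ∈ B N then f ω else G ω with hu
  have hum : ∀ N, Measurable (u N) := fun N => Measurable.ite (hBm N) hfm hGm
  set w : Ω → ℝ := fun ω => f ω + |G ω| with hw
  have hwm : Measurable w := hfm.add hGm.abs
  have hwi : Integrable w μ := hfi.add hGi.abs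
  have huw : ∀ N ω, ‖u N ω‖ ≤ w ω := by
    intro N ω
    simp only [hu, hw, Real.norm_eq_abs]
    split_ifs
    · rw [abs_of_nonneg (hf0 ω)]; linarith [abs_nonneg (G ω)]
    · linarith [hf0 ω]
  have hui : ∀ N, Integrable (u N) μ := fun N =>
    hwi.mono' (hum N).aestronglyMeasurable (Eventually.of_forall (huw N))
  have hGT' : ∀ᵐ ω ∂μ, ∀ k : ℕ, G (T^[k] ω) ≤ G (T^[k+1] ω) := by
    rw [ae_all_iff]; intro k
    have := (hT.iterate k).quasiMeasurePreserving.ae hGT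
    filter_upwards [this] with ω hω
    rwa [Function.iterate_succ_apply']
  have main : ∀ N, 1 ≤ N → c ≤ ∫ ω, u N ω ∂μ := by
    intro N hN
    have hpt : ∀ n, ∀ᵐ ω ∂μ, g n ω ≤ ∑ k ∈ Finset.range n, u N (T^[k] ω) +
        ∑ k ∈ Finset.range n, (if n ≤ k + N then w (T^[k] ω) else 0) := by
      intro n
      filter_upwards [hGT'] with ω hω
      have := cover_bound N (fun m n => g n (T^[m] ω)) (fun m => G (T^[m] ω))
        (fun m => f (T^[m] ω)) (fun m => T^[m] ω ∈ B N) (fun m => hg0 _)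
        (fun m p q => ?_) (monotone_nat_of_le_succ hω) (fun m => hf0 _) (fun m => hg1 _)
        (fun m hm => ?_) (fun m hm => ?_) n 0
      · simpa using this
      · have := hsub p q (T^[m] ω)
        rwa [← Function.iterate_add_apply, add_comm p m] at this
      · have := hm 1 (by simp [hN])
        have h2 := hg1 (T^[m] ω)
        simp only [Nat.cast_one, one_mul] at this
        linarith
      · simp only [hBdef, Set.mem_setOf_eq, not_forall, not_lt] at hm
        obtain ⟨l, hl, hl2⟩ := hm
        rw [Finset.mem_Icc] at hl
        exact ⟨l, hl.1, hl.2, hl2⟩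
    have hcomp : ∀ (h : Ω → ℝ), Integrable h μ → ∀ k, Integrable (fun ω => h (T^[k] ω)) μ :=
      fun h hh k => ((hT.iterate k).integrable_comp hh.aestronglyMeasurable).2 hh
    have hbd : ∀ n : ℕ, 1 ≤ n → (n:ℝ) * c ≤ n * ∫ ω, u N ω ∂μ + N * ∫ ω, w ω ∂μ := by
      intro n hn
      have hi1 : ∀ k ∈ Finset.range n, Integrable (fun ω => u N (T^[k] ω)) μ :=
        fun k _ => hcomp _ (hui N) k
      have hi2 : ∀ k ∈ Finset.range n,
          Integrable (fun ω => if n ≤ k + N then w (T^[k] ω) else 0) μ := by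
        intro k _
        split_ifs
        · exact hcomp _ hwi k
        · exact integrable_zero _ _ _
      have h1 := integral_mono_ae (hgi n)
        ((integrable_finset_sum _ hi1).add (integrable_finset_sum _ hi2)) (hpt n)
      simp only [Pi.add_apply] at h1
      rw [integral_add (integrable_finset_sum _ hi1) (integrable_finset_sum _ hi2),
        integral_finset_sum _ hi1, integral_finset_sum _ hi2] at h1
      simp only [integral_comp_iter hT (hum N)] at h1
      rw [Finset.sum_const, Finset.card_range, nsmul_eq_mul] at h1
      have hW0 : 0 ≤ ∫ ω, w ω ∂μ :=
        integral_nonneg fun ω => add_nonneg (hf0 ω) (abs_nonneg _)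
      have h2 : ∑ k ∈ Finset.range n, ∫ ω, (if n ≤ k + N then w (T^[k] ω) else 0) ∂μ
          ≤ N * ∫ ω, w ω ∂μ := by
        calc _ = ∑ k ∈ Finset.range n, if n ≤ k + N then ∫ ω, w ω ∂μ else 0 := by
              refine Finset.sum_congr rfl fun k _ => ?_
              split_ifs
              · exact integral_comp_iter hT hwm k
              · simp
          _ = (((Finset.range n).filter fun k => n ≤ k + N).card : ℝ) * ∫ ω, w ω ∂μ := by
              rw [← Finset.sum_filter, Finset.sum_const, nsmul_eq_mul]
          _ ≤ _ := by
              refine mul_le_mul_of_nonneg_right ?_ hW0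
              have : ((Finset.range n).filter fun k => n ≤ k + N) ⊆ Finset.Ico (n - N) n := by
                intro k hk
                simp only [Finset.mem_filter, Finset.mem_range, Finset.mem_Ico] at hk ⊢
                omega
              have := Finset.card_le_card this
              rw [Nat.card_Ico] at this
              exact_mod_cast this.trans (by omega)
      linarith [hc n hn]
    by_contra hcon
    push Not at hcon
    set δ := c - ∫ ω, u N ω ∂μ with hδ
    have hδ0 : 0 < δ := by linarith
    obtain ⟨n, hn⟩ := exists_nat_gt ((N * ∫ ω, w ω ∂μ) / δ)
    have hb := hbd (n+1) (by omega)
    rw [div_lt_iff₀ hδ0] at hn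
    push_cast at hb
    nlinarith
  have hlim : Tendsto (fun N => ∫ ω, u N ω ∂μ) atTop (𝓝 (∫ ω, G ω ∂μ)) := by
    refine tendsto_integral_of_dominated_convergence w
      (fun N => (hum N).aestronglyMeasurable) hwi (fun N => Eventually.of_forall (huw N)) ?_
    filter_upwards [hGg] with ω hω
    obtain ⟨l, hl1, hl⟩ := hω
    refine tendsto_const_nhds.congr' ?_
    filter_upwards [eventually_ge_atTop l] with N hN
    simp only [hu]
    rw [if_neg]
    intro hB
    exact absurd hl (not_le.2 (hB l (Finset.mem_Icc.2 ⟨hl1, hN⟩)))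
  exact ge_of_tendsto hlim (by filter_upwards [eventually_ge_atTop 1] with N hN using main N hN)
end erg

theorem limsup_cmp (u v : ℕ → ℝ) (σ : ℕ → ℕ) (hσ : Tendsto σ atTop atTop)
    (H : ∀ a b : ℝ, 0 ≤ a → a < b → ∀ᶠ n in atTop, v (σ n) ≤ a → u n ≤ b) :
    limsup (fun n => ENNReal.ofReal (u n)) atTop ≤ limsup (fun n => ENNReal.ofReal (v n)) atTop := by
  refine le_of_forall_gt_imp_ge_of_dense fun c hc => ?_
  obtain ⟨b', hb1, hb2⟩ := exists_between hc
  obtain ⟨a', ha1, ha2⟩ := exists_between hb1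
  have hb' : b' ≠ ⊤ := (hb2.trans_le le_top).ne
  have ha' : a' ≠ ⊤ := (ha2.trans_le le_top).ne
  have hab : a'.toReal < b'.toReal := (ENNReal.toReal_lt_toReal ha' hb').2 ha2
  have h1 := hσ.eventually (eventually_lt_of_limsup_lt ha1)
  refine limsup_le_of_le (by isBoundedDefault) ?_
  filter_upwards [h1, H _ _ ENNReal.toReal_nonneg hab] with n h1 h2
  have h3 : v (σ n) ≤ a'.toReal := by
    have := (ENNReal.ofReal_le_iff_le_toReal ha').1 h1.le
    exact this
  exact ((ENNReal.ofReal_le_iff_le_toReal hb').2 (h2 h3)).trans hb2.le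

theorem liminf_cmp (u v : ℕ → ℝ)
    (H : ∀ a b : ℝ, 0 ≤ a → a < b → ∀ᶠ n in atTop, v n ≤ a → u n ≤ b) :
    liminf (fun n => ENNReal.ofReal (u n)) atTop ≤ liminf (fun n => ENNReal.ofReal (v n)) atTop := by
  refine le_of_forall_gt_imp_ge_of_dense fun c hc => ?_
  obtain ⟨b', hb1, hb2⟩ := exists_between hc
  obtain ⟨a', ha1, ha2⟩ := exists_between hb1
  have hb' : b' ≠ ⊤ := (hb2.trans_le le_top).ne
  have ha' : a' ≠ ⊤ := (ha2.trans_le le_top).ne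
  have hab : a'.toReal < b'.toReal := (ENNReal.toReal_lt_toReal ha' hb').2 ha2
  have h1 := frequently_lt_of_liminf_lt (by isBoundedDefault) ha1
  refine liminf_le_of_frequently_le ?_ (by isBoundedDefault)
  refine (h1.and_eventually (H _ _ ENNReal.toReal_nonneg hab)).mono fun n hn => ?_
  have h3 : v n ≤ a'.toReal := by
    have := (ENNReal.ofReal_le_iff_le_toReal ha').1 hn.1.le
    exact this
  exact ((ENNReal.ofReal_le_iff_le_toReal hb').2 (hn.2 h3)).trans hb2.le

section erg
variable {Ω : Type*} [MeasurableSpace Ω] {μ : Measure Ω} {T : Ω → Ω}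

def loF (g : ℕ → Ω → ℝ) (ω : Ω) : ENNReal := liminf (fun n : ℕ => ENNReal.ofReal (g n ω / n)) atTop
def upF (g : ℕ → Ω → ℝ) (ω : Ω) : ENNReal := limsup (fun n : ℕ => ENNReal.ofReal (g n ω / n)) atTop

theorem loF_meas {g : ℕ → Ω → ℝ} (hg : ∀ n, Measurable (g n)) : Measurable (loF g) :=
  Measurable.liminf fun n => ((hg n).div_const _).ennreal_ofReal

theorem upF_meas {g : ℕ → Ω → ℝ} (hg : ∀ n, Measurable (g n)) : Measurable (upF g) :=
  Measurable.limsup fun n => ((hg n).div_const _).ennreal_ofReal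

theorem loF_le_upF (g : ℕ → Ω → ℝ) (ω : Ω) : loF g ω ≤ upF g ω := liminf_le_limsup

theorem div_small (f : ℝ) {ε : ℝ} (hε : 0 < ε) : ∀ᶠ n : ℕ in atTop, f ≤ ε * n := by
  have : Tendsto (fun n : ℕ => ε * (n:ℝ)) atTop atTop :=
    Tendsto.const_mul_atTop hε tendsto_natCast_atTop_atTop
  exact this.eventually_ge_atTop f

theorem lower_claim [IsProbabilityMeasure μ] (hT : MeasurePreserving T μ μ) (g : ℕ → Ω → ℝ)
    (hgm : ∀ n, Measurable (g n))
    (hgi : ∀ n, Integrable (g n) μ) (hg0 : ∀ ω, g 0 ω = 0) (hgn : ∀ n ω, 0 ≤ g n ω)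
    (hsub : ∀ m n ω, g (m + n) ω ≤ g m ω + g n (T^[m] ω))
    (c : ℝ) (hc : ∀ n : ℕ, 1 ≤ n → n * c ≤ ∫ ω, g n ω ∂μ) :
    ENNReal.ofReal c ≤ ∫⁻ ω, loF g ω ∂μ := by
  by_cases hfin : ∫⁻ ω, loF g ω ∂μ = ⊤
  · rw [hfin]; exact le_top
  have hlm := loF_meas hgm
  have hlt : ∀ᵐ ω ∂μ, loF g ω < ⊤ := ae_lt_top hlm hfin
  have hinv : ∀ ω, loF g ω ≤ loF g (T ω) := by
    intro ω
    unfold loF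
    rw [← liminf_nat_add _ 1]
    refine liminf_cmp (fun n => g (n+1) ω / ((n+1 : ℕ):ℝ)) _ fun a b ha hab => ?_
    filter_upwards [div_small (g 1 ω) (sub_pos.2 hab), eventually_gt_atTop 0] with n h1 h2 h3
    have hn : (0:ℝ) < n := by exact_mod_cast h2
    rw [div_le_iff₀ hn] at h3
    have hs := hsub 1 n ω
    rw [add_comm 1 n] at hs
    simp only [Function.iterate_one] at hs
    push_cast
    rw [div_le_iff₀ (by positivity)]
    nlinarith
  have key : ∀ ε : ℝ, 0 < ε → c ≤ ∫ ω, (loF g ω).toReal ∂μ + ε := by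
    intro ε hε
    have hi : Integrable (fun ω => (loF g ω).toReal) μ :=
      integrable_toReal_of_lintegral_ne_top hlm.aemeasurable hfin
    have := E1 hT g hgm hgi hg0 hsub (g 1) (hgm 1) (hgi 1) (hgn 1) (fun _ => le_rfl)
      (fun ω => (loF g ω).toReal + ε) (hlm.ennreal_toReal.add_const _)
      (hi.add (integrable_const ε)) ?_ ?_ c hc
    · rw [integral_add hi (integrable_const ε)] at this
      simpa using this
    · filter_upwards [hT.quasiMeasurePreserving.ae hlt] with ω hω
      have := ENNReal.toReal_mono hω.ne (hinv ω)
      linarith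
    · filter_upwards [hlt] with ω hω
      have h1 : loF g ω < ENNReal.ofReal ((loF g ω).toReal + ε) := by
        rw [ENNReal.lt_ofReal_iff_toReal_lt hω.ne]; linarith
      have h2 := (frequently_lt_of_liminf_lt (by isBoundedDefault) h1).and_eventually
        (eventually_ge_atTop 1)
      obtain ⟨l, hl, hl1⟩ := h2.exists
      refine ⟨l, hl1, ?_⟩
      have hl0 : (0:ℝ) < l := by exact_mod_cast hl1
      have := (ENNReal.ofReal_lt_ofReal_iff (by positivity)).1 hl
      rw [div_lt_iff₀ hl0] at this
      linarith
  have h2 : c ≤ ∫ ω, (loF g ω).toReal ∂μ := le_of_forall_pos_le_add key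
  rw [integral_toReal hlm.aemeasurable hlt] at h2
  exact ENNReal.ofReal_le_of_le_toReal h2

def bS (T : Ω → Ω) (F : Ω → ℝ) (n : ℕ) (ω : Ω) : ℝ := ∑ k ∈ Finset.range n, F (T^[k] ω)

theorem bS_meas (hT : Measurable T) {F : Ω → ℝ} (hF : Measurable F) (n : ℕ) :
    Measurable (bS T F n) :=
  Finset.measurable_sum _ fun k _ => hF.comp (hT.iterate k)

theorem bS_int (hT : MeasurePreserving T μ μ) {F : Ω → ℝ} (hF : Integrable F μ) (n : ℕ) :
    Integrable (bS T F n) μ :=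
  integrable_finsetSum _ fun k _ =>
    ((hT.iterate k).integrable_comp hF.aestronglyMeasurable).2 hF

theorem bS_integral [IsProbabilityMeasure μ] (hT : MeasurePreserving T μ μ) {F : Ω → ℝ}
    (hFm : Measurable F)
    (hF : Integrable F μ) (n : ℕ) : ∫ ω, bS T F n ω ∂μ = n * ∫ ω, F ω ∂μ := by
  unfold bS
  have hi : ∀ k ∈ Finset.range n, Integrable (fun ω => F (T^[k] ω)) μ := fun k _ =>
    ((hT.iterate k).integrable_comp hF.aestronglyMeasurable).2 hF
  rw [integral_finsetSum _ hi]
  simp [integral_comp_iter hT hFm]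

theorem bS_add (T : Ω → Ω) (F : Ω → ℝ) (m n : ℕ) (ω : Ω) :
    bS T F (m + n) ω = bS T F m ω + bS T F n (T^[m] ω) := by
  unfold bS
  rw [Finset.sum_range_add]
  congr 1
  refine Finset.sum_congr rfl fun k _ => ?_
  rw [← Function.iterate_add_apply, add_comm]

theorem upper_claim [IsProbabilityMeasure μ] (hT : MeasurePreserving T μ μ) (F : Ω → ℝ)
    (hFm : Measurable F) (hFi : Integrable F μ) (hF0 : ∀ ω, 0 ≤ F ω) :
    ∫⁻ ω, upF (bS T F) ω ∂μ ≤ ENNReal.ofReal (∫ ω, F ω ∂μ) := by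
  have hum := upF_meas (bS_meas hT.measurable hFm)
  have hinv : ∀ ω, upF (bS T F) (T ω) ≤ upF (bS T F) ω := by
    intro ω
    unfold upF
    refine limsup_cmp _ _ (fun n => n + 1) (tendsto_add_atTop_nat 1) fun a b ha hab => ?_
    filter_upwards [div_small a (sub_pos.2 hab), eventually_gt_atTop 0] with n h1 h2 h3
    have hn : (0:ℝ) < n := by exact_mod_cast h2
    rw [div_le_iff₀ (by positivity)] at h3
    have hs := bS_add T F 1 n ω
    rw [add_comm 1 n] at hs
    have h4 : bS T F 1 ω = F ω := by simp [bS]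
    simp only [Function.iterate_one, h4] at hs
    push_cast at h3
    rw [div_le_iff₀ hn]
    nlinarith [hF0 ω]
  have hcap : ∀ M : ℕ, ∫⁻ ω, min (upF (bS T F) ω) M ∂μ ≤ ENNReal.ofReal (∫ ω, F ω ∂μ) := by
    intro M
    set h : Ω → ENNReal := fun ω => min (upF (bS T F) ω) M with hh
    have hhm : Measurable h := hum.min measurable_const
    have hhM : ∀ ω, h ω ≤ M := fun ω => min_le_right _ _
    have hht : ∀ ω, h ω ≠ ⊤ := fun ω => ((hhM ω).trans_lt (ENNReal.natCast_lt_top M)).ne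
    have hfin : ∫⁻ ω, h ω ∂μ ≠ ⊤ := by
      refine ((lintegral_mono hhM).trans_lt ?_).ne
      simp
    have hi : Integrable (fun ω => (h ω).toReal) μ :=
      integrable_toReal_of_lintegral_ne_top hhm.aemeasurable hfin
    have key : ∀ ε : ℝ, 0 < ε → ∫ ω, (h ω).toReal ∂μ ≤ ∫ ω, F ω ∂μ + ε := by
      intro ε hε
      have := E1 hT (fun n ω => - bS T F n ω) (fun n => (bS_meas hT.measurable hFm n).neg)
        (fun n => (bS_int hT hFi n).neg) (fun ω => by simp [bS])
        (fun m n ω => by rw [bS_add]; linarith)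
        (fun _ => 0) measurable_const (integrable_zero _ _ _) (fun _ => le_rfl)
        (fun ω => by simp [bS, hF0 ω])
        (fun ω => -(h ω).toReal + ε) (hhm.ennreal_toReal.neg.add_const _)
        (hi.neg.add (integrable_const ε)) ?_ ?_ (-∫ ω, F ω ∂μ) ?_
      · have hi' : Integrable (fun ω => -(h ω).toReal) μ := hi.neg
        rw [integral_add hi' (integrable_const ε), integral_neg] at this
        simp at this
        linarith
      · refine Eventually.of_forall fun ω => ?_
        have : (h (T ω)).toReal ≤ (h ω).toReal :=
          ENNReal.toReal_mono (hht ω) (min_le_min_right _ (hinv ω))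
        linarith
      · refine Eventually.of_forall fun ω => ?_
        by_cases hz : (h ω).toReal ≤ ε
        · refine ⟨1, le_rfl, ?_⟩
          have : 0 ≤ bS T F 1 ω := Finset.sum_nonneg fun _ _ => hF0 _
          simp only [Nat.cast_one, one_mul]
          linarith
        push Not at hz
        have h1 : ENNReal.ofReal ((h ω).toReal - ε) < upF (bS T F) ω := by
          refine lt_of_lt_of_le ?_ (min_le_left _ (M:ENNReal))
          rw [ENNReal.ofReal_lt_iff_lt_toReal (by linarith) (hht ω)]
          change _ < (h ω).toReal
          linarith
        have h2 := (frequently_lt_of_lt_limsup (by isBoundedDefault) h1).and_eventually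
          (eventually_ge_atTop 1)
        obtain ⟨l, hl, hl1⟩ := h2.exists
        refine ⟨l, hl1, ?_⟩
        have hl0 : (0:ℝ) < l := by exact_mod_cast hl1
        have h3 := (ENNReal.ofReal_lt_ofReal_iff_of_nonneg (by linarith)).1 hl
        rw [lt_div_iff₀ hl0] at h3
        nlinarith
      · intro n hn
        rw [integral_neg, bS_integral hT hFm hFi]
        linarith
    have h2 : ∫ ω, (h ω).toReal ∂μ ≤ ∫ ω, F ω ∂μ := le_of_forall_pos_le_add key
    rw [integral_toReal hhm.aemeasurable
      (Eventually.of_forall fun ω => (hht ω).lt_top)] at h2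
    rw [← ENNReal.ofReal_toReal hfin]
    exact ENNReal.ofReal_le_ofReal h2
  have hsup : ∀ ω, upF (bS T F) ω = ⨆ M : ℕ, min (upF (bS T F) ω) M := by
    intro ω
    rw [← inf_iSup_eq]
    rw [ENNReal.iSup_natCast]
    simp
  calc ∫⁻ ω, upF (bS T F) ω ∂μ = ∫⁻ ω, ⨆ M : ℕ, min (upF (bS T F) ω) M ∂μ := by
        congr 1; ext ω; exact hsup ω
    _ = ⨆ M : ℕ, ∫⁻ ω, min (upF (bS T F) ω) M ∂μ := by
        refine lintegral_iSup (fun M => hum.min measurable_const) ?_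
        intro a b hab ω
        exact min_le_min_left _ (by exact_mod_cast hab)
    _ ≤ _ := iSup_le hcap

/-- upper and lower averages with matching integrals converge -/
theorem conv_of_claims {g : ℕ → Ω → ℝ} (hgm : ∀ n, Measurable (g n)) (hgn : ∀ n ω, 0 ≤ g n ω)
    (c : ℝ)
    (h1 : ∫⁻ ω, upF g ω ∂μ ≤ ENNReal.ofReal c) (h2 : ENNReal.ofReal c ≤ ∫⁻ ω, loF g ω ∂μ) :
    ∀ᵐ ω ∂μ, ∃ y : ℝ, Tendsto (fun n : ℕ => g n ω / n) atTop (𝓝 y) := by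
  have hup : ∫⁻ ω, upF g ω ∂μ ≠ ⊤ := (h1.trans_lt ENNReal.ofReal_lt_top).ne
  have hlo : ∫⁻ ω, loF g ω ∂μ ≠ ⊤ :=
    ((lintegral_mono (loF_le_upF g)).trans_lt hup.lt_top).ne
  have he := ae_eq_of_ae_le_of_lintegral_le (Eventually.of_forall (loF_le_upF g)) hlo
    (upF_meas hgm).aemeasurable (h1.trans h2)
  filter_upwards [he, ae_lt_top (upF_meas hgm) hup] with ω hω hf
  have ht : Tendsto (fun n : ℕ => ENNReal.ofReal (g n ω / n)) atTop (𝓝 (upF g ω)) :=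
    tendsto_of_liminf_eq_limsup hω rfl
  refine ⟨(upF g ω).toReal, ?_⟩
  have := (ENNReal.tendsto_toReal hf.ne).comp ht
  refine this.congr fun n => ?_
  simp only [Function.comp]
  exact ENNReal.toReal_ofReal (div_nonneg (hgn n ω) (Nat.cast_nonneg n))

theorem birkhoff_nonneg [IsProbabilityMeasure μ] (hT : MeasurePreserving T μ μ) (F : Ω → ℝ)
    (hFm : Measurable F) (hFi : Integrable F μ) (hF0 : ∀ ω, 0 ≤ F ω) :
    ∀ᵐ ω ∂μ, ∃ y : ℝ, Tendsto (fun n : ℕ => bS T F n ω / n) atTop (𝓝 y) := by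
  refine conv_of_claims (bS_meas hT.measurable hFm)
    (fun n ω => Finset.sum_nonneg fun _ _ => hF0 _) _ (upper_claim hT F hFm hFi hF0)
    (lower_claim hT _ (bS_meas hT.measurable hFm) (bS_int hT hFi) (fun ω => by simp [bS])
      (fun n ω => Finset.sum_nonneg fun _ _ => hF0 _) (fun m n ω => (bS_add T F m n ω).le) _ ?_)
  intro n hn
  rw [bS_integral hT hFm hFi]

theorem sublinear [IsProbabilityMeasure μ] (hT : MeasurePreserving T μ μ) (F : Ω → ℝ)
    (hFm : Measurable F) (hFi : Integrable F μ) (hF0 : ∀ ω, 0 ≤ F ω) :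
    ∀ᵐ ω ∂μ, ∀ ε : ℝ, 0 < ε → ∀ᶠ n : ℕ in atTop, F (T^[n] ω) ≤ ε * n := by
  filter_upwards [birkhoff_nonneg hT F hFm hFi hF0] with ω hω ε hε
  obtain ⟨y, hy⟩ := hω
  have h1 : Tendsto (fun n : ℕ => bS T F (n+1) ω / ((n+1 : ℕ):ℝ) - bS T F n ω / n) atTop
      (𝓝 (y - y)) := ((tendsto_add_atTop_iff_nat 1).2 hy).sub hy
  rw [sub_self] at h1
  have h2 := h1.eventually_lt_const (show (0:ℝ) < ε/2 by linarith)
  have h3 := hy.eventually_lt_const (show y < |y| + 1 by linarith [le_abs_self y])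
  filter_upwards [h2, h3, div_small (|y| + 1 + ε/2) (half_pos hε), eventually_gt_atTop 0]
    with n h2 h3 h4 h5
  have hn : (0:ℝ) < n := by exact_mod_cast h5
  have e : bS T F (n+1) ω = bS T F n ω + F (T^[n] ω) := Finset.sum_range_succ _ _
  set X := bS T F n ω / n with hX
  have hX' : bS T F n ω = X * n := by rw [hX]; field_simp
  have h6 : bS T F (n+1) ω < (X + ε/2) * (n+1) := by
    have : bS T F (n+1) ω / ((n+1 : ℕ):ℝ) < X + ε/2 := by linarith
    rw [div_lt_iff₀ (by positivity)] at this
    push_cast at this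
    exact this
  rw [e, hX'] at h6
  nlinarith

end erg

section erg2
variable {Ω : Type*} [MeasurableSpace Ω] {μ : Measure Ω} {T : Ω → Ω}

theorem sub_blocks (g : ℕ → Ω → ℝ) (hg0 : ∀ ω, g 0 ω = 0)
    (hsub : ∀ m n ω, g (m + n) ω ≤ g m ω + g n (T^[m] ω)) (m q r : ℕ) (ω : Ω) :
    g (m * q + r) ω ≤ bS (T^[m]) (g m) q ω + g r ((T^[m])^[q] ω) := by
  induction q generalizing r with
  | zero => simp [bS]
  | succ q ih =>
    have h1 := ih (m + r)
    have h2 := hsub m r ((T^[m])^[q] ω)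
    rw [show m * (q+1) + r = m * q + (m + r) by ring]
    have e : bS (T^[m]) (g m) (q+1) ω = bS (T^[m]) (g m) q ω + g m ((T^[m])^[q] ω) :=
      Finset.sum_range_succ _ _
    rw [e, Function.iterate_succ_apply' (T^[m]) q ω]
    linarith

theorem kingman_nonneg [IsProbabilityMeasure μ] (hT : MeasurePreserving T μ μ) (g : ℕ → Ω → ℝ)
    (hgm : ∀ n, Measurable (g n))
    (hgi : ∀ n, Integrable (g n) μ) (hg0 : ∀ ω, g 0 ω = 0) (hgn : ∀ n ω, 0 ≤ g n ω)
    (hsub : ∀ m n ω, g (m + n) ω ≤ g m ω + g n (T^[m] ω)) :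
    ∀ᵐ ω ∂μ, ∃ y : ℝ, Tendsto (fun n : ℕ => g n ω / n) atTop (𝓝 y) := by
  have hup : ∀ m : ℕ, 1 ≤ m → ∫⁻ ω, upF g ω ∂μ ≤ ENNReal.ofReal ((∫ ω, g m ω ∂μ) / m) := by
    intro m hm
    have hm0 : (0:ℝ) < m := by exact_mod_cast hm
    set F : Ω → ℝ := fun ω => g m ω / m with hF
    have hFm : Measurable F := (hgm m).div_const _
    have hFi : Integrable F μ := (hgi m).div_const _
    have hF0 : ∀ ω, 0 ≤ F ω := fun ω => div_nonneg (hgn m ω) hm0.le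
    set H : Ω → ℝ := fun ω => ∑ r ∈ Finset.range m, g r ω with hH
    have hHm : Measurable H := Finset.measurable_sum _ fun k _ => hgm k
    have hHi : Integrable H μ := integrable_finsetSum _ fun k _ => hgi k
    have hH0 : ∀ ω, 0 ≤ H ω := fun ω => Finset.sum_nonneg fun _ _ => hgn _ _
    have hle : ∀ᵐ ω ∂μ, upF g ω ≤ upF (bS (T^[m]) F) ω := by
      filter_upwards [sublinear (hT.iterate m) H hHm hHi hH0] with ω hω
      have hσ : Tendsto (fun n : ℕ => n / m) atTop atTop := Nat.tendsto_div_const_atTop (by omega)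
      refine limsup_cmp _ _ _ hσ fun a b ha hab => ?_
      filter_upwards [hσ.eventually (hω (b - a) (sub_pos.2 hab)), eventually_ge_atTop m] with n h1 h2 h3
      have hn : (0:ℝ) < n := by exact_mod_cast (by omega : 0 < n)
      have hq : 0 < n / m := Nat.div_pos h2 (by omega)
      have hq' : (0:ℝ) < (n / m : ℕ) := by exact_mod_cast hq
      rw [div_le_iff₀ hq'] at h3
      rw [div_le_iff₀ hn]
      have hb := sub_blocks (T := T) g hg0 hsub m (n / m) (n % m) ω
      rw [Nat.div_add_mod] at hb
      have hr : g (n % m) ((T^[m])^[n/m] ω) ≤ H ((T^[m])^[n/m] ω) :=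
        Finset.single_le_sum (f := fun r => g r ((T^[m])^[n/m] ω)) (fun i _ => hgn i _)
          (Finset.mem_range.2 (Nat.mod_lt _ (by omega)))
      have e : bS (T^[m]) (g m) (n/m) ω = m * bS (T^[m]) F (n/m) ω := by
        simp only [bS, hF, Finset.mul_sum]
        exact Finset.sum_congr rfl fun k _ => by field_simp
      have hmn : (m:ℝ) * (n / m : ℕ) ≤ n := by exact_mod_cast Nat.mul_div_le n m
      have hqn : ((n / m : ℕ):ℝ) ≤ n := by exact_mod_cast Nat.div_le_self n m
      have h4 : (m:ℝ) * bS (T^[m]) F (n/m) ω ≤ a * n := by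
        calc (m:ℝ) * bS (T^[m]) F (n/m) ω ≤ m * (a * (n/m:ℕ)) := by gcongr
          _ = a * (m * (n/m:ℕ)) := by ring
          _ ≤ a * n := by gcongr
      have h5 : (b - a) * ((n/m:ℕ):ℝ) ≤ (b - a) * n :=
        mul_le_mul_of_nonneg_left hqn (by linarith)
      linarith
    refine (lintegral_mono_ae hle).trans ((upper_claim (hT.iterate m) F hFm hFi hF0).trans ?_)
    rw [hF, integral_div]
  set x : ℕ → ℝ := fun m => (∫ ω, g (m+1) ω ∂μ) / ((m+1:ℕ):ℝ) with hx
  have hx0 : ∀ m, 0 ≤ x m := fun m =>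
    div_nonneg (integral_nonneg (hgn _)) (Nat.cast_nonneg _)
  have hbdd : BddBelow (Set.range x) := ⟨0, by rintro _ ⟨m, rfl⟩; exact hx0 m⟩
  set c := ⨅ m, x m with hc
  refine conv_of_claims hgm hgn c ?_ (lower_claim hT g hgm hgi hg0 hgn hsub c ?_)
  · by_contra hlt
    push Not at hlt
    have hU : ∫⁻ ω, upF g ω ∂μ ≠ ⊤ := ((hup 1 le_rfl).trans_lt ENNReal.ofReal_lt_top).ne
    have h1 : c < (∫⁻ ω, upF g ω ∂μ).toReal :=
      (ENNReal.ofReal_lt_iff_lt_toReal (le_ciInf hx0) hU).1 hlt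
    obtain ⟨m, hm⟩ := exists_lt_of_ciInf_lt h1
    have h2 := ENNReal.toReal_le_of_le_ofReal (hx0 m) (hup (m+1) (by omega))
    linarith
  · intro n hn
    obtain ⟨m, rfl⟩ : ∃ m, n = m + 1 := ⟨n - 1, by omega⟩
    have := ciInf_le hbdd m
    have hp : (0:ℝ) < ((m+1:ℕ):ℝ) := by positivity
    change c ≤ _ / _ at this
    rw [le_div_iff₀ hp] at this
    linarith

theorem kingman [IsProbabilityMeasure μ] (hT : MeasurePreserving T μ μ) (g : ℕ → Ω → ℝ)
    (hgm : ∀ n, Measurable (g n)) (f : Ω → ℝ) (hfm : Measurable f) (hfi : Integrable f μ)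
    (hf0 : ∀ ω, 0 ≤ f ω) (hgf : ∀ n ω, |g n ω| ≤ bS T f n ω)
    (hsub : ∀ m n ω, g (m + n) ω ≤ g m ω + g n (T^[m] ω)) :
    ∃ γ : Ω → ℝ, Measurable γ ∧
      ∀ᵐ ω ∂μ, Tendsto (fun n : ℕ => g n ω / n) atTop (𝓝 (γ ω)) := by
  have hbm := bS_meas hT.measurable hfm
  have hbi := bS_int hT hfi
  have hgi : ∀ n, Integrable (g n) μ := fun n =>
    (hbi n).mono' (hgm n).aestronglyMeasurable (Eventually.of_forall fun ω => hgf n ω)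
  have hg0 : ∀ ω, g 0 ω = 0 := fun ω => by
    have := hgf 0 ω
    simpa [bS] using this
  have h1 := kingman_nonneg hT (fun n ω => g n ω + bS T f n ω) (fun n => (hgm n).add (hbm n))
    (fun n => (hgi n).add (hbi n)) (fun ω => by simp [hg0, bS])
    (fun n ω => by have := hgf n ω; have := neg_abs_le (g n ω); linarith)
    (fun m n ω => by have := hsub m n ω; have := bS_add T f m n ω; linarith)
  have h2 := birkhoff_nonneg hT f hfm hfi hf0
  have h3 : ∀ᵐ ω ∂μ, ∃ y : ℝ, Tendsto (fun n : ℕ => g n ω / n) atTop (𝓝 y) := by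
    filter_upwards [h1, h2] with ω h1 h2
    obtain ⟨y, hy⟩ := h1
    obtain ⟨z, hz⟩ := h2
    refine ⟨y - z, (hy.sub hz).congr fun n => ?_⟩
    ring
  obtain ⟨γ, hγ, h⟩ := measurable_limit_of_tendsto_metrizable_ae
    (f := fun (n:ℕ) ω => g n ω / n) (L := atTop) (μ := μ)
    (fun n => ((hgm n).div_const _).aemeasurable) h3
  exact ⟨γ, hγ, h⟩

end erg2

section erg3
variable {Ω : Type*} [MeasurableSpace Ω] {μ : Measure Ω} {T : Ω → Ω}

theorem mS_pos_GL {d k : ℕ} (hk : k ≤ d) (X : GL (Fin d) ℝ) :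
    0 < mS k (X : Matrix (Fin d) (Fin d) ℝ) :=
  mS_pos hk _ ((X⁻¹ : GL (Fin d) ℝ) : Matrix (Fin d) (Fin d) ℝ) (by
    rw [← Units.val_mul]; simp)

theorem mS_meas {d k : ℕ} {X : Ω → Matrix (Fin d) (Fin d) ℝ}
    (h : ∀ i j, Measurable fun ω => X ω i j) : Measurable fun ω => mS k (X ω) := by
  unfold mS
  refine Finset.measurable_sum _ fun I _ => Finset.measurable_sum _ fun J _ => ?_
  simp only [Matrix.det_apply, Matrix.submatrix_apply]
  refine Measurable.abs (Finset.measurable_sum _ fun σ _ => Measurable.const_smul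
    (Finset.measurable_prod _ fun i _ => h _ _) _)

theorem mS_log_le {d k : ℕ} (hk : k ≤ d) (X : GL (Fin d) ℝ) {a : ℝ}
    (h : ∀ i j, |(X : Matrix (Fin d) (Fin d) ℝ) i j| ≤ Real.exp a) :
    Real.log (mS k (X : Matrix (Fin d) (Fin d) ℝ)) ≤ Real.log (mC d k + 1) + k * a := by
  have h1 := mS_le_of_entries k _ h
  have hc := mC_nonneg d k
  have h2 : mS k (X : Matrix (Fin d) (Fin d) ℝ) ≤ (mC d k + 1) * Real.exp (k * a) := by
    rw [Real.exp_nat_mul]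
    refine h1.trans ?_
    gcongr
    linarith
  calc _ ≤ Real.log ((mC d k + 1) * Real.exp (k * a)) := Real.log_le_log (mS_pos_GL hk X) h2
    _ = _ := by rw [Real.log_mul (by positivity) (by positivity), Real.log_exp]

theorem mS_log_mul {d k : ℕ} (hk : k ≤ d) (X Y : GL (Fin d) ℝ) :
    Real.log (mS k ((X * Y : GL (Fin d) ℝ) : Matrix (Fin d) (Fin d) ℝ)) ≤
      Real.log (mS k (X : Matrix (Fin d) (Fin d) ℝ)) +
      Real.log (mS k (Y : Matrix (Fin d) (Fin d) ℝ)) := by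
  rw [← Real.log_mul (mS_pos_GL hk X).ne' (mS_pos_GL hk Y).ne']
  refine Real.log_le_log (mS_pos_GL hk _) ?_
  rw [Units.val_mul]
  exact mS_mul_le _ _ _

theorem mS_log_one {d k : ℕ} (hk : k ≤ d) :
    0 ≤ Real.log (mS k ((1 : GL (Fin d) ℝ) : Matrix (Fin d) (Fin d) ℝ)) := by
  rw [Units.val_one]
  exact Real.log_nonneg (one_le_mS_one hk)

theorem mS_kingman [IsProbabilityMeasure μ] (hT : MeasurePreserving T μ μ) {d k : ℕ} (hk : k ≤ d)
    (X : ℕ → Ω → GL (Fin d) ℝ)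
    (hXm : ∀ n i j, Measurable fun ω => (X n ω : Matrix (Fin d) (Fin d) ℝ) i j)
    (f : Ω → ℝ) (hfm : Measurable f) (hfi : Integrable f μ) (hf0 : ∀ ω, 0 ≤ f ω)
    (h1 : ∀ ω i j, |(X 1 ω : Matrix (Fin d) (Fin d) ℝ) i j| ≤ Real.exp (f ω))
    (h1' : ∀ ω i j, |(((X 1 ω)⁻¹ : GL (Fin d) ℝ) : Matrix (Fin d) (Fin d) ℝ) i j| ≤ Real.exp (f ω))
    (hX : ∀ m n ω, X (m+n) ω = X n (T^[m] ω) * X m ω ∨ X (m+n) ω = X m ω * X n (T^[m] ω)) :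
    ∃ γ : Ω → ℝ, Measurable γ ∧ ∀ᵐ ω ∂μ, Tendsto
      (fun n : ℕ => (1/(n:ℝ)) * Real.log (mS k (X n ω : Matrix (Fin d) (Fin d) ℝ)))
      atTop (𝓝 (γ ω)) := by
  set L : GL (Fin d) ℝ → ℝ := fun X => Real.log (mS k (X : Matrix (Fin d) (Fin d) ℝ)) with hL
  have hLm : ∀ X Y, L (X * Y) ≤ L X + L Y := mS_log_mul hk
  have hLi : ∀ X, 0 ≤ L X + L X⁻¹ := fun X => by
    have := hLm X X⁻¹
    rw [mul_inv_cancel] at this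
    exact (mS_log_one hk).trans this
  set F : Ω → ℝ := fun ω => Real.log (mC d k + 1) + k * f ω with hF
  have hF1 : ∀ ω, L (X 1 ω) ≤ F ω := fun ω => mS_log_le hk _ (h1 ω)
  have hF1' : ∀ ω, L (X 1 ω)⁻¹ ≤ F ω := fun ω => mS_log_le hk _ (h1' ω)
  have hF0 : ∀ ω, 0 ≤ F ω := fun ω =>
    add_nonneg (Real.log_nonneg (by linarith [mC_nonneg d k])) (mul_nonneg (by positivity) (hf0 ω))
  have hK := kingman hT (fun n ω => if n = 0 then 0 else L (X n ω)) ?_ F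
    ((hfm.const_mul _).const_add _) ((integrable_const _).add (hfi.const_mul _)) hF0 ?_ ?_
  · obtain ⟨γ, hγ, h⟩ := hK
    refine ⟨γ, hγ, ?_⟩
    filter_upwards [h] with ω hω
    refine hω.congr' ?_
    filter_upwards [eventually_gt_atTop 0] with n hn
    simp only [hn.ne', if_false]
    simp only [hL]
    ring
  · intro n
    by_cases hn : n = 0
    · simp [hn]
    · simp only [hn, if_false]
      exact (mS_meas (hXm n)).log
  · intro n ω
    induction n with
    | zero => simp [bS]
    | succ n ih =>
      have e : bS T F (n+1) ω = bS T F n ω + F (T^[n] ω) := Finset.sum_range_succ _ _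
      rw [e]
      simp only [Nat.succ_ne_zero, if_false]
      rcases Nat.eq_zero_or_pos n with rfl | hn
      · have a1 := hLi (X 1 ω)
        have a2 := hF1 ω
        have a3 := hF1' ω
        simp only [bS, Finset.range_zero, Finset.sum_empty, zero_add, Function.iterate_zero, id]
        rw [abs_le]; constructor <;> linarith
      · simp only [hn.ne', if_false] at ih
        rw [abs_le] at ih ⊢
        have a1 := hF1 (T^[n] ω)
        have a2 := hF1' (T^[n] ω)
        set Z := X 1 (T^[n] ω)
        have a3 : L (X (n+1) ω) ≤ L (X n ω) + L Z := by
          rcases hX n 1 ω with h | h <;> rw [h]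
          · have := hLm Z (X n ω); linarith
          · exact hLm _ _
        have a4 : L (X n ω) ≤ L (X (n+1) ω) + L Z⁻¹ := by
          rcases hX n 1 ω with h | h <;> rw [h]
          · have := hLm Z⁻¹ (Z * X n ω)
            rw [inv_mul_cancel_left] at this
            linarith
          · have := hLm (X n ω * Z) Z⁻¹
            rw [mul_inv_cancel_right] at this
            linarith
        constructor <;> linarith
  · intro m n ω
    rcases Nat.eq_zero_or_pos m with rfl | hm
    · simp
    rcases Nat.eq_zero_or_pos n with rfl | hn
    · simp
    have hmn : m + n ≠ 0 := by omega
    simp only [hm.ne', hn.ne', if_false]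
    rw [if_neg hmn]
    rcases hX m n ω with h | h <;> rw [h]
    · have := hLm (X n (T^[m] ω)) (X m ω); linarith
    · exact hLm _ _

theorem inMeasure_comp [IsProbabilityMeasure μ] {X : ℕ → Ω → ℝ} (hXm : ∀ n, Measurable (X n))
    {γ : Ω → ℝ} (hγ : Measurable γ) (hX : ∀ᵐ ω ∂μ, Tendsto (fun n => X n ω) atTop (𝓝 (γ ω)))
    (S : ℕ → Ω → Ω) (hS : ∀ n, MeasurePreserving (S n) μ μ) (hSγ : ∀ n, ∀ᵐ ω ∂μ, γ (S n ω) = γ ω)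
    (a : ℕ → ℕ) (ha : Tendsto a atTop atTop) :
    TendstoInMeasure μ (fun n ω => X (a n) (S n ω)) atTop γ := by
  have h := tendstoInMeasure_of_tendsto_ae (fun n => (hXm n).aestronglyMeasurable) hX
  intro ε hε
  refine ((h ε hε).comp ha).congr fun n => ?_
  simp only [Function.comp]
  have hms : MeasurableSet {x | ε ≤ edist (X (a n) x) (γ x)} :=
    measurableSet_le measurable_const ((hXm _).edist hγ)
  rw [← (hS n).measure_preimage hms.nullMeasurableSet]
  refine measure_congr ?_
  filter_upwards [hSγ n] with ω hω
  change (ε ≤ edist (X (a n) (S n ω)) (γ (S n ω))) = (ε ≤ edist (X (a n) (S n ω)) (γ ω))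
  rw [hω]

end erg3

theorem abs_le_opNorm {d : ℕ} (M : Matrix (Fin d) (Fin d) ℝ) (i j : Fin d) : |M i j| ≤ opNorm M := by
  have hb : BddAbove (Set.range fun x : {x : Fin d → ℝ // eNorm x ≤ 1} =>
      eNorm (M *ᵥ (x : Fin d → ℝ))) := by
    refine ⟨∑ i, ∑ j, |M i j|, ?_⟩
    rintro _ ⟨⟨x, hx⟩, rfl⟩
    refine (eNorm_le_sum _).trans (Finset.sum_le_sum fun i _ => ?_)
    simp only [Matrix.mulVec, dotProduct]
    refine (Finset.abs_sum_le_sum_abs _ _).trans (Finset.sum_le_sum fun j _ => ?_)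
    rw [abs_mul]
    exact mul_le_of_le_one_right (abs_nonneg _) ((abs_le_eNorm x j).trans hx)
  have h1 : eNorm (Pi.single j (1:ℝ) : Fin d → ℝ) ≤ 1 := by
    unfold eNorm
    have e : ∑ i, (Pi.single j (1:ℝ) : Fin d → ℝ) i ^ 2 = 1 := by simp [Pi.single_apply]
    rw [e, Real.sqrt_one]
  have h2 := le_ciSup hb ⟨Pi.single j 1, h1⟩
  have h3 := abs_le_eNorm (M *ᵥ (Pi.single j (1:ℝ))) i
  simp only [Matrix.mulVec_single_one] at h3
  simp only [Matrix.mulVec_single_one] at h2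
  exact h3.trans h2

section erg4
variable {Ω : Type*} [MeasurableSpace Ω]

theorem det_meas {d : ℕ} {X : Ω → Matrix (Fin d) (Fin d) ℝ}
    (h : ∀ i j, Measurable fun ω => X ω i j) : Measurable fun ω => (X ω).det := by
  simp only [Matrix.det_apply]
  exact Finset.measurable_sum _ fun σ _ => Measurable.const_smul
    (Finset.measurable_prod _ fun i _ => h _ _) _

theorem inv_meas {d : ℕ} {X : Ω → GL (Fin d) ℝ}
    (h : ∀ i j, Measurable fun ω => (X ω : Matrix (Fin d) (Fin d) ℝ) i j) (i j : Fin d) :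
    Measurable fun ω => (((X ω)⁻¹ : GL (Fin d) ℝ) : Matrix (Fin d) (Fin d) ℝ) i j := by
  simp only [Matrix.coe_units_inv, Matrix.inv_def, Matrix.smul_apply, Matrix.adjugate_apply,
    Ring.inverse_eq_inv', smul_eq_mul]
  refine (det_meas h).inv.mul (det_meas fun a b => ?_)
  simp only [Matrix.updateRow_apply]
  split_ifs
  · exact measurable_const
  · exact h a b

theorem le_of_gr {f : ℕ → ℝ} {a b : ℝ} (f0 : ∀ n, 0 < f n)
    (h : Tendsto (fun n : ℕ => (1/(n:ℝ)) * Real.log (f n)) atTop (𝓝 a)) (hg : Gr f b) : a ≤ b := by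
  refine le_of_forall_pos_le_add fun ε hε => ?_
  refine le_of_tendsto h ?_
  filter_upwards [hg ε hε, eventually_gt_atTop 0] with n h1 h2
  have hn : (0:ℝ) < n := by exact_mod_cast h2
  have := Real.log_le_log (f0 n) h1
  rw [Real.log_exp] at this
  rw [one_div, inv_mul_le_iff₀ hn]
  exact this

/-- a measurable integrable function controlling the entries of `A` and its inverse -/
theorem exists_control {d : ℕ} (μ : Measure Ω) [IsProbabilityMeasure μ] (A : Ω → GL (Fin d) ℝ)
    (hA : ∀ i j, Measurable fun ω => (A ω : Matrix (Fin d) (Fin d) ℝ) i j)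
    (hint₁ : Integrable
      (fun ω => max (Real.log (opNorm (A ω : Matrix (Fin d) (Fin d) ℝ))) 0) μ)
    (hint₂ : Integrable
      (fun ω => max (Real.log (opNorm (((A ω)⁻¹ : GL (Fin d) ℝ) : Matrix (Fin d) (Fin d) ℝ))) 0)
      μ) :
    ∃ f : Ω → ℝ, Measurable f ∧ Integrable f μ ∧ (∀ ω, 0 ≤ f ω) ∧
      (∀ ω i j, |(A ω : Matrix (Fin d) (Fin d) ℝ) i j| ≤ Real.exp (f ω)) ∧
      (∀ ω i j, |(((A ω)⁻¹ : GL (Fin d) ℝ) : Matrix (Fin d) (Fin d) ℝ) i j| ≤ Real.exp (f ω)) := by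
  set P : Ω → ℝ := fun ω => ∑ i, ∑ j, |(A ω : Matrix (Fin d) (Fin d) ℝ) i j| with hP
  set Q : Ω → ℝ := fun ω =>
    ∑ i, ∑ j, |(((A ω)⁻¹ : GL (Fin d) ℝ) : Matrix (Fin d) (Fin d) ℝ) i j| with hQ
  have hPm : Measurable P := Finset.measurable_sum _ fun i _ => Finset.measurable_sum _ fun j _ =>
    (hA i j).abs
  have hQm : Measurable Q := Finset.measurable_sum _ fun i _ => Finset.measurable_sum _ fun j _ =>
    (inv_meas hA i j).abs
  have hP0 : ∀ ω, 0 ≤ P ω := fun ω => Finset.sum_nonneg fun i _ => Finset.sum_nonneg fun j _ =>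
    abs_nonneg _
  have hQ0 : ∀ ω, 0 ≤ Q ω := fun ω => Finset.sum_nonneg fun i _ => Finset.sum_nonneg fun j _ =>
    abs_nonneg _
  have hent : ∀ (M : Matrix (Fin d) (Fin d) ℝ) i j, |M i j| ≤ ∑ i, ∑ j, |M i j| := fun M i j =>
    (Finset.single_le_sum (f := fun j => |M i j|) (fun _ _ => abs_nonneg _)
      (Finset.mem_univ j)).trans
    (Finset.single_le_sum (f := fun i => ∑ j, |M i j|)
      (fun _ _ => Finset.sum_nonneg fun _ _ => abs_nonneg _) (Finset.mem_univ i))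
  have hsm : ∀ (M : Matrix (Fin d) (Fin d) ℝ), ∑ i, ∑ j, |M i j| ≤
      (d:ℝ)^2 * Real.exp (max (Real.log (opNorm M)) 0) := by
    intro M
    calc ∑ i, ∑ j, |M i j| ≤ ∑ i : Fin d, ∑ j : Fin d, Real.exp (max (Real.log (opNorm M)) 0) :=
          Finset.sum_le_sum fun i _ => Finset.sum_le_sum fun j _ =>
            (abs_le_opNorm M i j).trans ((Real.le_exp_log _).trans
              (Real.exp_le_exp.2 (le_max_left _ _)))
      _ = _ := by simp; ring
  have hf0 : ∀ ω, 0 ≤ Real.log (P ω + Q ω + 1) := fun ω =>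
    Real.log_nonneg (by linarith [hP0 ω, hQ0 ω])
  have hfm : Measurable fun ω => Real.log (P ω + Q ω + 1) := ((hPm.add hQm).add_const 1).log
  refine ⟨fun ω => Real.log (P ω + Q ω + 1), hfm, ?_, hf0, ?_, ?_⟩
  · refine Integrable.mono' ((integrable_const (Real.log (2*(d:ℝ)^2+1))).add (hint₁.add hint₂))
      hfm.aestronglyMeasurable (Eventually.of_forall fun ω => ?_)
    rw [Real.norm_eq_abs, abs_of_nonneg (hf0 ω)]
    simp only [Pi.add_apply]
    have h1 := hsm (A ω)
    have h2 := hsm ((A ω)⁻¹ : GL (Fin d) ℝ)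
    set α := max (Real.log (opNorm (A ω : Matrix (Fin d) (Fin d) ℝ))) 0
    set β := max (Real.log (opNorm (((A ω)⁻¹ : GL (Fin d) ℝ) : Matrix (Fin d) (Fin d) ℝ))) 0
    have hα : 0 ≤ α := le_max_right _ _
    have hβ : 0 ≤ β := le_max_right _ _
    have e1 : Real.exp α ≤ Real.exp (α + β) := Real.exp_le_exp.2 (by linarith)
    have e2 : Real.exp β ≤ Real.exp (α + β) := Real.exp_le_exp.2 (by linarith)
    have e3 : 1 ≤ Real.exp (α + β) := Real.one_le_exp (by linarith)
    have e4 : P ω + Q ω + 1 ≤ (2*(d:ℝ)^2+1) * Real.exp (α+β) := by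
      have := mul_le_mul_of_nonneg_left e1 (sq_nonneg (d:ℝ))
      have := mul_le_mul_of_nonneg_left e2 (sq_nonneg (d:ℝ))
      change P ω ≤ _ at h1
      change Q ω ≤ _ at h2
      linarith
    have e5 := Real.log_le_log (by linarith [hP0 ω, hQ0 ω]) e4
    rwa [Real.log_mul (by positivity) (by positivity), Real.log_exp] at e5
  · intro ω i j
    rw [Real.exp_log (by linarith [hP0 ω, hQ0 ω])]
    have := hent (A ω : Matrix (Fin d) (Fin d) ℝ) i j
    change _ ≤ P ω at this
    linarith [hQ0 ω]
  · intro ω i j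
    rw [Real.exp_log (by linarith [hP0 ω, hQ0 ω])]
    have := hent ((A ω)⁻¹ : GL (Fin d) ℝ) i j
    change _ ≤ Q ω at this
    linarith [hP0 ω]

end erg4

/-- the pointwise properties needed at a point of the full-measure set -/
structure Good {d : ℕ} {Ω : Type*} (θ : Equiv.Perm Ω) (φ : ℤ → Ω → GL (Fin d) ℝ) (f : Ω → ℝ)
    (γ : ℕ → Ω → ℝ) (ω : Ω) : Prop where
  fwd : ∀ k ≤ d, Tendsto (fun n : ℕ => (1/(n:ℝ)) *
    Real.log (mS k (φ n ω : Matrix (Fin d) (Fin d) ℝ))) atTop (𝓝 (γ k ω))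
  bwd : ∀ k ≤ d, Tendsto (fun n : ℕ => (1/(n:ℝ)) *
    Real.log (mS k (φ n ((θ ^ (-(n:ℤ))) ω) : Matrix (Fin d) (Fin d) ℝ))) atTop (𝓝 (γ k ω))
  mid : ∀ k ≤ d, ∃ ns : ℕ → ℕ, StrictMono ns ∧ Tendsto (fun i : ℕ => (1/((2 * ns i : ℕ):ℝ)) *
    Real.log (mS k (φ ((2 * ns i : ℕ) : ℤ) ((θ ^ (-(ns i:ℤ))) ω) : Matrix (Fin d) (Fin d) ℝ)))
    atTop (𝓝 (γ k ω))
  inv : ∀ k ≤ d, γ k (θ ω) = γ k ω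
  fsub : ∀ ε : ℝ, 0 < ε → ∀ᶠ n : ℕ in atTop, f ((θ ^ (n:ℤ)) ω) ≤ ε * n
  bsub : ∀ ε : ℝ, 0 < ε → ∀ᶠ n : ℕ in atTop, f ((θ ^ (-(n:ℤ))) ω) ≤ ε * n

theorem iter_fwd {Ω : Type*} (θ : Equiv.Perm Ω) (n : ℕ) (ω : Ω) : θ^[n] ω = (θ ^ (n:ℤ)) ω := by
  rw [Equiv.Perm.iterate_eq_pow, zpow_natCast]

theorem iter_bwd {Ω : Type*} (θ : Equiv.Perm Ω) (n : ℕ) (ω : Ω) :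
    θ.symm^[n] ω = (θ ^ (-(n:ℤ))) ω := by
  rw [Equiv.Perm.iterate_eq_pow, _root_.zpow_neg, zpow_natCast, ← inv_pow]
  rfl

theorem zp {Ω : Type*} (θ : Equiv.Perm Ω) (m n : ℤ) (ω : Ω) :
    (θ ^ m) ((θ ^ n) ω) = (θ ^ (m + n)) ω := by
  rw [← Equiv.Perm.mul_apply, ← _root_.zpow_add]

theorem zp1 {Ω : Type*} (θ : Equiv.Perm Ω) (n : ℤ) (ω : Ω) :
    θ ((θ ^ n) ω) = (θ ^ (1 + n)) ω := by
  rw [← zp, zpow_one]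

theorem good_ae {d : ℕ}
    {Ω : Type*} [MeasurableSpace Ω] (ℙ : Measure Ω) [IsProbabilityMeasure ℙ]
    (θ : Equiv.Perm Ω) (hθmeas : Measurable (θ : Ω → Ω))
    (hθinv : Measurable (θ.symm : Ω → Ω))
    (hθpres : MeasurePreserving (θ : Ω → Ω) ℙ ℙ)
    (A : Ω → GL (Fin d) ℝ)
    (hA : ∀ i j, Measurable fun ω => (A ω : Matrix (Fin d) (Fin d) ℝ) i j)
    (φ : ℤ → Ω → GL (Fin d) ℝ)
    (hφ0 : ∀ ω, φ 0 ω = 1)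
    (hφ1 : ∀ ω, φ 1 ω = A ω)
    (hφc : ∀ (m n : ℤ) (ω : Ω), φ (m + n) ω = φ m ((θ ^ n) ω) * φ n ω)
    (f : Ω → ℝ) (hfm : Measurable f) (hfi : Integrable f ℙ) (hf0 : ∀ ω, 0 ≤ f ω)
    (h1 : ∀ ω i j, |(A ω : Matrix (Fin d) (Fin d) ℝ) i j| ≤ Real.exp (f ω))
    (h1' : ∀ ω i j, |(((A ω)⁻¹ : GL (Fin d) ℝ) : Matrix (Fin d) (Fin d) ℝ) i j| ≤ Real.exp (f ω)) :
    ∃ γ : ℕ → Ω → ℝ, ∀ᵐ ω ∂ℙ, Good θ φ f γ ω := by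
  have hsym : MeasurePreserving (θ.symm : Ω → Ω) ℙ ℙ :=
    MeasurePreserving.symm (⟨θ, hθmeas, hθinv⟩ : Ω ≃ᵐ Ω) hθpres
  have hφm : ∀ (n : ℕ) i j, Measurable fun ω => (φ n ω : Matrix (Fin d) (Fin d) ℝ) i j := by
    intro n
    induction n with
    | zero => intro i j; simp [hφ0]
    | succ n ih =>
      intro i j
      have : ∀ ω, φ ((n+1 : ℕ):ℤ) ω = φ n (θ ω) * A ω := fun ω => by
        rw [Nat.cast_succ, hφc, hφ1, zpow_one]
      simp only [this, Units.val_mul, Matrix.mul_apply]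
      exact Finset.measurable_sum _ fun k _ => ((ih i k).comp hθmeas).mul (hA k j)
  have hbm : ∀ n : ℕ, MeasurePreserving (fun ω => (θ ^ (-(n:ℤ))) ω) ℙ ℙ := fun n => by
    have := hsym.iterate n
    rwa [show (θ.symm)^[n] = fun ω => (θ ^ (-(n:ℤ))) ω from funext (iter_bwd θ n)] at this
  have main : ∀ k : ℕ, ∃ γ : Ω → ℝ, k ≤ d → ∀ᵐ ω ∂ℙ,
      (Tendsto (fun n : ℕ => (1/(n:ℝ)) *
        Real.log (mS k (φ n ω : Matrix (Fin d) (Fin d) ℝ))) atTop (𝓝 (γ ω))) ∧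
      (Tendsto (fun n : ℕ => (1/(n:ℝ)) *
        Real.log (mS k (φ n ((θ ^ (-(n:ℤ))) ω) : Matrix (Fin d) (Fin d) ℝ))) atTop (𝓝 (γ ω))) ∧
      (∃ ns : ℕ → ℕ, StrictMono ns ∧ Tendsto (fun i : ℕ => (1/((2 * ns i : ℕ):ℝ)) *
        Real.log (mS k (φ ((2 * ns i : ℕ) : ℤ) ((θ ^ (-(ns i:ℤ))) ω) :
          Matrix (Fin d) (Fin d) ℝ))) atTop (𝓝 (γ ω))) ∧ γ (θ ω) = γ ω := by
    intro k
    by_cases hk : k ≤ d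
    swap
    · exact ⟨0, fun h => absurd h hk⟩
    obtain ⟨γ, hγm, hγ⟩ := mS_kingman hθpres hk (fun n ω => φ n ω) hφm f hfm hfi hf0
      (by simpa [hφ1] using h1) (by simpa [hφ1] using h1') (fun m n ω => Or.inl (by
        rw [iter_fwd, ← hφc]; push_cast; rw [add_comm]))
    obtain ⟨γ', hγm', hγ'⟩ := mS_kingman hsym hk (fun n ω => φ n ((θ ^ (-(n:ℤ))) ω))
      (fun n i j => (hφm n i j).comp (hbm n).measurable) (fun ω => f (θ.symm ω))
      (hfm.comp hθinv) ((hsym.integrable_comp hfi.aestronglyMeasurable).2 hfi) (fun ω => hf0 _)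
      (fun ω i j => by simpa [hφ1] using h1 (θ.symm ω) i j)
      (fun ω i j => by simpa [hφ1] using h1' (θ.symm ω) i j) (fun m n ω => Or.inr (by
        rw [iter_bwd]
        push_cast
        rw [hφc, zp, zp, show (n:ℤ) + -((m:ℤ) + n) = -m by ring,
          show -(n:ℤ) + -m = -((m:ℤ)+n) by ring]))
    refine ⟨γ, fun _ => ?_⟩
    have hinv : ∀ᵐ ω ∂ℙ, γ (θ ω) = γ ω := by
      filter_upwards [hγ, hθpres.quasiMeasurePreserving.ae hγ] with ω w1 w2
      have p1 : ∀ n : ℕ, 0 < mS k (φ n ω : Matrix (Fin d) (Fin d) ℝ) := fun n => mS_pos_GL hk _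
      have p2 : ∀ n : ℕ, 0 < mS k (φ n (θ ω) : Matrix (Fin d) (Fin d) ℝ) := fun n => mS_pos_GL hk _
      have e : ∀ n : ℕ, φ ((n+1 : ℕ):ℤ) ω = φ n (θ ω) * A ω := fun n => by
        rw [Nat.cast_succ, hφc, hφ1, zpow_one]
      refine le_antisymm (le_of_gr p2 w2 ?_) (le_of_gr p1 w1 (Gr.unshift ?_))
      · refine Gr.of_le ((Gr.of_tendsto p1 w1).shift.const_mul
          (mS k (((A ω)⁻¹ : GL (Fin d) ℝ) : Matrix (Fin d) (Fin d) ℝ)) (mS_nonneg _ _)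
          (fun n => (p1 _).le)) fun n => ?_
        have e' : φ n (θ ω) = φ ((n+1 : ℕ):ℤ) ω * (A ω)⁻¹ := by rw [e, mul_inv_cancel_right]
        rw [e', Units.val_mul, mul_comm (mS k _)]
        exact mS_mul_le _ _ _
      · refine Gr.of_le ((Gr.of_tendsto p2 w2).const_mul
          (mS k (A ω : Matrix (Fin d) (Fin d) ℝ)) (mS_nonneg _ _)
          (fun n => (p2 _).le)) fun n => ?_
        rw [e, Units.val_mul, mul_comm (mS k _)]
        exact mS_mul_le _ _ _
    have hinvn : ∀ n : ℕ, ∀ᵐ ω ∂ℙ, γ ((θ ^ (-(n:ℤ))) ω) = γ ω := by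
      intro n
      induction n with
      | zero => simp
      | succ n ih =>
        filter_upwards [ih, (hbm (n+1)).quasiMeasurePreserving.ae hinv] with ω w1 w2
        rw [← w2, ← w1]
        congr 1
        rw [zp1]
        congr 2
        push_cast; ring
    have hXm : ∀ n : ℕ, Measurable fun ω => (1/(n:ℝ)) *
        Real.log (mS k (φ n ω : Matrix (Fin d) (Fin d) ℝ)) := fun n =>
      (mS_meas (hφm n)).log.const_mul _
    have im1 := inMeasure_comp hXm hγm hγ _ hbm hinvn (fun n => n) tendsto_id
    have im2 := inMeasure_comp hXm hγm hγ _ hbm hinvn (fun n => 2 * n)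
      (tendsto_id.const_mul_atTop' (by norm_num))
    obtain ⟨ns, hns, hns2⟩ := im2.exists_seq_tendsto_ae
    have hγγ : γ' =ᵐ[ℙ] γ := by
      refine tendstoInMeasure_ae_unique (tendstoInMeasure_of_tendsto_ae (fun n => ?_) hγ') im1
      exact ((hXm n).comp (hbm n).measurable).aestronglyMeasurable
    filter_upwards [hγ, hγ', hγγ, hns2, hinv] with ω w1 w2 w3 w4 w5
    exact ⟨w1, w3 ▸ w2, ⟨ns, hns, w4⟩, w5⟩
  choose γ hγ using main
  refine ⟨γ, ?_⟩
  have hall := ae_all_iff.2 fun k => eventually_imp_distrib_left.2 (hγ k)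
  filter_upwards [hall, sublinear hθpres f hfm hfi hf0, sublinear hsym f hfm hfi hf0] with ω w a b
  refine ⟨fun k hk => (w k hk).1, fun k hk => (w k hk).2.1, fun k hk => (w k hk).2.2.1,
    fun k hk => (w k hk).2.2.2, ?_, ?_⟩
  · simpa only [iter_fwd] using a
  · simpa only [iter_bwd] using b

section pt
variable {d : ℕ}

theorem sing_rates {M U V : ℕ → Matrix (Fin d) (Fin d) ℝ} {s : ℕ → Fin d → ℝ} {γ : ℕ → ℝ}
    (h : ∀ n, SVD (M n) (U n) (V n) (s n)) (hs : ∀ n, Antitone (s n))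
    (hp : ∀ k ≤ d, ∀ n, 0 < mS k (M n))
    (hγ : ∀ k ≤ d, Tendsto (fun n : ℕ => (1/(n:ℝ)) * Real.log (mS k (M n))) atTop (𝓝 (γ k))) :
    (∀ j : Fin d, Gr (fun n => s n j) (γ (j+1) - γ j)) ∧
    (∀ j : Fin d, Gr (fun n => (s n j)⁻¹) (-(γ (j+1) - γ j))) := by
  have P0 : ∀ k (hk : k ≤ d) n, 0 < ∏ i : Fin k, s n (Fin.castLE hk i) := fun k hk n =>
    Finset.prod_pos fun i _ => (h n).pos _
  have g1 : ∀ k (hk : k ≤ d), Gr (fun n => ∏ i : Fin k, s n (Fin.castLE hk i)) (γ k) := fun k hk =>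
    Gr.of_le ((Gr.of_tendsto (hp k hk) (hγ k hk)).const_mul (mC d k ^ 2) (sq_nonneg _)
      (fun n => (hp k hk n).le)) fun n => (h n).le_mS hk
  have g2 : ∀ k (hk : k ≤ d), Gr (fun n => (∏ i : Fin k, s n (Fin.castLE hk i))⁻¹) (-γ k) :=
    fun k hk =>
    Gr.of_le ((Gr.of_tendsto_inv (hp k hk) (hγ k hk)).const_mul (mC d k ^ 3)
      (pow_nonneg (mC_nonneg _ _) _)
      (fun n => (inv_pos.2 (hp k hk n)).le)) fun n => by
        have := (h n).mS_le hk (hs n)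
        rw [← div_eq_mul_inv, le_div_iff₀ (hp k hk n), inv_mul_le_iff₀ (P0 k hk n), mul_comm]
        exact this
  have e : ∀ (j : Fin d) n, ∏ i : Fin (j+1), s n (Fin.castLE (by omega) i) =
      (∏ i : Fin j, s n (Fin.castLE (by omega) i)) * s n j := by
    intro j n
    rw [Fin.prod_univ_castSucc]
    rfl
  constructor
  · intro j
    have := (g1 (j+1) (by omega)).mul (g2 j (by omega)) (fun n => (P0 _ _ n).le)
      (fun n => (inv_pos.2 (P0 _ _ n)).le)
    rw [← sub_eq_add_neg] at this
    refine this.of_le fun n => ?_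
    rw [e, mul_comm, inv_mul_cancel_left₀ (P0 _ _ n).ne']
  · intro j
    have := (g2 (j+1) (by omega)).mul (g1 j (by omega)) (fun n => (inv_pos.2 (P0 _ _ n)).le)
      (fun n => (P0 _ _ n).le)
    rw [show -γ (j+1) + γ j = -(γ (j+1) - γ j) by ring] at this
    refine this.of_le fun n => ?_
    rw [e, _root_.mul_inv_rev, inv_mul_cancel_right₀ (P0 _ _ n).ne']

theorem rates_antitone {s : ℕ → Fin d → ℝ} {l : Fin d → ℝ} (hs : ∀ n, Antitone (s n))
    (s0 : ∀ n j, 0 < s n j)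
    (h1 : ∀ j : Fin d, Gr (fun n => s n j) (l j)) (h2 : ∀ j : Fin d, Gr (fun n => (s n j)⁻¹) (-l j)) :
    Antitone l := by
  intro i j hij
  exact le_of_gr (fun n => s0 n j) (Gr.tendsto_log (fun n => s0 n j) (h1 j) (h2 j))
    ((h1 i).of_le fun n => hs n hij)

theorem Coc.lower' {M A B U V : ℕ → Matrix (Fin d) (Fin d) ℝ} {s : ℕ → Fin d → ℝ} {l : Fin d → ℝ}
    {W : Matrix (Fin d) (Fin d) ℝ} (h : Coc M A B U V s l) (hW : LimW V l W) {t : ℝ}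
    {x : Fin d → ℝ} (hx : ∀ μ < t, x ∉ slow M μ) : Gr (fun n => (eNorm (M n *ᵥ x))⁻¹) (-t) := by
  by_cases hj : ∃ j, t ≤ l j ∧ (Wᵀ *ᵥ x) j ≠ 0
  · obtain ⟨j, h1, h2⟩ := hj
    exact h.lower hW h1 h2
  push Not at hj
  exfalso
  set S := insert (t-1) ((Finset.univ.filter fun j => l j < t).image l) with hS
  have hne : S.Nonempty := Finset.insert_nonempty _ _
  have hm : S.max' hne < t := by
    rw [Finset.max'_lt_iff]
    intro y hy
    simp only [hS, Finset.mem_insert, Finset.mem_image, Finset.mem_filter, Finset.mem_univ,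
      true_and] at hy
    rcases hy with rfl | ⟨a, ha, rfl⟩
    · linarith
    · exact ha
  refine hx _ hm ?_
  rw [h.slow_eq hW, mem_cSub]
  intro j hj2
  simp only [Finset.mem_filter, Finset.mem_univ, true_and] at hj2
  refine hj j (le_of_not_gt fun hlt => hj2 (Finset.le_max' _ _ ?_))
  simp only [hS, Finset.mem_insert, Finset.mem_image, Finset.mem_filter, Finset.mem_univ, true_and]
  exact Or.inr ⟨j, hlt, rfl⟩

theorem trans_core {M N N' A B A' B' U V : ℕ → Matrix (Fin d) (Fin d) ℝ} {s s' : ℕ → Fin d → ℝ}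
    {γ : ℕ → ℝ} {F : Matrix (Fin d) (Fin d) ℝ}
    (hN : Coc N A B U V s (fun j : Fin d => -(γ (j+1) - γ j)))
    (hN' : Coc (fun n => (N' n)ᵀ) A' B' U V s' (fun j : Fin d => γ (j+1) - γ j))
    (hF : LimW V (fun j : Fin d => -(γ (j+1) - γ j)) F)
    (hF' : LimW V (fun j : Fin d => γ (j+1) - γ j) F)
    (hM1 : ∀ k ≤ d, Gr (fun n => mS k (M n)) (γ k))
    (hN1 : ∀ k ≤ d, Gr (fun n => mS k (N' n)) (γ k))
    (hmp : ∀ k ≤ d, ∀ n, 0 < mS k (M n * N' n))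
    (mid : ∀ k ≤ d, ∃ ns : ℕ → ℕ, StrictMono ns ∧ Tendsto (fun i : ℕ => (1/((2 * ns i : ℕ):ℝ)) *
      Real.log (mS k (M (ns i) * N' (ns i)))) atTop (𝓝 (γ k)))
    {μ μ' : ℝ} (hμ : μ < μ') {x : Fin d → ℝ} (hx : x ∈ slow M μ) (hx' : x ∈ slow N (-μ')) :
    x = 0 := by
  by_contra hx0
  rw [hN.slow_eq hF, mem_cSub] at hx'
  simp only [Finset.mem_filter, Finset.mem_univ, true_and, neg_le_neg_iff, not_le] at hx'
  set S := Finset.univ.filter fun j : Fin d => μ' ≤ γ (j+1) - γ j with hS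
  have hFF : F * Fᵀ = 1 := mul_eq_one_comm.1 hF.orth
  have hne : S.Nonempty := by
    by_contra hcon
    rw [Finset.not_nonempty_iff_eq_empty, Finset.filter_eq_empty_iff] at hcon
    apply hx0
    have : Fᵀ *ᵥ x = 0 := funext fun j => hx' j (not_le.1 (hcon (Finset.mem_univ j)))
    have h2 : F *ᵥ (Fᵀ *ᵥ x) = x := by rw [mulVec_mulVec, hFF, one_mulVec]
    rw [← h2, this, mulVec_zero]
  set k := S.max' hne with hk
  have hkS : μ' ≤ γ (k+1) - γ k := (Finset.mem_filter.1 (S.max'_mem hne)).2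
  have hgt : ∀ a : Fin d, (k:ℕ) + 1 ≤ a → γ (a+1) - γ a < μ' := by
    intro a ha
    by_contra hcon
    have : a ≤ k := Finset.le_max' _ _ (by simpa [hS] using hcon)
    have : (a:ℕ) ≤ k := this
    omega
  set Q := insert μ ((Finset.univ.filter fun a : Fin d => (k:ℕ) + 1 ≤ a).image
    fun a : Fin d => γ (a+1) - γ a) with hQ
  have hQne : Q.Nonempty := Finset.insert_nonempty _ _
  have hr : Q.max' hQne < μ' := by
    rw [Finset.max'_lt_iff]
    intro y hy
    simp only [hQ, Finset.mem_insert, Finset.mem_image, Finset.mem_filter, Finset.mem_univ,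
      true_and] at hy
    rcases hy with rfl | ⟨a, ha, rfl⟩
    · exact hμ
    · exact hgt a ha
  set r := Q.max' hQne
  have hμr : μ ≤ r := Finset.le_max' _ _ (Finset.mem_insert_self _ _)
  have har : ∀ a : Fin d, (k:ℕ) + 1 ≤ a → γ (a+1) - γ a ≤ r := fun a ha =>
    Finset.le_max' _ _ (by
      simp only [hQ, Finset.mem_insert, Finset.mem_image, Finset.mem_filter, Finset.mem_univ,
        true_and]
      exact Or.inr ⟨a, ha, rfl⟩)
  have hk1 : (k:ℕ) + 1 ≤ d := k.2
  have hk0 : (k:ℕ) ≤ d := by omega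
  have T := transversal M N' F hF.orth (hM1 _ hk1) (hM1 _ hk0) (hN1 _ hk1) (hN1 _ hk0) hx0
    (r := r) (Gr.rate hx hμr) (fun a ha => hx' a (hgt a ha)) (fun a ha => by
      have : F *ᵥ Pi.single a 1 ∈ slow (fun n => (N' n)ᵀ) (γ (a+1) - γ a) := by
        rw [hN'.slow_eq hF', mem_cSub]
        intro j hj
        rw [mulVec_mulVec, hF.orth, one_mulVec]
        refine Pi.single_eq_of_ne (fun e => hj ?_) _
        simp [e]
      exact Gr.rate this (har a ha))
  obtain ⟨ns, hns, hlim⟩ := mid _ hk1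
  have key : ∀ ε : ℝ, 0 < ε → γ (k+1) ≤ (γ (k+1) + (r + γ k) + ε) / 2 := by
    intro ε hε
    refine le_of_tendsto hlim ?_
    filter_upwards [hns.tendsto_atTop.eventually (T ε hε),
      hns.tendsto_atTop.eventually (eventually_gt_atTop 0)] with i h1 h2
    have hn : (0:ℝ) < ns i := by exact_mod_cast h2
    have := Real.log_le_log (hmp _ hk1 _) h1
    rw [Real.log_exp] at this
    push_cast
    rw [one_div, inv_mul_le_iff₀ (by positivity)]
    linarith
  have := key ((μ' - r)/2) (by linarith)
  linarith

/-- the pointwise Oseledets data -/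
structure Pt (M N : ℕ → Matrix (Fin d) (Fin d) ℝ) (l : Fin d → ℝ) (W : Matrix (Fin d) (Fin d) ℝ) :
    Prop where
  orth : Wᵀ * W = 1
  roots : ∃ R : ℕ → Matrix (Fin d) (Fin d) ℝ,
      (∀ n : ℕ, 1 ≤ n → (R n).IsSymm ∧ (R n).PosDef ∧ R n ^ (2 * n) = (M n)ᵀ * M n) ∧
      Tendsto R atTop (𝓝 (W * diagonal (fun j => Real.exp (l j)) * Wᵀ))
  dimM : ∀ μ, Module.finrank ℝ (slow M μ) = (Finset.univ.filter fun j => l j ≤ μ).card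
  dimN : ∀ μ, Module.finrank ℝ (slow N (-μ)) = (Finset.univ.filter fun j => μ ≤ l j).card
  lowM : ∀ t x, (∀ μ < t, x ∉ slow M μ) → Gr (fun n => (eNorm (M n *ᵥ x))⁻¹) (-t)
  lowN : ∀ t x, (∀ μ < t, x ∉ slow N μ) → Gr (fun n => (eNorm (N n *ᵥ x))⁻¹) (-t)
  trans : ∀ μ μ', μ < μ' → ∀ x, x ∈ slow M μ → x ∈ slow N (-μ') → x = 0

theorem gr_of_sub {g : ℕ → ℝ} {f : ℕ → ℝ} (h : ∀ ε : ℝ, 0 < ε → ∀ᶠ n : ℕ in atTop, f n ≤ ε * n)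
    (hg : ∀ n, g n ≤ Real.exp (f n)) : Gr g 0 := by
  intro ε hε
  filter_upwards [h ε hε] with n hn
  refine (hg n).trans (Real.exp_le_exp.2 ?_)
  linarith

theorem good_pt {Ω : Type*} (θ : Equiv.Perm Ω)
    (A : Ω → GL (Fin d) ℝ)
    (φ : ℤ → Ω → GL (Fin d) ℝ)
    (hφ0 : ∀ ω, φ 0 ω = 1)
    (hφ1 : ∀ ω, φ 1 ω = A ω)
    (hφc : ∀ (m n : ℤ) (ω : Ω), φ (m + n) ω = φ m ((θ ^ n) ω) * φ n ω)
    (f : Ω → ℝ)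
    (h1 : ∀ ω i j, |(A ω : Matrix (Fin d) (Fin d) ℝ) i j| ≤ Real.exp (f ω))
    (h1' : ∀ ω i j, |(((A ω)⁻¹ : GL (Fin d) ℝ) : Matrix (Fin d) (Fin d) ℝ) i j| ≤ Real.exp (f ω))
    (γ : ℕ → Ω → ℝ) (ω : Ω) (hG : Good θ φ f γ ω) :
    ∃ W, Pt (fun n : ℕ => (φ n ω : Matrix (Fin d) (Fin d) ℝ))
      (fun n : ℕ => (φ (-(n:ℤ)) ω : Matrix (Fin d) (Fin d) ℝ)) (fun j => γ (j+1) ω - γ j ω) W := by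
  set γ0 : ℕ → ℝ := fun k => γ k ω with hγ0
  set l : Fin d → ℝ := fun j => γ0 (j+1) - γ0 j with hl
  set M : ℕ → Matrix (Fin d) (Fin d) ℝ := fun n => (φ n ω : Matrix (Fin d) (Fin d) ℝ) with hM
  set N : ℕ → Matrix (Fin d) (Fin d) ℝ := fun n => (φ (-(n:ℤ)) ω : Matrix (Fin d) (Fin d) ℝ) with hN
  set N' : ℕ → Matrix (Fin d) (Fin d) ℝ := fun n =>
    (φ n ((θ ^ (-(n:ℤ))) ω) : Matrix (Fin d) (Fin d) ℝ) with hN'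
  have inv1 : ∀ X : GL (Fin d) ℝ, ((X⁻¹ : GL (Fin d) ℝ) : Matrix (Fin d) (Fin d) ℝ) * X = 1 :=
    fun X => by rw [← Units.val_mul]; simp
  have inv2 : ∀ X : GL (Fin d) ℝ, (X : Matrix (Fin d) (Fin d) ℝ) *
      ((X⁻¹ : GL (Fin d) ℝ) : Matrix (Fin d) (Fin d) ℝ) = 1 :=
    fun X => by rw [← Units.val_mul]; simp
  -- forward
  have sv := fun n => svd_exists (M n) (φ n ω).isUnit
  choose U V s hsvd hs using sv
  have hMp : ∀ k ≤ d, ∀ n, 0 < mS k (M n) := fun k hk n => mS_pos_GL hk _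
  obtain ⟨gs, gs'⟩ := sing_rates hsvd hs hMp hG.fwd
  have cM : Coc M (fun n => (A ((θ ^ (n:ℤ)) ω) : Matrix (Fin d) (Fin d) ℝ))
      (fun n => (((A ((θ ^ (n:ℤ)) ω))⁻¹ : GL (Fin d) ℝ) : Matrix (Fin d) (Fin d) ℝ)) U V s l := by
    refine ⟨hsvd, fun n => ?_, fun n => inv1 _, fun i j => gr_of_sub hG.fsub fun n => h1 _ i j,
      fun i j => gr_of_sub hG.fsub fun n => h1' _ i j, gs, gs'⟩
    simp only [hM]
    rw [← Units.val_mul, ← hφ1, ← hφc]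
    congr 2
    push_cast; ring
  obtain ⟨W, hW, hWl⟩ := cM.limit
  have LW : LimW V l W := ⟨hW, hWl⟩
  -- backward
  have sv' := fun n : ℕ => svd_exists (N' n) (φ n ((θ ^ (-(n:ℤ))) ω)).isUnit
  choose U' V' s' hsvd' hs' using sv'
  have hNp : ∀ k ≤ d, ∀ n, 0 < mS k (N' n) := fun k hk n => mS_pos_GL hk _
  obtain ⟨ts, ts'⟩ := sing_rates hsvd' hs' hNp hG.bwd
  have hb : ∀ ε : ℝ, 0 < ε → ∀ᶠ n : ℕ in atTop, f ((θ ^ (-(n:ℤ))) ω) ≤ ε * n := hG.bsub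
  have gA : ∀ i j, Gr (fun n : ℕ =>
      |(A ((θ ^ (-((n+1 : ℕ):ℤ))) ω) : Matrix (Fin d) (Fin d) ℝ) i j|) 0 := fun i j =>
    Gr.shift (f := fun n : ℕ => |(A ((θ ^ (-(n:ℤ))) ω) : Matrix (Fin d) (Fin d) ℝ) i j|)
      (gr_of_sub hb fun n => h1 _ i j)
  have gB : ∀ i j, Gr (fun n : ℕ => |(((A ((θ ^ (-((n+1 : ℕ):ℤ))) ω))⁻¹ : GL (Fin d) ℝ) :
      Matrix (Fin d) (Fin d) ℝ) i j|) 0 := fun i j =>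
    Gr.shift (f := fun n : ℕ => |(((A ((θ ^ (-(n:ℤ))) ω))⁻¹ : GL (Fin d) ℝ) :
      Matrix (Fin d) (Fin d) ℝ) i j|) (gr_of_sub hb fun n => h1' _ i j)
  have hNN : ∀ n, N n * N' n = 1 := fun n => by
    have := hφc (-(n:ℤ)) n ((θ ^ (-(n:ℤ))) ω)
    rw [zp, neg_add_cancel, add_neg_cancel, hφ0, zpow_zero] at this
    simp only [hN, hN']
    rw [← Units.val_mul]
    simp only [Equiv.Perm.coe_one, id] at this
    rw [← this, Units.val_one]
  have cN : Coc N (fun n => (((A ((θ ^ (-((n+1 : ℕ):ℤ))) ω))⁻¹ : GL (Fin d) ℝ) :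
        Matrix (Fin d) (Fin d) ℝ))
      (fun n => (A ((θ ^ (-((n+1 : ℕ):ℤ))) ω) : Matrix (Fin d) (Fin d) ℝ)) V' U'
      (fun n j => (s' n j)⁻¹) (fun j : Fin d => -(γ0 (j+1) - γ0 j)) := by
    refine ⟨fun n => (hsvd' n).inv (hNN n), fun n => ?_, fun n => inv2 _, gB, gA, ts', fun j => ?_⟩
    · simp only [hN]
      rw [← Units.val_mul]
      congr 1
      rw [eq_inv_mul_iff_mul_eq, ← hφ1, ← hφc]
      congr 1
      push_cast; ring
    · simp only [inv_inv, neg_neg]; exact ts j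
  have cN' : Coc (fun n => (N' n)ᵀ)
      (fun n => (A ((θ ^ (-((n+1 : ℕ):ℤ))) ω) : Matrix (Fin d) (Fin d) ℝ)ᵀ)
      (fun n => (((A ((θ ^ (-((n+1 : ℕ):ℤ))) ω))⁻¹ : GL (Fin d) ℝ) :
        Matrix (Fin d) (Fin d) ℝ)ᵀ) V' U' s' (fun j : Fin d => γ0 (j+1) - γ0 j) := by
    refine ⟨fun n => (hsvd' n).tr, fun n => ?_, fun n => ?_, fun i j => gA j i, fun i j => gB j i,
      ts, ts'⟩
    · rw [← transpose_mul]
      congr 1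
      simp only [hN']
      rw [← Units.val_mul]
      congr 1
      have := hφc n 1 ((θ ^ (-((n+1 : ℕ):ℤ))) ω)
      rw [hφ1, zp] at this
      rw [show ((n+1 : ℕ):ℤ) = (n:ℤ) + 1 by push_cast; rfl] at this ⊢
      rw [this]
      congr 4
      ring
    · rw [← transpose_mul, inv2, transpose_one]
  obtain ⟨F, hF, hFl⟩ := cN'.limit
  have LF' : LimW U' (fun j : Fin d => γ0 (j+1) - γ0 j) F := ⟨hF, hFl⟩
  have LF : LimW U' (fun j : Fin d => -(γ0 (j+1) - γ0 j)) F := ⟨hF, fun g => hFl fun y => g (-y)⟩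
  have hMN : ∀ n : ℕ, M n * N' n = (φ ((2 * n : ℕ):ℤ) ((θ ^ (-(n:ℤ))) ω) :
      Matrix (Fin d) (Fin d) ℝ) := fun n => by
    simp only [hM, hN']
    rw [← Units.val_mul]
    congr 1
    have := hφc n n ((θ ^ (-(n:ℤ))) ω)
    rw [zp, add_neg_cancel, zpow_zero] at this
    simp only [Equiv.Perm.coe_one, id] at this
    rw [← this]
    congr 1
    push_cast; ring
  refine ⟨W, hW, cM.roots LW, fun μ => ?_, fun μ => ?_, fun t x hx => cM.lower' LW hx,
    fun t x hx => cN.lower' LF hx, fun μ μ' hμ x hx hx' => ?_⟩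
  · rw [cM.slow_eq LW, finrank_cSub _ hW]
  · rw [cN.slow_eq LF, finrank_cSub _ hF]
    simp only [neg_le_neg_iff]
    rfl
  · refine trans_core cN cN' LF LF' (fun k hk => Gr.of_tendsto (hMp k hk) (hG.fwd k hk))
      (fun k hk => Gr.of_tendsto (hNp k hk) (hG.bwd k hk)) (fun k hk n => ?_) (fun k hk => ?_)
      hμ hx hx'
    · rw [hMN]; exact mS_pos_GL hk _
    · simp only [hMN]; exact hG.mid k hk

end pt

section split
variable {d : ℕ}

theorem slow_mono {M : ℕ → Matrix (Fin d) (Fin d) ℝ} {μ ν : ℝ} (h : μ ≤ ν) :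
    slow M μ ≤ slow M ν := fun _ hx => Gr.rate hx h

/-- two-sided slow space -/
def sp2 (M N : ℕ → Matrix (Fin d) (Fin d) ℝ) (μ : ℝ) : Submodule ℝ (Fin d → ℝ) :=
  slow M μ ⊓ slow N (-μ)

theorem Pt.indep {M N : ℕ → Matrix (Fin d) (Fin d) ℝ} {l : Fin d → ℝ}
    {W : Matrix (Fin d) (Fin d) ℝ} (h : Pt M N l W) {p : ℕ} (lam : Fin p → ℝ)
    (hl : Function.Injective lam) : iSupIndep fun i => sp2 M N (lam i) := by
  classical
  rw [iSupIndep_iff_finsetSum_eq_zero_imp_eq_zero]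
  intro s v hv hs
  by_contra! hcon
  obtain ⟨i0, hi0s, hi0⟩ := hcon
  obtain ⟨i, hi, hmin⟩ := (s.filter fun i => v i ≠ 0).exists_min_image lam
    ⟨i0, by simp [hi0s, hi0]⟩
  rw [Finset.mem_filter] at hi
  have hsum : ∑ j ∈ s.filter (fun i => v i ≠ 0), v j = 0 := by
    rw [Finset.sum_filter_ne_zero, hs]
  rw [← Finset.add_sum_erase _ _ (show i ∈ s.filter (fun i => v i ≠ 0) by simpa using hi)] at hsum
  have hvi : v i = - ∑ j ∈ (s.filter (fun i => v i ≠ 0)).erase i, v j := eq_neg_of_add_eq_zero_left hsum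
  rcases ((s.filter (fun i => v i ≠ 0)).erase i).eq_empty_or_nonempty with he | hne
  · rw [he] at hvi
    exact hi.2 (by simpa using hvi)
  · obtain ⟨k, hk, hkmin⟩ := Finset.exists_min_image _ lam hne
    rw [Finset.mem_erase] at hk
    have hlt : lam i < lam k :=
      lt_of_le_of_ne (hmin k hk.2) fun e => hk.1 (hl e).symm
    refine hi.2 (h.trans _ _ hlt _ (hv i hi.1).1 ?_)
    rw [hvi]
    refine Submodule.neg_mem _ (Submodule.sum_mem _ fun j hj => ?_)
    have h1 := hkmin j hj
    simp only [Finset.mem_erase, Finset.mem_filter] at hj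
    exact slow_mono (by linarith) (hv j hj.2.1).2

theorem sum_finrank_le {p : ℕ} (E : Fin p → Submodule ℝ (Fin d → ℝ)) (h : iSupIndep E) :
    ∑ i, Module.finrank ℝ (E i) = Module.finrank ℝ (⨆ i, E i : Submodule ℝ (Fin d → ℝ)) := by
  classical
  let f : (∀ i, E i) →ₗ[ℝ] (Fin d → ℝ) := ∑ i, (E i).subtype ∘ₗ LinearMap.proj i
  have hf : ∀ x, f x = ∑ i, (x i : Fin d → ℝ) := by intro x; simp [f]
  have hinj : Function.Injective f := by
    rw [injective_iff_map_eq_zero]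
    intro x hx
    rw [hf] at hx
    rw [iSupIndep_iff_finsetSum_eq_zero_imp_eq_zero] at h
    have := h Finset.univ (fun i => (x i : Fin d → ℝ)) (fun i _ => (x i).2) hx
    ext i : 1
    exact Subtype.ext (this i (Finset.mem_univ i))
  have hr : LinearMap.range f = ⨆ i, E i := by
    apply le_antisymm
    · rintro _ ⟨x, rfl⟩
      rw [hf]
      exact Submodule.sum_mem _ fun i _ => Submodule.mem_iSup_of_mem i (x i).2
    · refine iSup_le fun i y hy => ⟨Pi.single i ⟨y, hy⟩, ?_⟩
      rw [hf, Finset.sum_eq_single i]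
      · simp
      · intro j _ hj; simp [Pi.single_eq_of_ne hj]
      · simp
  rw [← hr, LinearMap.finrank_range_of_inj hinj, Module.finrank_pi_fintype]

theorem Pt.split {M N : ℕ → Matrix (Fin d) (Fin d) ℝ} {l : Fin d → ℝ}
    {W : Matrix (Fin d) (Fin d) ℝ} (h : Pt M N l W) {p : ℕ} (lam : Fin p → ℝ)
    (hl : Function.Injective lam) (hr : ∀ j, ∃ i, lam i = l j) :
    (⨆ i, sp2 M N (lam i)) = ⊤ ∧
      ∀ i, Module.finrank ℝ (sp2 M N (lam i)) = (Finset.univ.filter fun j => l j = lam i).card := by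
  classical
  have hge : ∀ i, (Finset.univ.filter fun j => l j = lam i).card ≤
      Module.finrank ℝ (sp2 M N (lam i)) := by
    intro i
    have h1 := Submodule.finrank_sup_add_finrank_inf_eq (slow M (lam i)) (slow N (-lam i))
    have h2 := Submodule.finrank_le (slow M (lam i) ⊔ slow N (-lam i))
    rw [Module.finrank_fin_fun] at h2
    rw [h.dimM, h.dimN, ← Finset.card_union_add_card_inter] at h1
    have e1 : (Finset.univ.filter fun j => l j ≤ lam i) ∪ (Finset.univ.filter fun j => lam i ≤ l j)
        = Finset.univ := by
      ext j; simp [le_total]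
    have e2 : (Finset.univ.filter fun j => l j ≤ lam i) ∩ (Finset.univ.filter fun j => lam i ≤ l j)
        = (Finset.univ.filter fun j => l j = lam i) := by
      ext j; simp [le_antisymm_iff]
    rw [e1, e2, Finset.card_univ, Fintype.card_fin] at h1
    unfold sp2
    omega
  have hsum : ∑ i, (Finset.univ.filter fun j => l j = lam i).card = d := by
    choose g hg using hr
    have := Finset.card_eq_sum_card_fiberwise (f := g) (s := Finset.univ) (t := Finset.univ)
      (fun _ _ => Finset.mem_coe.2 (Finset.mem_univ _))
    rw [Finset.card_univ, Fintype.card_fin] at this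
    refine Eq.trans ?_ this.symm
    refine Finset.sum_congr rfl fun i _ => ?_
    congr 1
    ext j
    simp only [Finset.mem_filter, Finset.mem_univ, true_and]
    rw [← hg j]
    exact hl.eq_iff
  have hle := sum_finrank_le _ (h.indep lam hl)
  have hle2 := Submodule.finrank_le (⨆ i, sp2 M N (lam i))
  rw [Module.finrank_fin_fun, ← hle] at hle2
  have hs2 : ∑ i, Module.finrank ℝ (sp2 M N (lam i)) = d :=
    le_antisymm hle2 (hsum.symm.le.trans (Finset.sum_le_sum fun i _ => hge i))
  constructor
  · apply Submodule.eq_top_of_finrank_eq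
    rw [← hle, hs2, Module.finrank_fin_fun]
  · intro i
    have := (Finset.sum_eq_sum_iff_of_le (fun i _ => hge i)).1 (hsum.trans hs2.symm)
    exact (this i (Finset.mem_univ i)).symm

theorem Pt.eig {M N : ℕ → Matrix (Fin d) (Fin d) ℝ} {l : Fin d → ℝ}
    {W : Matrix (Fin d) (Fin d) ℝ} (h : Pt M N l W) (t : ℝ) :
    Module.finrank ℝ (Module.End.eigenspace
      (Matrix.toLin' (W * diagonal (fun j => Real.exp (l j)) * Wᵀ)) (Real.exp t)) =
      (Finset.univ.filter fun j => l j = t).card := by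
  rw [eigen_conj W h.orth, finrank_cSub W h.orth]
  simp

theorem Pt.eig' {M N : ℕ → Matrix (Fin d) (Fin d) ℝ} {l : Fin d → ℝ}
    {W : Matrix (Fin d) (Fin d) ℝ} (h : Pt M N l W) (μ : ℝ) :
    Module.End.eigenspace
      (Matrix.toLin' (W * diagonal (fun j => Real.exp (l j)) * Wᵀ)) μ ≠ ⊥ ↔
      ∃ j, Real.exp (l j) = μ := by
  rw [eigen_conj W h.orth, Ne, ← Submodule.finrank_eq_zero, finrank_cSub W h.orth,
    Finset.card_eq_zero, Finset.filter_eq_empty_iff]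
  simp

theorem Pt.lyap {M N : ℕ → Matrix (Fin d) (Fin d) ℝ} {l : Fin d → ℝ}
    {W : Matrix (Fin d) (Fin d) ℝ} (h : Pt M N l W) (t : ℝ) (x : Fin d → ℝ) (hx : x ≠ 0)
    (hM : ∀ n, 0 < eNorm (M n *ᵥ x)) (hN : ∀ n, 0 < eNorm (N n *ᵥ x)) :
    (Tendsto (fun n : ℕ => (1/(n:ℝ)) * Real.log (eNorm (M n *ᵥ x))) atTop (𝓝 t) ∧
     Tendsto (fun n : ℕ => (1/(n:ℝ)) * Real.log (eNorm (N n *ᵥ x))) atTop (𝓝 (-t))) ↔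
      x ∈ sp2 M N t := by
  constructor
  · rintro ⟨h1, h2⟩
    exact ⟨Gr.of_tendsto hM h1, Gr.of_tendsto hN h2⟩
  · rintro ⟨h1, h2⟩
    refine ⟨Gr.tendsto_log hM h1 (h.lowM t x fun μ hμ hs => hx (h.trans _ _ hμ _ hs h2)),
      Gr.tendsto_log hN h2 (h.lowN (-t) x fun μ hμ hs => hx ?_)⟩
    exact h.trans t (-μ) (by linarith) x h1 (by rwa [neg_neg])

/-- decreasing enumeration of the values of `l` -/
def lamOf (l : Fin d → ℝ) : Fin (Finset.univ.image l).card → ℝ :=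
  fun i => (Finset.univ.image l).orderEmbOfFin rfl i.rev

theorem lamOf_anti (l : Fin d → ℝ) : StrictAnti (lamOf l) := by
  intro i j hij
  exact ((Finset.univ.image l).orderEmbOfFin rfl).strictMono (Fin.rev_lt_rev.2 hij)

theorem lamOf_range (l : Fin d → ℝ) (t : ℝ) : (∃ i, lamOf l i = t) ↔ ∃ j, l j = t := by
  have h := Finset.range_orderEmbOfFin (Finset.univ.image l) rfl
  have h2 : t ∈ Set.range ((Finset.univ.image l).orderEmbOfFin rfl) ↔ ∃ j, l j = t := by
    rw [h]; simp
  rw [← h2]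
  constructor
  · rintro ⟨i, hi⟩; exact ⟨i.rev, hi⟩
  · rintro ⟨i, hi⟩; exact ⟨i.rev, by simpa [lamOf] using hi⟩

theorem lamOf_cast {l l' : Fin d → ℝ} (h : l = l')
    (hp : (Finset.univ.image l').card = (Finset.univ.image l).card)
    (i : Fin (Finset.univ.image l).card) : lamOf l' (Fin.cast hp.symm i) = lamOf l i := by
  subst h
  rfl

theorem int_lims (u : ℤ → ℝ) (t : ℝ) :
    (Tendsto (fun n : ℤ => (1/(n:ℝ)) * u n) atTop (𝓝 t) ∧
     Tendsto (fun n : ℤ => (1/(n:ℝ)) * u n) atBot (𝓝 t)) ↔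
    (Tendsto (fun n : ℕ => (1/(n:ℝ)) * u n) atTop (𝓝 t) ∧
     Tendsto (fun n : ℕ => (1/(n:ℝ)) * u (-(n:ℤ))) atTop (𝓝 (-t))) := by
  refine and_congr ?_ ?_
  · rw [← Nat.map_cast_int_atTop, tendsto_map'_iff]
    simp [Function.comp_def]
  · rw [← map_neg_atTop, tendsto_map'_iff, ← Nat.map_cast_int_atTop, tendsto_map'_iff]
    rw [← tendsto_neg_iff]
    have : (fun x => -(((fun n : ℤ => (1/(n:ℝ)) * u n) ∘ Neg.neg) ∘ (Nat.cast : ℕ → ℤ)) x) =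
      (fun n : ℕ => (1/(n:ℝ)) * u (-(n:ℤ))) := by
      ext n
      simp
    rw [this]

end split

theorem GL_mulVec_ne {d : ℕ} (X : GL (Fin d) ℝ) {x : Fin d → ℝ} (hx : x ≠ 0) :
    (X : Matrix (Fin d) (Fin d) ℝ) *ᵥ x ≠ 0 := by
  intro h
  apply hx
  have : ((X⁻¹ : GL (Fin d) ℝ) : Matrix (Fin d) (Fin d) ℝ) *ᵥ
      ((X : Matrix (Fin d) (Fin d) ℝ) *ᵥ x) = x := by
    rw [mulVec_mulVec, ← Units.val_mul, inv_mul_cancel, Units.val_one, one_mulVec]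
  rw [← this, h, mulVec_zero]

theorem inv_set {Ω : Type*} [MeasurableSpace Ω] (ℙ : Measure Ω) [IsProbabilityMeasure ℙ]
    (θ : Equiv.Perm Ω) (hθmeas : Measurable (θ : Ω → Ω))
    (hθinv : Measurable (θ.symm : Ω → Ω))
    (hθpres : MeasurePreserving (θ : Ω → Ω) ℙ ℙ) (P : Ω → Prop) (hP : ∀ᵐ ω ∂ℙ, P ω) :
    ∃ Ω' : Set Ω, MeasurableSet Ω' ∧ ℙ Ω' = 1 ∧ (θ : Ω → Ω) ⁻¹' Ω' = Ω' ∧ ∀ ω ∈ Ω', P ω := by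
  obtain ⟨t, ht, htm, ht0⟩ := exists_measurable_superset_of_null (ae_iff.1 hP)
  have hsymm : MeasurePreserving (θ.symm : Ω → Ω) ℙ ℙ :=
    MeasurePreserving.symm (⟨θ, hθmeas, hθinv⟩ : Ω ≃ᵐ Ω) hθpres
  have hz : ∀ n : ℤ, MeasurePreserving ((θ ^ n : Equiv.Perm Ω) : Ω → Ω) ℙ ℙ := by
    intro n
    obtain ⟨k, rfl | rfl⟩ := n.eq_nat_or_neg
    · convert hθpres.iterate k using 1
      ext ω; exact (iter_fwd θ k ω).symm
    · convert hsymm.iterate k using 1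
      ext ω; exact (iter_bwd θ k ω).symm
  have hU : MeasurableSet (⋃ n : ℤ, ((θ ^ n : Equiv.Perm Ω) : Ω → Ω) ⁻¹' t) :=
    MeasurableSet.iUnion fun n => (hz n).measurable htm
  have hU0 : ℙ (⋃ n : ℤ, ((θ ^ n : Equiv.Perm Ω) : Ω → Ω) ⁻¹' t) = 0 := by
    rw [measure_iUnion_null_iff]
    intro n
    rw [(hz n).measure_preimage htm.nullMeasurableSet, ht0]
  refine ⟨(⋃ n : ℤ, ((θ ^ n : Equiv.Perm Ω) : Ω → Ω) ⁻¹' t)ᶜ, hU.compl, ?_, ?_, ?_⟩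
  · rw [prob_compl_eq_one_iff hU, hU0]
  · ext ω
    simp only [Set.mem_preimage, Set.mem_compl_iff, Set.mem_iUnion, not_exists]
    constructor
    · intro h n
      have := h (n - 1)
      have e : (θ ^ (n - 1)) (θ ω) = (θ ^ n) ω := by
        have := zp θ (n - 1) 1 ω
        rwa [zpow_one, sub_add_cancel] at this
      rwa [e] at this
    · intro h n
      have := h (n + 1)
      rwa [← zp, zpow_one] at this
  · intro ω h
    by_contra hc
    refine h (Set.mem_iUnion.2 ⟨0, ?_⟩)
    exact ht hc

theorem map_sp2 {d : ℕ} {Ω : Type*} (θ : Equiv.Perm Ω) (A : Ω → GL (Fin d) ℝ)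
    (φ : ℤ → Ω → GL (Fin d) ℝ) (hφ1 : ∀ ω, φ 1 ω = A ω)
    (hφc : ∀ (m n : ℤ) (ω : Ω), φ (m + n) ω = φ m ((θ ^ n) ω) * φ n ω) (ω : Ω) (μ : ℝ) :
    Submodule.map (Matrix.toLin' (A ω : Matrix (Fin d) (Fin d) ℝ))
      (sp2 (fun n : ℕ => (φ n ω : Matrix (Fin d) (Fin d) ℝ))
        (fun n : ℕ => (φ (-(n:ℤ)) ω : Matrix (Fin d) (Fin d) ℝ)) μ) =
      sp2 (fun n : ℕ => (φ n (θ ω) : Matrix (Fin d) (Fin d) ℝ))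
        (fun n : ℕ => (φ (-(n:ℤ)) (θ ω) : Matrix (Fin d) (Fin d) ℝ)) μ := by
  have key : ∀ (m : ℤ) (x : Fin d → ℝ), (φ m (θ ω) : Matrix (Fin d) (Fin d) ℝ) *ᵥ
      ((A ω : Matrix (Fin d) (Fin d) ℝ) *ᵥ x) = (φ (m + 1) ω : Matrix (Fin d) (Fin d) ℝ) *ᵥ x := by
    intro m x
    rw [hφc, hφ1, zpow_one, Units.val_mul, mulVec_mulVec]
  have iff : ∀ x, (A ω : Matrix (Fin d) (Fin d) ℝ) *ᵥ x ∈
      sp2 (fun n : ℕ => (φ n (θ ω) : Matrix (Fin d) (Fin d) ℝ))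
        (fun n : ℕ => (φ (-(n:ℤ)) (θ ω) : Matrix (Fin d) (Fin d) ℝ)) μ ↔
      x ∈ sp2 (fun n : ℕ => (φ n ω : Matrix (Fin d) (Fin d) ℝ))
        (fun n : ℕ => (φ (-(n:ℤ)) ω : Matrix (Fin d) (Fin d) ℝ)) μ := by
    intro x
    unfold sp2
    rw [Submodule.mem_inf, Submodule.mem_inf, mem_slow, mem_slow, mem_slow, mem_slow]
    simp only [key]
    refine and_congr ⟨fun h => ?_, fun h => ?_⟩ ⟨fun h => ?_, fun h => ?_⟩
    · exact Gr.unshift (by simpa using h)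
    · simpa using h.shift
    · have := h.shift
      simpa using this
    · apply Gr.unshift
      simpa using h
  ext y
  rw [Submodule.mem_map]
  constructor
  · rintro ⟨x, hx, rfl⟩
    rw [toLin'_apply]
    exact (iff x).2 hx
  · intro hy
    have e : (A ω : Matrix (Fin d) (Fin d) ℝ) *ᵥ
        ((((A ω)⁻¹ : GL (Fin d) ℝ) : Matrix (Fin d) (Fin d) ℝ) *ᵥ y) = y := by
      rw [mulVec_mulVec, ← Units.val_mul, mul_inv_cancel, Units.val_one, one_mulVec]
    refine ⟨(((A ω)⁻¹ : GL (Fin d) ℝ) : Matrix (Fin d) (Fin d) ℝ) *ᵥ y, ?_, ?_⟩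
    · rw [← iff, e]; exact hy
    · rw [toLin'_apply, e]

/-- MET for a discrete-time linear cocycle, part (vi): on a `θ`-invariant full-measure set,
`Φ(ω) = lim_{n→∞}(φ(n,ω)ᵀφ(n,ω))^{1/(2n)}` exists with distinct eigenvalues
`e^{lam ω 0} > ⋯ > e^{lam ω (p ω - 1)}` of multiplicities `d_i(ω)`, and there is a splitting
`ℝ^d = E_1(ω) ⊕ ⋯ ⊕ E_{p(ω)}(ω)` with `dim E_i(ω) = d_i(ω)` such that
(a) `A(ω)E_i(ω) = E_i(θω)`, and (b) for `x ≠ 0`, `lim_{n→±∞} (1/n) log|φ(n,ω)x| = λ_i(ω)`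
(both signs simultaneously) iff `x ∈ E_i(ω) ∖ {0}`. -/
theorem discrete_MET_oseledets_splitting
    {d : ℕ} (hd : 1 ≤ d)
    {Ω : Type*} [MeasurableSpace Ω] (ℙ : Measure Ω) [IsProbabilityMeasure ℙ]
    (θ : Equiv.Perm Ω) (hθmeas : Measurable (θ : Ω → Ω))
    (hθinv : Measurable (θ.symm : Ω → Ω))
    (hθpres : MeasurePreserving (θ : Ω → Ω) ℙ ℙ)
    (A : Ω → GL (Fin d) ℝ)
    (hA : ∀ i j, Measurable fun ω => (A ω : Matrix (Fin d) (Fin d) ℝ) i j)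
    (φ : ℤ → Ω → GL (Fin d) ℝ)
    (hφ0 : ∀ ω, φ 0 ω = 1)
    (hφ1 : ∀ ω, φ 1 ω = A ω)
    (hφc : ∀ (m n : ℤ) (ω : Ω), φ (m + n) ω = φ m ((θ ^ n) ω) * φ n ω)
    (hint₁ : Integrable
      (fun ω => max (Real.log (opNorm (A ω : Matrix (Fin d) (Fin d) ℝ))) 0) ℙ)
    (hint₂ : Integrable
      (fun ω => max (Real.log (opNorm (((A ω)⁻¹ : GL (Fin d) ℝ) : Matrix (Fin d) (Fin d) ℝ))) 0)
      ℙ) :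
    ∃ (Ω' : Set Ω) (Φ : Ω → Matrix (Fin d) (Fin d) ℝ) (p : Ω → ℕ)
      (lam : ∀ ω : Ω, Fin (p ω) → ℝ)
      (E : ∀ ω : Ω, Fin (p ω) → Submodule ℝ (Fin d → ℝ)),
      MeasurableSet Ω' ∧ ℙ Ω' = 1 ∧ (θ : Ω → Ω) ⁻¹' Ω' = Ω' ∧
      ∀ ω ∈ Ω',
        -- existence of the limit `Φ(ω)`
        ((Φ ω).IsSymm ∧ (Φ ω).PosDef ∧
          ∃ R : ℕ → Matrix (Fin d) (Fin d) ℝ,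
            (∀ n : ℕ, 1 ≤ n → (R n).IsSymm ∧ (R n).PosDef ∧
              R n ^ (2 * n) =
                ((φ (n : ℤ) ω : Matrix (Fin d) (Fin d) ℝ))ᵀ *
                  ((φ (n : ℤ) ω : Matrix (Fin d) (Fin d) ℝ))) ∧
            Tendsto R atTop (𝓝 (Φ ω))) ∧
        -- `e^{lam ω 0} > ⋯ > e^{lam ω (p ω - 1)}` are the distinct eigenvalues of `Φ(ω)`
        StrictAnti (lam ω) ∧
        (∀ μ : ℝ,
          Module.End.eigenspace (Matrix.toLin' (Φ ω)) μ ≠ ⊥ ↔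
            ∃ i : Fin (p ω), μ = Real.exp (lam ω i)) ∧
        -- splitting `ℝ^d = E_1(ω) ⊕ ⋯ ⊕ E_{p(ω)}(ω)` with `dim E_i(ω) = d_i(ω)`
        iSupIndep (E ω) ∧ (⨆ i, E ω i) = ⊤ ∧
        (∀ i : Fin (p ω),
          Module.finrank ℝ (E ω i) =
            Module.finrank ℝ
              (Module.End.eigenspace (Matrix.toLin' (Φ ω)) (Real.exp (lam ω i)))) ∧
        -- (a) `A(ω) E_i(ω) = E_i(θω)`
        (∃ hp : p (θ ω) = p ω,
          ∀ i : Fin (p ω),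
            Submodule.map (Matrix.toLin' (A ω : Matrix (Fin d) (Fin d) ℝ)) (E ω i) =
              E (θ ω) (Fin.cast hp.symm i)) ∧
        -- (b) two-sided Lyapunov exponents characterize `E_i(ω)`
        (∀ x : Fin d → ℝ, x ≠ 0 → ∀ i : Fin (p ω),
          (Tendsto
              (fun n : ℤ =>
                (1 / (n : ℝ)) *
                  Real.log (eNorm ((φ n ω : Matrix (Fin d) (Fin d) ℝ) *ᵥ x)))
              atTop (𝓝 (lam ω i)) ∧
            Tendsto
              (fun n : ℤ =>
                (1 / (n : ℝ)) *
                  Real.log (eNorm ((φ n ω : Matrix (Fin d) (Fin d) ℝ) *ᵥ x)))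
              atBot (𝓝 (lam ω i))) ↔ x ∈ E ω i) := by
  obtain ⟨f, hfm, hfi, hf0, h1, h1'⟩ := exists_control ℙ A hA hint₁ hint₂
  obtain ⟨γ, hγ⟩ := good_ae ℙ θ hθmeas hθinv hθpres A hA φ hφ0 hφ1 hφc f hfm hfi hf0 h1 h1'
  obtain ⟨Ω', hΩm, hΩ1, hΩi, hΩg⟩ := inv_set ℙ θ hθmeas hθinv hθpres _ hγ
  classical
  set l : Ω → Fin d → ℝ := fun ω j => γ (j+1) ω - γ j ω with hl
  set M : Ω → ℕ → Matrix (Fin d) (Fin d) ℝ :=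
    fun ω n => (φ n ω : Matrix (Fin d) (Fin d) ℝ) with hM
  set N : Ω → ℕ → Matrix (Fin d) (Fin d) ℝ :=
    fun ω n => (φ (-(n:ℤ)) ω : Matrix (Fin d) (Fin d) ℝ) with hN
  have hW : ∀ ω, ∃ W, ω ∈ Ω' → Pt (M ω) (N ω) (l ω) W := by
    intro ω
    by_cases h : ω ∈ Ω'
    · obtain ⟨W, hW⟩ := good_pt θ A φ hφ0 hφ1 hφc f h1 h1' γ ω (hΩg ω h)
      exact ⟨W, fun _ => hW⟩
    · exact ⟨0, fun h' => absurd h' h⟩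
  choose W hW using hW
  refine ⟨Ω', fun ω => W ω * diagonal (fun j => Real.exp (l ω j)) * (W ω)ᵀ,
    fun ω => (Finset.univ.image (l ω)).card, fun ω => lamOf (l ω),
    fun ω i => sp2 (M ω) (N ω) (lamOf (l ω) i), hΩm, hΩ1, hΩi, fun ω hω => ?_⟩
  have P := hW ω hω
  have hinj := (lamOf_anti (l ω)).injective
  obtain ⟨htop, hdim⟩ := P.split (lamOf (l ω)) hinj fun j => (lamOf_range _ _).2 ⟨j, rfl⟩
  refine ⟨⟨conj_symm _ _, conj_posDef _ P.orth _ fun _ => Real.exp_pos _, P.roots⟩,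
    lamOf_anti _, fun μ => ?_, P.indep _ hinj, htop, fun i => ?_, ?_, fun x hx i => ?_⟩
  · rw [P.eig']
    constructor
    · rintro ⟨j, hj⟩
      obtain ⟨i, hi⟩ := (lamOf_range (l ω) (l ω j)).2 ⟨j, rfl⟩
      exact ⟨i, by simp only; rw [hi, hj]⟩
    · rintro ⟨i, hi⟩
      obtain ⟨j, hj⟩ := (lamOf_range (l ω) _).1 ⟨i, rfl⟩
      exact ⟨j, by simp only at hi; rw [hi, hj]⟩
  · rw [hdim i, P.eig]
  · have hll : l ω = l (θ ω) := by
      ext j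
      have hi := (hΩg ω hω).inv
      simp only [hl]
      rw [hi _ (by omega), hi _ (by omega)]
    have hp : (Finset.univ.image (l (θ ω))).card = (Finset.univ.image (l ω)).card := by rw [hll]
    refine ⟨hp, fun i => ?_⟩
    simp only
    rw [lamOf_cast hll hp i]
    exact map_sp2 θ A φ hφ1 hφc ω _
  · rw [int_lims]
    refine P.lyap _ x hx (fun n => ?_) fun n => ?_
    · exact eNorm_pos (GL_mulVec_ne _ hx)
    · exact eNorm_pos (GL_mulVec_ne _ hx)
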